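/- arXiv:1103.5030 — 2 statements merged into one kernel-verified Lean document; each statement's English description precedes it below -/
import Mathlib

section
/- For every B > 0 there exist constants c = c(B) > 0 and C = C(B) such that for all N ≥ 2, if α = a/q + β with 1 ≤ q ≤ log^B N, gcd(a,q) = 1, and |β| < log^B N / N, then |Λ̂_N(α) − (μ(q)/φ(q)) ν_N(β)| ≤ C · N · e^{−c√(log N)}. -/
open Real Filter

/-- Truncated von Mangoldt function: `Λ_N(n) = log p` if `n = p^j ≤ N`, else `0`. -/
noncomputable def LamN (N : ℕ) (n : ℤ) : ℝ :=
  if 1 ≤ n ∧ n ≤ (N : ℤ) then ArithmeticFunction.vonMangoldt n.toNat else 0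

/-- The exponential sum `Λ̂_N(α) = Σ_{n∈ℤ} Λ_N(n) e^{−2πinα}`. -/
noncomputable def LamHat (N : ℕ) (α : ℝ) : ℂ :=
  ∑' n : ℤ, (LamN N n : ℂ) * Complex.exp (-2 * Real.pi * Complex.I * n * α)

/-- `ν_N(β) = Σ_{n=1}^{N} e^{−2πinβ}`. -/
noncomputable def nuN (N : ℕ) (β : ℝ) : ℂ :=
  ∑ n ∈ Finset.Icc 1 N, Complex.exp (-2 * Real.pi * Complex.I * n * β)

lemma sw_bc {f : ℂ → ℂ} (hf : Differentiable ℂ f) {c : ℂ} {r m : ℝ} (hr : 0 < r) (hm : 0 < m)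
    (hb : ∀ z ∈ Metric.ball c r, ‖f z‖ ≤ Real.exp m * ‖f c‖)
    (hnz : ∀ z ∈ Metric.ball c r, f z ≠ 0) :
    ∀ z ∈ Metric.closedBall c (r/2), ‖deriv f z / f z‖ ≤ 30 * m / r := by
  have hlog : DifferentiableOn ℂ (fun z => deriv f z / f z) (Metric.ball c r) :=
    (hf.deriv.differentiableOn).div hf.differentiableOn hnz
  obtain ⟨h, hh⟩ := hlog.isExactOn_ball
  have hc : c ∈ Metric.ball c r := Metric.mem_ball_self hr
  -- f z = f c * exp (h z - h c)
  have key : ∀ z ∈ Metric.ball c r, f z * Complex.exp (-(h z)) = f c * Complex.exp (-(h c)) := by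
    intro z hz
    refine (convex_ball c r).is_const_of_fderivWithin_eq_zero (𝕜 := ℂ)
      (f := fun z => f z * Complex.exp (-(h z))) ?_ ?_ hz hc
    · intro w hw
      exact ((hf w).mul (hh w hw).differentiableAt.neg.cexp).differentiableWithinAt
    · intro w hw
      rw [fderivWithin_of_isOpen Metric.isOpen_ball hw]
      have h1 : HasDerivAt (fun z => f z * Complex.exp (-(h z))) 0 w := by
        have e := (hf w).hasDerivAt.mul ((hh w hw).neg.cexp)
        have h3 : f w * (deriv f w / f w) = deriv f w := mul_div_cancel₀ _ (hnz w hw)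
        refine e.congr_deriv ?_
        simp only [Pi.neg_apply]
        linear_combination (-Complex.exp (-(h w))) * h3
      simpa using h1.hasFDerivAt.fderiv
  have hre : ∀ z ∈ Metric.ball c r, (h z - h c).re ≤ m := by
    intro z hz
    have h1 : f z = f c * Complex.exp (h z - h c) := by
      have := key z hz
      rw [Complex.exp_neg, Complex.exp_neg] at this
      rw [Complex.exp_sub]
      field_simp [Complex.exp_ne_zero] at this ⊢
      exact this
    have h2 := hb z hz
    rw [h1, norm_mul, Complex.norm_exp, mul_comm] at h2
    have := le_of_mul_le_mul_right h2 (norm_pos_iff.mpr (hnz c hc))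
    exact Real.exp_le_exp.mp this
  have hbd : ∀ w ∈ Metric.ball c (3*r/4), ‖h w - h c‖ ≤ 6 * m := by
    intro w hw
    have := Complex.borelCaratheodory_zero (f := fun z => h (c + z) - h c) (z := w - c) (R := r) hm
      ?_ ?_ hr ?_ (by simp)
    · simp only [add_sub_cancel] at this
      refine this.trans ?_
      rw [Metric.mem_ball, dist_eq_norm] at hw
      rw [div_le_iff₀ (by linarith)]
      nlinarith
    · intro z hz
      have hz' : c + z ∈ Metric.ball c r := by simpa using hz
      have := (hh _ hz').differentiableAt
      have h3 : DifferentiableAt ℂ (fun z => h (c + z)) z := by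
        apply DifferentiableAt.comp z (f := fun z => c + z) (g := h) this (by fun_prop)
      exact (h3.sub_const _).differentiableWithinAt
    · intro z hz
      exact hre _ (by simpa using hz)
    · rw [Metric.mem_ball, dist_eq_norm] at hw
      simp; linarith
  intro z hz
  rw [Metric.mem_closedBall] at hz
  have hsub : ∀ w ∈ Metric.ball z (r/4), w ∈ Metric.ball c (3*r/4) := by
    intro w hw
    rw [Metric.mem_ball] at *
    have := dist_triangle w z c; linarith
  have hzr : z ∈ Metric.ball c r := by rw [Metric.mem_ball]; linarith
  have hd : DifferentiableOn ℂ (fun w => h w - h c) (Metric.closedBall z (r/4)) := by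
    intro w hw
    have : w ∈ Metric.ball c r := by
      rw [Metric.mem_ball]; rw [Metric.mem_closedBall] at hw
      have := dist_triangle w z c; linarith
    exact ((hh w this).differentiableAt.sub_const _).differentiableWithinAt
  have hfin : ∀ r' ∈ Set.Ioo 0 (r/4), ‖deriv f z / f z‖ * r' ≤ 6 * m := by
    intro r' hr'
    have := Complex.norm_deriv_le_of_forall_mem_sphere_norm_le (c := z) (R := r') (C := 6 * m)
      (f := fun w => h w - h c) hr'.1 ?_ ?_
    · rw [((hh z hzr).sub_const (h c)).deriv] at this
      rwa [le_div_iff₀ hr'.1] at this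
    · apply DifferentiableOn.diffContOnCl
      rw [closure_ball _ hr'.1.ne']
      exact hd.mono (Metric.closedBall_subset_closedBall hr'.2.le)
    · intro w hw
      apply hbd w (hsub w _)
      rw [Metric.mem_sphere] at hw
      rw [Metric.mem_ball, hw]; exact hr'.2
  have h4 := hfin (r/5) ⟨by linarith, by linarith⟩
  rw [le_div_iff₀ hr]; linarith

/-- dividing out a zero by a Blaschke factor -/
lemma sw_blaschke {f : ℂ → ℂ} (hf : Differentiable ℂ f) {R M : ℝ} (hR : 0 < R)
    (hb : ∀ z ∈ Metric.closedBall (0:ℂ) R, ‖f z‖ ≤ M) (h0 : f 0 ≠ 0) {ρ : ℂ}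
    (hρ : ρ ∈ Metric.ball (0:ℂ) R) (hfρ : f ρ = 0) :
    ∃ g : ℂ → ℂ, Differentiable ℂ g ∧ (∀ z ∈ Metric.closedBall (0:ℂ) R, ‖g z‖ ≤ M) ∧
      ‖g 0‖ * ‖ρ‖ = ‖f 0‖ * R ∧ g 0 ≠ 0 ∧ (∀ z ∈ Metric.ball (0:ℂ) R, g z = 0 → f z = 0) ∧
      (deriv f 0 / f 0).re = (deriv g 0 / g 0).re + (-ρ.re) * (1/‖ρ‖^2 - 1/R^2) := by
  have hρ0 : ρ ≠ 0 := by rintro rfl; exact h0 hfρ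
  have hρR : ‖ρ‖ < R := by simpa using hρ
  have hRc : (R:ℂ) ≠ 0 := by exact_mod_cast hR.ne'
  set D := dslope f ρ with hD
  have hDd : Differentiable ℂ D := by
    have := (Complex.differentiableOn_dslope (f := f) (c := ρ) (s := Set.univ) (by simp)).mpr
      hf.differentiableOn
    exact differentiableOn_univ.mp this
  set P : ℂ → ℂ := fun z => (R^2 - (starRingEnd ℂ) ρ * z)/R with hP
  have hPd : Differentiable ℂ P := by intro z; simp only [hP]; fun_prop
  have hfD : ∀ z, f z = (z - ρ) * D z := by
    intro z
    have := sub_smul_dslope f ρ z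
    rw [hfρ, sub_zero, smul_eq_mul] at this
    exact this.symm
  have hPne : ∀ z ∈ Metric.ball (0:ℂ) R, P z ≠ 0 := by
    intro z hz h
    have hz' : ‖z‖ < R := by simpa using hz
    simp only [hP, div_eq_zero_iff, hRc, or_false] at h
    have h1 : ‖(R:ℂ)^2‖ = ‖(starRingEnd ℂ) ρ * z‖ := by rw [sub_eq_zero.mp h]
    rw [norm_mul, RCLike.norm_conj, norm_pow, Complex.norm_real, Real.norm_eq_abs, abs_of_pos hR] at h1
    nlinarith [norm_nonneg z, norm_nonneg ρ]
  have hD0 : f 0 = -ρ * D 0 := by rw [hfD 0]; ring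
  have hD0ne : D 0 ≠ 0 := by intro h; apply h0; rw [hD0, h, mul_zero]
  have hP0 : P 0 = R := by simp only [hP]; field_simp; ring
  refine ⟨fun z => D z * P z, hDd.mul hPd, ?_, ?_, ?_, ?_, ?_⟩
  · intro z hz
    refine Complex.norm_le_of_forall_mem_frontier_norm_le (U := Metric.ball (0:ℂ) R)
      Metric.isBounded_ball (hDd.mul hPd).diffContOnCl ?_ (by rwa [closure_ball _ hR.ne'])
    intro w hw
    rw [frontier_ball _ hR.ne'] at hw
    have hwR : ‖w‖ = R := by simpa using hw
    have hne : w - ρ ≠ 0 := by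
      intro h; rw [sub_eq_zero.mp h] at hwR; linarith
    have hnP : ‖P w‖ = ‖w - ρ‖ := by
      have e1 : (R:ℂ)^2 - (starRingEnd ℂ) ρ * w = w * (starRingEnd ℂ) (w - ρ) := by
        have : w * (starRingEnd ℂ) w = (R:ℂ)^2 := by
          rw [Complex.mul_conj, Complex.normSq_eq_norm_sq, hwR]; push_cast; rfl
        rw [map_sub, mul_sub, this]; ring
      simp only [hP]
      rw [e1, norm_div, norm_mul, RCLike.norm_conj, hwR, Complex.norm_real, Real.norm_eq_abs,
        abs_of_pos hR]
      field_simp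
    have : ‖D w * P w‖ = ‖f w‖ := by rw [hfD w, norm_mul, norm_mul, hnP, mul_comm]
    exact this.le.trans (hb w (by simp [hwR]))
  · simp only [hP0, hD0]
    rw [norm_mul, norm_mul, norm_neg, Complex.norm_real, Real.norm_eq_abs, abs_of_pos hR]; ring
  · simp only [hP0]; exact mul_ne_zero hD0ne hRc
  · intro z hz h
    rcases mul_eq_zero.mp h with h | h
    · rw [hfD z, h, mul_zero]
    · exact absurd h (hPne z hz)
  · have d1 : deriv f 0 = D 0 + (-ρ) * deriv D 0 := by
      have h1 : HasDerivAt f (1 * D 0 + (0 - ρ) * deriv D 0) 0 := by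
        have := ((hasDerivAt_id (0:ℂ)).sub_const ρ).mul (hDd 0).hasDerivAt
        exact this.congr_of_eventuallyEq (Eventually.of_forall hfD)
      rw [h1.deriv]; ring
    have d2 : deriv (fun z => D z * P z) 0 = deriv D 0 * R + D 0 * (-(starRingEnd ℂ) ρ / R) := by
      have h2 : HasDerivAt P ((0 - (starRingEnd ℂ) ρ * 1)/R) 0 :=
        (((hasDerivAt_const (0:ℂ) ((R:ℂ)^2)).sub ((hasDerivAt_id (0:ℂ)).const_mul _)).div_const _)
      refine ((hDd 0).hasDerivAt.mul h2).deriv.trans ?_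
      rw [hP0]; ring
    have e : deriv f 0 / f 0 = deriv (fun z => D z * P z) 0 / (D 0 * P 0)
        + (-ρ⁻¹ + (starRingEnd ℂ) ρ / R^2) := by
      rw [d1, d2, hD0, hP0]; field_simp; ring
    rw [e, Complex.add_re]
    congr 1
    have : ((starRingEnd ℂ) ρ / (R:ℂ)^2).re = ρ.re / R^2 := by
      rw [← Complex.ofReal_pow, Complex.div_ofReal_re, Complex.conj_re]
    rw [Complex.add_re, this, Complex.neg_re, Complex.inv_re, Complex.normSq_eq_norm_sq]
    ring

lemma sw_local_aux (n : ℕ) : ∀ {f : ℂ → ℂ} (_ : Differentiable ℂ f) {R M m : ℝ} (_ : 0 < R)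
    (_ : 0 < m) (_ : ∀ z ∈ Metric.closedBall (0:ℂ) R, ‖f z‖ ≤ M) (_ : f 0 ≠ 0)
    (_ : ∀ z ∈ Metric.ball (0:ℂ) R, f z = 0 → z.re ≤ 0) (_ : M ≤ Real.exp m * ‖f 0‖)
    (_ : M < ‖f 0‖ * 2^n), -(60 * m / R) ≤ (deriv f 0 / f 0).re := by
  induction n with
  | zero =>
    intro f _ R M m hR hm hb _ _ _ hn
    have := hb 0 (by simp [hR.le])
    simp at hn; linarith
  | succ n ih =>
    intro f hf R M m hR hm hb h0 hz hM hn
    by_cases h : ∃ ρ ∈ Metric.ball (0:ℂ) (R/2), f ρ = 0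
    · obtain ⟨ρ, hρ, hfρ⟩ := h
      have hρ2 : ‖ρ‖ < R/2 := by simpa using hρ
      have hρR : ρ ∈ Metric.ball (0:ℂ) R := by simp; linarith
      have hρ0 : 0 < ‖ρ‖ := by rw [norm_pos_iff]; rintro rfl; exact h0 hfρ
      obtain ⟨g, hg, hgb, hg0, hgne, hgz, hre⟩ := sw_blaschke hf hR hb h0 hρR hfρ
      have hge : 2 * ‖f 0‖ ≤ ‖g 0‖ := by
        have hf0 := norm_nonneg (f 0)
        by_contra hcon
        push Not at hcon
        nlinarith [norm_nonneg (g 0)]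
      have := ih hg hR hm hgb hgne (fun z hz1 hz2 => hz z hz1 (hgz z hz1 hz2))
        (hM.trans (by gcongr; linarith [norm_nonneg (f 0)])) (by
          rw [pow_succ] at hn
          have : ‖f 0‖ * (2^n*2) ≤ ‖g 0‖ * 2^n := by
            nlinarith [pow_pos (two_pos : (0:ℝ) < 2) n]
          linarith)
      rw [hre]
      have h1 : 0 ≤ (-ρ.re) * (1/‖ρ‖^2 - 1/R^2) := by
        apply mul_nonneg
        · linarith [hz ρ hρR hfρ]
        · rw [sub_nonneg]
          apply one_div_le_one_div_of_le (by positivity)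
          gcongr; linarith
      linarith
    · push Not at h
      have := sw_bc hf (c := 0) (r := R/2) (by linarith) hm
        (fun z hz => (hb z (by simp at *; linarith)).trans hM) h 0 (by simp; linarith)
      have h2 := (abs_le.mp ((Complex.abs_re_le_norm _).trans this)).1
      have e : 30 * m / (R/2) = 60 * m / R := by field_simp; norm_num
      rw [e] at h2; exact h2

lemma sw_local0 {f : ℂ → ℂ} (hf : Differentiable ℂ f) {R M m : ℝ} (hR : 0 < R)
    (hm : 0 < m) (hb : ∀ z ∈ Metric.closedBall (0:ℂ) R, ‖f z‖ ≤ M) (h0 : f 0 ≠ 0)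
    (hz : ∀ z ∈ Metric.ball (0:ℂ) R, f z = 0 → z.re ≤ 0) (hM : M ≤ Real.exp m * ‖f 0‖) :
    -(60 * m / R) ≤ (deriv f 0 / f 0).re := by
  obtain ⟨n, hn⟩ := pow_unbounded_of_one_lt (M / ‖f 0‖) (one_lt_two)
  refine sw_local_aux n hf hR hm hb h0 hz hM ?_
  rw [div_lt_iff₀ (norm_pos_iff.mpr h0)] at hn
  linarith

/-- local lemma at general centre, no zero -/
lemma sw_local1 {f : ℂ → ℂ} (hf : Differentiable ℂ f) {s : ℂ} {R m : ℝ} (hR : 0 < R)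
    (hm : 0 < m) (hb : ∀ z ∈ Metric.closedBall s R, ‖f z‖ ≤ Real.exp m * ‖f s‖) (h0 : f s ≠ 0)
    (hz : ∀ z ∈ Metric.ball s R, f z = 0 → z.re ≤ s.re) :
    -(60 * m / R) ≤ (deriv f s / f s).re := by
  have hd : deriv (fun z => f (s + z)) 0 = deriv f s := by
    rw [deriv_comp_const_add]; simp
  have := sw_local0 (f := fun z => f (s + z)) (R := R) (m := m) (hf.comp (by fun_prop)) hR hm
    (fun z hz => hb (s + z) (by simpa using hz)) (by simpa using h0)
    (fun z hz1 hz2 => by have := hz (s+z) (by simpa using hz1) hz2; simpa using this)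
    (by simp)
  simpa [hd] using this

/-- local lemma at general centre, one zero -/
lemma sw_local2 {f : ℂ → ℂ} (hf : Differentiable ℂ f) {s : ℂ} {R m : ℝ} (hR : 0 < R)
    (hm : 0 < m) (hb : ∀ z ∈ Metric.closedBall s R, ‖f z‖ ≤ Real.exp m * ‖f s‖) (h0 : f s ≠ 0)
    (hz : ∀ z ∈ Metric.ball s R, f z = 0 → z.re ≤ s.re) {w : ℝ} (hw : 0 < w) (hwR : w < R)
    (hzero : f (s - w) = 0) :
    -(60 * m / R) + (1 / w - 1/R) ≤ (deriv f s / f s).re := by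
  have hd : deriv (fun z => f (s + z)) 0 = deriv f s := by
    rw [deriv_comp_const_add]; simp
  obtain ⟨g, hg, hgb, hg0, hgne, hgz, hre⟩ := sw_blaschke (f := fun z => f (s + z)) (R := R)
    (M := Real.exp m * ‖f s‖) (hf.comp (by fun_prop)) hR
    (fun z hz => hb (s + z) (by simpa using hz)) (by simpa using h0) (ρ := -(w:ℂ))
    (by simp [abs_of_pos hw, hwR]) (by simpa [sub_eq_add_neg] using hzero)
  simp only [norm_neg, Complex.norm_real, Real.norm_eq_abs, abs_of_pos hw, add_zero,
    Complex.neg_re, Complex.ofReal_re, neg_neg, hd] at hg0 hre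
  have hge : ‖f s‖ ≤ ‖g 0‖ := by
    by_contra hcon
    push Not at hcon
    nlinarith [norm_nonneg (g 0), norm_nonneg (f s)]
  have := sw_local0 hg hR hm hgb hgne
    (fun z hz1 hz2 => by
      have := hz (s+z) (by simpa using hz1) (hgz z hz1 hz2); simpa using this)
    (by gcongr)
  rw [hre]
  have e : w * (1 / w^2 - 1/R^2) = 1/w - w/R^2 := by field_simp
  have e2 : w / R^2 ≤ 1 / R := by rw [div_le_div_iff₀ (by positivity) hR]; nlinarith
  linarith

theorem sw_ext {f : ℂ → ℂ} (hf : Differentiable ℂ f) {A : ℝ → ℂ} (hA : Measurable A) {K : ℝ}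
    (hK : ∀ u : ℝ, 1 < u → ‖A u‖ ≤ K)
    (h : ∀ s : ℂ, 1 < s.re → f s = s * ∫ u in Set.Ioi (1:ℝ), A u * (u:ℂ) ^ (-(s + 1))) :
    ∀ s : ℂ, 0 < s.re → f s = s * ∫ u in Set.Ioi (1:ℝ), A u * (u:ℂ) ^ (-(s + 1)) := by
  classical
  set g : ℝ → ℂ := (Set.Ioi (1:ℝ)).indicator A with hg
  have hK0 : 0 ≤ K := (norm_nonneg _).trans (hK 2 (by norm_num))
  have hgb : ∀ u, ‖g u‖ ≤ K := by
    intro u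
    by_cases hu : u ∈ Set.Ioi (1:ℝ)
    · rw [hg, Set.indicator_of_mem hu]; exact hK u hu
    · rw [hg, Set.indicator_of_notMem hu]; simpa using hK0
  have hgm : Measurable g := hA.indicator measurableSet_Ioi
  have hmel : ∀ s : ℂ, mellin g (-s) = ∫ u in Set.Ioi (1:ℝ), A u * (u:ℂ) ^ (-(s + 1)) := by
    intro s
    rw [mellin]
    have : ∀ t : ℝ, ((t:ℂ) ^ (-s - 1)) • g t
        = (Set.Ioi (1:ℝ)).indicator (fun u => A u * (u:ℂ) ^ (-(s + 1))) t := by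
      intro t
      by_cases hu : t ∈ Set.Ioi (1:ℝ)
      · rw [hg, Set.indicator_of_mem hu, Set.indicator_of_mem hu, smul_eq_mul, mul_comm]
        congr 2; ring
      · rw [hg, Set.indicator_of_notMem hu, Set.indicator_of_notMem hu]; simp
    simp_rw [this]
    rw [MeasureTheory.setIntegral_indicator measurableSet_Ioi]
    congr 2
    ext x; simp
  have hloc : MeasureTheory.LocallyIntegrableOn g (Set.Ioi 0) := by
    apply MeasureTheory.LocallyIntegrable.locallyIntegrableOn
    have hc : MeasureTheory.LocallyIntegrable (fun _ : ℝ => K) MeasureTheory.volume :=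
      MeasureTheory.locallyIntegrable_const K
    refine hc.mono hgm.aestronglyMeasurable ?_
    filter_upwards with x
    simpa [abs_of_nonneg hK0] using hgb x
  have hdiff : ∀ s : ℂ, 0 < s.re → DifferentiableAt ℂ (mellin g) (-s) := by
    intro s hs
    refine mellin_differentiableAt_of_isBigO_rpow (a := 0) (b := -s.re - 1) hloc ?_ (by simpa using hs) ?_ (by simp)
    · refine Asymptotics.IsBigO.of_bound K ?_
      filter_upwards with x
      simpa using hgb x
    · refine Asymptotics.IsBigO.of_bound 0 ?_
      have : Set.Iio (1:ℝ) ∈ nhdsWithin (0:ℝ) (Set.Ioi 0) :=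
        mem_nhdsWithin_of_mem_nhds (Iio_mem_nhds (by norm_num))
      filter_upwards [this] with x hx
      rw [hg, Set.indicator_of_notMem (by simpa using (le_of_lt hx))]
      simp
  have hd2 : DifferentiableOn ℂ (fun s => s * mellin g (-s)) {s : ℂ | 0 < s.re} := by
    intro s hs
    refine (DifferentiableAt.mul differentiableAt_id ?_).differentiableWithinAt
    exact DifferentiableAt.comp (g := mellin g) (f := fun s => -s) s (hdiff s hs) differentiableAt_id.neg
  have hopen : IsOpen {s : ℂ | 0 < s.re} := isOpen_lt continuous_const Complex.continuous_re
  have heq : Set.EqOn f (fun s => s * mellin g (-s)) {s : ℂ | 0 < s.re} := by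
    refine AnalyticOnNhd.eqOn_of_preconnected_of_eventuallyEq (z₀ := (2:ℂ))
      (hf.differentiableOn.analyticOnNhd hopen) (hd2.analyticOnNhd hopen) ?_ (by simp) ?_
    · exact (convex_halfSpace_re_gt 0).isPreconnected
    · have : {s : ℂ | 1 < s.re} ∈ nhds (2:ℂ) :=
        (isOpen_lt continuous_const Complex.continuous_re).mem_nhds (by simp)
      filter_upwards [this] with s hs
      rw [hmel]; exact h s hs
  intro s hs
  rw [heq hs]
  simp only [hmel]

theorem sw_intbound {A : ℝ → ℂ} {K η : ℝ} (hK : ∀ u : ℝ, 1 < u → ‖A u‖ ≤ K * u ^ (1 - η))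
    {s : ℂ} (hs : 1 - η < s.re) :
    ‖∫ u in Set.Ioi (1:ℝ), A u * (u:ℂ) ^ (-(s + 1))‖ ≤ K / (s.re + η - 1) := by
  have hexp : -η - s.re < -1 := by linarith
  have h1 : ∫ u in Set.Ioi (1:ℝ), K * u ^ (-η - s.re) = K / (s.re + η - 1) := by
    rw [MeasureTheory.integral_const_mul, integral_Ioi_rpow_of_lt hexp one_pos]
    rw [Real.one_rpow]
    have h3 : -η - s.re + 1 ≠ 0 := by linarith
    have h4 : s.re + η - 1 ≠ 0 := by linarith
    field_simp
    ring
  rw [← h1]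
  refine MeasureTheory.norm_integral_le_of_norm_le
    ((integrableOn_Ioi_rpow_of_lt hexp one_pos).const_mul K) ?_
  filter_upwards [MeasureTheory.ae_restrict_mem measurableSet_Ioi] with u hu
  have hu1 : (1:ℝ) < u := hu
  have hu0 : 0 < u := by linarith
  rw [norm_mul, Complex.norm_cpow_eq_rpow_re_of_pos hu0]
  calc _ ≤ (K * u ^ (1 - η)) * u ^ (-(s+1)).re := by
        gcongr; exact hK u hu1
    _ = _ := by
        rw [mul_assoc, ← Real.rpow_add hu0]; congr 2; simp; ring

theorem sw_charsum_bound {q : ℕ} [NeZero q] {χ : DirichletCharacter ℂ q} (hχ : χ ≠ 1) (n : ℕ) :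
    ‖∑ k ∈ Finset.Icc 1 n, χ k‖ ≤ q := by
  have hper : ∀ m : ℕ, ∑ k ∈ Finset.Ico m (m+q), χ (k:ZMod q) = 0 := by
    intro m
    rw [← MulChar.sum_eq_zero_of_ne_one hχ]
    refine Finset.sum_bij (fun k _ => (k : ZMod q)) (by simp) ?_ ?_ (by simp)
    · intro a ha b hb hab
      rw [ZMod.natCast_eq_natCast_iff] at hab
      simp only [Finset.mem_Ico] at ha hb
      have := (Nat.modEq_iff_dvd.1 hab)
      obtain ⟨c, hc⟩ := this
      have h1 : (b:ℤ) - a < q := by omega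
      have h2 : -(q:ℤ) < (b:ℤ) - a := by omega
      have hq : (0:ℤ) < q := by have := NeZero.pos q; omega
      have : c = 0 := by
        rw [hc] at h1 h2
        have : c < 1 := by nlinarith
        have : -1 < c := by nlinarith
        omega
      subst this; simp at hc; omega
    · intro b _
      refine ⟨m + ((b - (m:ZMod q)).val), ?_, ?_⟩
      · simp [ZMod.val_lt]
      · simp
  induction n using Nat.strong_induction_on with
  | _ n ih =>
    by_cases hn : n ≤ q
    · calc _ ≤ ∑ k ∈ Finset.Icc 1 n, ‖χ (k:ZMod q)‖ := norm_sum_le _ _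
        _ ≤ ∑ k ∈ Finset.Icc 1 n, (1:ℝ) := Finset.sum_le_sum fun k _ => χ.norm_le_one k
        _ ≤ q := by simpa using hn
    · have h0 := NeZero.pos q
      have : ∑ k ∈ Finset.Icc 1 n, χ (k:ZMod q) = ∑ k ∈ Finset.Icc 1 (n-q), χ (k:ZMod q) := by
        have e1 : Finset.Icc 1 n = Finset.Ico 1 (n+1) := by ext; simp
        have e2 : Finset.Icc 1 (n-q) = Finset.Ico 1 (n+1-q) := by ext; simp; try omega
        have h2 := hper (n+1-q)
        rw [show n+1-q+q = n+1 by omega] at h2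
        rw [e1, e2, ← Finset.sum_Ico_consecutive _ (show 1 ≤ n+1-q by omega) (show n+1-q ≤ n+1 by omega), h2, add_zero]
      rw [this]
      exact ih _ (by omega)

theorem sw_Lint {q : ℕ} [NeZero q] {χ : DirichletCharacter ℂ q} (hχ : χ ≠ 1) {s : ℂ} (hs : 0 < s.re) :
    DirichletCharacter.LFunction χ s = s * ∫ u in Set.Ioi (1:ℝ),
      (∑ k ∈ Finset.Icc 1 ⌊u⌋₊, χ (k : ZMod q)) * (u:ℂ) ^ (-(s + 1)) := by
  refine sw_ext (K := q) (DirichletCharacter.differentiable_LFunction hχ) ?_ ?_ ?_ s hs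
  · exact (measurable_from_nat (f := fun n : ℕ => ∑ k ∈ Finset.Icc 1 n, χ (k : ZMod q))).comp Nat.measurable_floor
  · intro u _; exact sw_charsum_bound hχ _
  · intro s hs
    rw [DirichletCharacter.LFunction_eq_LSeries χ hs]
    refine LSeries_eq_mul_integral _ (r := 0) le_rfl (by linarith)
      (χ.LSeriesSummable_of_one_lt_re hs) ?_
    refine Asymptotics.IsBigO.of_bound q ?_
    filter_upwards with n
    simpa using sw_charsum_bound hχ n

theorem sw_L_bound {q : ℕ} [NeZero q] {χ : DirichletCharacter ℂ q} (hχ : χ ≠ 1) {η : ℝ}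
    (h0 : 0 ≤ η) (h1 : η ≤ 1) {s : ℂ} (hs0 : 0 < s.re) (hs : 1 - η < s.re) :
    ‖DirichletCharacter.LFunction χ s‖ ≤ ‖s‖ * ((q:ℝ) ^ η / (s.re + η - 1)) := by
  rw [sw_Lint hχ hs0, norm_mul]
  gcongr
  refine sw_intbound (fun u hu => ?_) hs
  have hu0 : 0 < u := by linarith
  have hq0 : (0:ℝ) ≤ q := by positivity
  have ha := sw_charsum_bound hχ ⌊u⌋₊
  have hb : ‖∑ k ∈ Finset.Icc 1 ⌊u⌋₊, χ (k : ZMod q)‖ ≤ u := by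
    calc _ ≤ ∑ k ∈ Finset.Icc 1 ⌊u⌋₊, ‖χ (k:ZMod q)‖ := norm_sum_le _ _
        _ ≤ ∑ k ∈ Finset.Icc 1 ⌊u⌋₊, (1:ℝ) := Finset.sum_le_sum fun k _ => χ.norm_le_one k
        _ ≤ u := by simpa using Nat.floor_le hu0.le
  set x := ‖∑ k ∈ Finset.Icc 1 ⌊u⌋₊, χ (k : ZMod q)‖
  have hx : 0 ≤ x := norm_nonneg _
  calc x = x ^ η * x ^ (1 - η) := by
        rcases hx.eq_or_lt with h | h
        · rw [← h]
          rcases h0.eq_or_lt with h' | h'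
          · rw [← h']; simp
          · rw [Real.zero_rpow h'.ne']; simp
        · rw [← Real.rpow_add h]; simp
    _ ≤ _ := by
      gcongr

theorem sw_zint {s : ℂ} (hs : 0 < s.re) :
    riemannZeta₀ s - 1 = s * ∫ u in Set.Ioi (1:ℝ), ((⌊u⌋₊:ℂ) - u) * (u:ℂ) ^ (-(s + 1)) := by
  refine sw_ext (K := 1) (f := fun s => riemannZeta₀ s - 1) (differentiable_riemannZeta₀.sub_const 1) ?_ ?_ ?_ s hs
  · exact ((measurable_from_nat (f := fun n : ℕ => (n:ℂ))).comp Nat.measurable_floor).sub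
      Complex.measurable_ofReal
  · intro u hu
    have h1 := Nat.floor_le (show 0 ≤ u by linarith)
    have h2 := Nat.lt_floor_add_one u
    rw [show ((⌊u⌋₊:ℂ) - u) = ((⌊u⌋₊ - u : ℝ) : ℂ) by simp, Complex.norm_real, Real.norm_eq_abs, abs_le]
    constructor <;> linarith
  · intro s hs
    have hne : s ≠ 1 := by rintro rfl; simp at hs
    have hz := LSeries_eq_mul_integral (fun _ => (1:ℂ)) (r := 1) zero_le_one (s := s) hs
      (LSeriesSummable_one_iff.2 hs) (by
        refine Asymptotics.IsBigO.of_bound 1 ?_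
        filter_upwards with n
        simp)
    have hz1 : LSeries (fun _ => (1:ℂ)) s = riemannZeta s := LSeries_one_eq_riemannZeta hs
    rw [hz1] at hz
    have hcp : ∀ u ∈ Set.Ioi (1:ℝ), (u:ℂ) * (u:ℂ) ^ (-(s + 1)) = (u:ℂ) ^ (-s) := by
      intro u hu
      have hu0 : (u:ℂ) ≠ 0 := by
        have : (1:ℝ) < u := hu
        exact_mod_cast (by linarith : (0:ℝ) < u).ne'
      nth_rewrite 1 [← Complex.cpow_one (u:ℂ)]
      rw [← Complex.cpow_add _ _ hu0]; congr 1; ring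
    have hu : ∫ u in Set.Ioi (1:ℝ), (u:ℂ) * (u:ℂ) ^ (-(s + 1)) = 1 / (s - 1) := by
      have : ∫ u in Set.Ioi (1:ℝ), (u:ℂ) * (u:ℂ) ^ (-(s + 1)) = ∫ u in Set.Ioi (1:ℝ), (u:ℂ) ^ (-s) :=
        MeasureTheory.setIntegral_congr_fun measurableSet_Ioi hcp
      rw [this, integral_Ioi_cpow_of_lt (by simpa using hs) one_pos]
      have h3 : s - 1 ≠ 0 := sub_ne_zero.2 hne
      have h4 : -s + 1 ≠ 0 := by intro h; apply h3; linear_combination -h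
      rw [Complex.ofReal_one, Complex.one_cpow]
      field_simp
      ring
    have i1 : MeasureTheory.IntegrableOn (fun u : ℝ => (u:ℂ) * (u:ℂ) ^ (-(s + 1))) (Set.Ioi 1) := by
      refine (integrableOn_Ioi_cpow_of_lt (a := -s) (by simpa using hs) one_pos).congr_fun (fun u hu => ?_) measurableSet_Ioi
      exact (hcp u hu).symm
    have i2 : MeasureTheory.IntegrableOn (fun u : ℝ => (⌊u⌋₊:ℂ) * (u:ℂ) ^ (-(s + 1))) (Set.Ioi 1) := by
      refine MeasureTheory.Integrable.mono i1 ?_ ?_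
      · refine Measurable.aestronglyMeasurable ?_
        refine ((measurable_from_nat (f := fun n : ℕ => (n:ℂ))).comp Nat.measurable_floor).mul ?_
        exact Complex.measurable_ofReal.pow_const _
      · filter_upwards [MeasureTheory.ae_restrict_mem measurableSet_Ioi] with u hu
        have hu1 : (1:ℝ) < u := hu
        rw [norm_mul, norm_mul]
        gcongr
        rw [Complex.norm_natCast, Complex.norm_real, Real.norm_of_nonneg (by linarith)]
        exact Nat.floor_le (by linarith)
    simp only [sub_mul]
    rw [MeasureTheory.integral_sub i2 i1, hu, mul_sub]
    simp only [Finset.sum_const, Nat.card_Icc, add_tsub_cancel_right, nsmul_eq_mul, mul_one] at hz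
    rw [← hz, riemannZeta_eq_inv_sub_add hne]
    have : s - 1 ≠ 0 := sub_ne_zero.2 hne
    field_simp
    ring

theorem sw_z0_bound {s : ℂ} (hs : 0 < s.re) : ‖riemannZeta₀ s‖ ≤ 1 + ‖s‖ / s.re := by
  have h := sw_zint hs
  have : riemannZeta₀ s = 1 + s * ∫ u in Set.Ioi (1:ℝ), ((⌊u⌋₊:ℂ) - u) * (u:ℂ) ^ (-(s + 1)) := by
    rw [← h]; ring
  rw [this]
  refine (norm_add_le _ _).trans ?_
  rw [norm_one, norm_mul, div_eq_mul_inv]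
  gcongr
  refine (sw_intbound (K := 1) (η := 1) (fun u hu => ?_) (by linarith)).trans_eq (by simp)
  have h1 := Nat.floor_le (show 0 ≤ u by linarith)
  have h2 := Nat.lt_floor_add_one u
  rw [show ((⌊u⌋₊:ℂ) - u) = ((⌊u⌋₊ - u : ℝ) : ℂ) by simp, Complex.norm_real, Real.norm_eq_abs]
  simp
  rw [abs_le]
  constructor <;> linarith

theorem sw_LS_bound {f : ℕ → ℂ} (hf : ∀ n, ‖f n‖ ≤ 1) {s : ℂ} (hs : 1 < s.re) :
    ‖LSeries f s‖ ≤ 1 / (s.re - 1) + 2 := by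
  have hsum : Summable (fun n : ℕ => 1 / (n:ℝ) ^ s.re) := Real.summable_one_div_nat_rpow.2 hs
  have h1 : ‖LSeries f s‖ ≤ ∑' n : ℕ, 1 / (n:ℝ) ^ s.re := by
    refine tsum_of_norm_bounded hsum.hasSum fun n => ?_
    rw [LSeries.norm_term_eq]
    split_ifs with h
    · positivity
    · gcongr; exact hf n
  have h2 : ((∑' n : ℕ, 1 / (n:ℝ) ^ s.re : ℝ) : ℂ) = riemannZeta (s.re : ℂ) := by
    rw [zeta_eq_tsum_one_div_nat_cpow (by simpa using hs), Complex.ofReal_tsum]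
    refine tsum_congr fun n => ?_
    rw [Complex.ofReal_div, Complex.ofReal_cpow (by positivity)]
    simp
  have h3 : (∑' n : ℕ, 1 / (n:ℝ) ^ s.re : ℝ) = ‖riemannZeta (s.re : ℂ)‖ := by
    rw [← h2, Complex.norm_real, Real.norm_of_nonneg (tsum_nonneg fun n => by positivity)]
  rw [h3] at h1
  refine h1.trans ?_
  have hne : (s.re : ℂ) ≠ 1 := by exact_mod_cast hs.ne'
  rw [riemannZeta_eq_inv_sub_add hne]
  refine (norm_add_le _ _).trans ?_
  have h4 := sw_z0_bound (s := (s.re : ℂ)) (by simpa using by linarith)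
  have h5 : ‖(s.re : ℂ)‖ / (s.re : ℂ).re = 1 := by
    rw [Complex.norm_real, Complex.ofReal_re, Real.norm_of_nonneg (by linarith)]
    exact div_self (by linarith)
  have h6 : ‖((s.re:ℂ) - 1)⁻¹‖ = 1 / (s.re - 1) := by
    rw [show ((s.re:ℂ) - 1) = ((s.re - 1 : ℝ) : ℂ) by simp, norm_inv, Complex.norm_real,
      Real.norm_of_nonneg (by linarith), one_div]
  rw [h6]
  linarith

open Classical in
noncomputable def swE {q : ℕ} [NeZero q] (χ : DirichletCharacter ℂ q) (s : ℂ) : ℂ :=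
  if χ = 1 then riemannZeta₁ s else DirichletCharacter.LFunction χ s

open Classical in
noncomputable def swc {q : ℕ} (χ : DirichletCharacter ℂ q) (n : ℕ) : ℂ :=
  if χ = 1 then 1 else χ (n : ZMod q)

open Classical in
noncomputable def swk {q : ℕ} (χ : DirichletCharacter ℂ q) : ℂ :=
  if χ = 1 then 1 else 0

theorem swc_norm {q : ℕ} (χ : DirichletCharacter ℂ q) (n : ℕ) : ‖swc χ n‖ ≤ 1 := by
  unfold swc; split_ifs
  · simp
  · exact χ.norm_le_one _

theorem swc_char {q : ℕ} (χ : DirichletCharacter ℂ q) :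
    ∃ (r : ℕ) (ψ : DirichletCharacter ℂ r), swc χ = fun n : ℕ => ψ (n : ZMod r) := by
  by_cases h : χ = 1
  · refine ⟨1, 1, ?_⟩
    funext n
    simp [swc, h, Subsingleton.eq_one (n : ZMod 1)]
  · exact ⟨q, χ, by funext n; simp [swc, h]⟩

theorem swE_diff {q : ℕ} [NeZero q] (χ : DirichletCharacter ℂ q) : Differentiable ℂ (swE χ) := by
  by_cases h : χ = 1
  · have : swE χ = riemannZeta₁ := by funext s; simp [swE, h]
    rw [this]; exact differentiable_riemannZeta₁
  · have : swE χ = DirichletCharacter.LFunction χ := by funext s; simp [swE, h]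
    rw [this]; exact DirichletCharacter.differentiable_LFunction h

theorem swE_eq {q : ℕ} [NeZero q] (χ : DirichletCharacter ℂ q) {s : ℂ} (hs : 1 < s.re) :
    swE χ s = (1 + swk χ * (s - 2)) * LSeries (swc χ) s := by
  have hne : s ≠ 1 := by rintro rfl; simp at hs
  by_cases h : χ = 1
  · have h1 : swc χ = 1 := by funext n; simp [swc, h]
    simp only [swE, swk, h, if_true]
    rw [← h, h1, LSeries_one_eq_riemannZeta hs, riemannZeta_eq_inv_sub_mul hne]
    have : s - 1 ≠ 0 := sub_ne_zero.2 hne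
    field_simp; ring
  · have h1 : swc χ = fun n : ℕ => χ (n : ZMod q) := by funext n; simp [swc, h]
    simp only [swE, swk, h, if_false, h1]
    rw [DirichletCharacter.LFunction_eq_LSeries χ hs]; ring

theorem swLS_lower {q : ℕ} (χ : DirichletCharacter ℂ q) {s : ℂ} (hs : 1 < s.re) (hs2 : s.re ≤ 2) :
    (s.re - 1) / 3 ≤ ‖LSeries (swc χ) s‖ := by
  obtain ⟨r, ψ, h⟩ := swc_char χ
  have h1 := DirichletCharacter.LSeries.mul_mu_eq_one ψ hs
  rw [← h] at h1
  have h2 := sw_LS_bound (f := (fun n : ℕ => ψ (n:ZMod r)) * (fun n : ℕ => ((ArithmeticFunction.moebius n : ℤ) : ℂ)))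
    (fun n => by
      rw [Pi.mul_apply, norm_mul]
      refine mul_le_one₀ (ψ.norm_le_one _) (norm_nonneg _) ?_
      rw [Complex.norm_intCast]
      exact_mod_cast ArithmeticFunction.abs_moebius_le_one) hs
  rw [← h] at h2
  have h3 := congrArg norm h1
  rw [norm_mul, norm_one] at h3
  set x := ‖LSeries (swc χ) s‖
  have hx : 0 ≤ x := norm_nonneg _
  have h4 : 1 ≤ x * (1 / (s.re - 1) + 2) := by
    exact h3.symm.le.trans (mul_le_mul_of_nonneg_left h2 hx)
  have h5 : 0 < s.re - 1 := by linarith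
  have h6 : x * (1 / (s.re - 1) + 2) = x * (1 + 2 * (s.re - 1)) / (s.re - 1) := by
    field_simp
  rw [h6, le_div_iff₀ h5] at h4
  nlinarith

theorem swE_ne {q : ℕ} [NeZero q] (χ : DirichletCharacter ℂ q) {s : ℂ} (hs : 1 < s.re) :
    swE χ s ≠ 0 := by
  rw [swE_eq χ hs]
  refine mul_ne_zero ?_ ?_
  · unfold swk; split_ifs
    · intro h
      have : s = 1 := by linear_combination h
      rw [this] at hs; simp at hs
    · simp
  · obtain ⟨r, ψ, h⟩ := swc_char χ
    rw [h]; exact DirichletCharacter.LSeries_ne_zero_of_one_lt_re ψ hs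

theorem swE_lower {q : ℕ} [NeZero q] (χ : DirichletCharacter ℂ q) {s : ℂ} (hs : 1 < s.re) (hs2 : s.re ≤ 2) :
    (s.re - 1) ^ 2 / 3 ≤ ‖swE χ s‖ := by
  rw [swE_eq χ hs, norm_mul]
  have h1 := swLS_lower χ hs hs2
  have h2 : s.re - 1 ≤ ‖1 + swk χ * (s - 2)‖ := by
    unfold swk; split_ifs
    · rw [show 1 + 1 * (s - 2) = s - 1 by ring]
      simpa using Complex.re_le_norm (s - 1)
    · simp; linarith
  have : 0 < s.re - 1 := by linarith
  calc _ = (s.re - 1) * ((s.re - 1) / 3) := by ring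
    _ ≤ _ := by gcongr

theorem swE_upper {q : ℕ} [NeZero q] (χ : DirichletCharacter ℂ q) {s : ℂ} (hs : 1/2 ≤ s.re) :
    ‖swE χ s‖ ≤ 4 * q * (‖s‖ + 1) ^ 2 := by
  have hq : (1:ℝ) ≤ q := by exact_mod_cast NeZero.pos q
  have hn := norm_nonneg s
  have hdiv : ‖s‖ / s.re ≤ 2 * ‖s‖ := by
    rw [div_le_iff₀ (by linarith)]; nlinarith
  by_cases h : χ = 1
  · simp only [swE, h, if_true]
    have : ‖riemannZeta₁ s‖ ≤ 1 + (‖s‖ + 1) * (1 + 2 * ‖s‖) := by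
      by_cases hne : s = 1
      · rw [hne, riemannZeta₁_one]; simp; positivity
      · have h1 := riemannZeta_eq_inv_sub_add hne
        have h2 := riemannZeta_eq_inv_sub_mul hne
        have h3 : s - 1 ≠ 0 := sub_ne_zero.2 hne
        have h4 : riemannZeta₁ s = 1 + (s - 1) * riemannZeta₀ s := by
          rw [h1] at h2; field_simp at h2; linear_combination -h2
        rw [h4]
        refine (norm_add_le _ _).trans ?_
        rw [norm_one, norm_mul]
        have h5 := sw_z0_bound (s := s) (by linarith)
        have h6 : ‖s - 1‖ ≤ ‖s‖ + 1 := by simpa using norm_sub_le s 1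
        gcongr
        linarith
    nlinarith
  · simp only [swE, h, if_false]
    have := sw_L_bound h zero_le_one le_rfl (s := s) (by linarith) (by linarith)
    rw [Real.rpow_one, show s.re + 1 - 1 = s.re by ring] at this
    calc _ ≤ _ := this
      _ = q * (‖s‖ / s.re) := by ring
      _ ≤ q * (4 * (‖s‖ + 1) ^ 2) := by gcongr; nlinarith
      _ = _ := by ring

theorem swE_logderiv {q : ℕ} [NeZero q] (χ : DirichletCharacter ℂ q) {s : ℂ} (hs : 1 < s.re) :
    deriv (swE χ) s / swE χ s = swk χ / (s - 1)
      - LSeries (fun n => swc χ n * (ArithmeticFunction.vonMangoldt n : ℂ)) s := by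
  have hev : swE χ =ᶠ[nhds s] (fun s => (1 + swk χ * (s - 2)) * LSeries (swc χ) s) := by
    have : {s : ℂ | 1 < s.re} ∈ nhds s :=
        (isOpen_lt continuous_const Complex.continuous_re).mem_nhds hs
    filter_upwards [this] with z hz using swE_eq χ hz
  have hne0 := swE_ne χ hs
  obtain ⟨r, ψ, h⟩ := swc_char χ
  have hv := DirichletCharacter.LSeries_twist_vonMangoldt_eq ψ hs
  rw [← h] at hv
  have hv2 : (fun n => swc χ n * (ArithmeticFunction.vonMangoldt n : ℂ)) = (swc χ) * (fun n => (ArithmeticFunction.vonMangoldt n : ℂ)) := rfl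
  have hd : DifferentiableAt ℂ (LSeries (swc χ)) s := by
    refine (LSeries_hasDerivAt ?_).differentiableAt
    refine lt_of_le_of_lt (LSeries.abscissaOfAbsConv_le_of_le_const ⟨1, fun n _ => swc_norm χ n⟩) ?_
    exact_mod_cast hs
  have hd1 : HasDerivAt (fun s : ℂ => 1 + swk χ * (s - 2)) (swk χ) s := by
    simpa using (((hasDerivAt_id s).sub_const 2).const_mul (swk χ)).const_add 1
  have hd3 : deriv (fun s => (1 + swk χ * (s - 2)) * LSeries (swc χ) s) s = _ := (hd1.mul hd.hasDerivAt).deriv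
  rw [hev.deriv_eq, hd3, swE_eq χ hs, hv2, hv]
  rw [swE_eq χ hs] at hne0
  have n1 := left_ne_zero_of_mul hne0
  have n2 := right_ne_zero_of_mul hne0
  have n3 : s - 1 ≠ 0 := by
    intro h; have : s = 1 := by linear_combination h
    rw [this] at hs; simp at hs
  have hk : swk χ / (s - 1) = swk χ / (1 + swk χ * (s - 2)) := by
    unfold swk; split_ifs
    · congr 1; ring
    · simp
  rw [hk]
  field_simp
  ring

theorem sw_real {q : ℕ} [NeZero q] {χ : DirichletCharacter ℂ q} (h2 : χ ^ 2 = 1) (a : ZMod q) :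
    ((χ a).re : ℂ) = χ a := by
  have : χ⁻¹ = χ := by
    rw [inv_eq_iff_mul_eq_one, ← pow_two, h2]
  have h := MulChar.star_apply' χ a
  rw [this] at h
  exact (Complex.conj_eq_iff_re.1 h)

theorem sw_Lreal {q : ℕ} [NeZero q] {χ : DirichletCharacter ℂ q} (hχ : χ ≠ 1) (h2 : χ ^ 2 = 1)
    {x : ℝ} (hx : 0 < x) : ((DirichletCharacter.LFunction χ x).re : ℂ) = DirichletCharacter.LFunction χ x := by
  have h := sw_Lint hχ (s := (x:ℂ)) (by simpa using hx)
  have h3 : ∫ u in Set.Ioi (1:ℝ), (∑ k ∈ Finset.Icc 1 ⌊u⌋₊, χ (k : ZMod q)) * (u:ℂ) ^ (-((x:ℂ) + 1))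
      = ((∫ u in Set.Ioi (1:ℝ), (∑ k ∈ Finset.Icc 1 ⌊u⌋₊, (χ (k : ZMod q)).re) * u ^ (-(x + 1)) : ℝ) : ℂ) := by
    rw [← integral_complex_ofReal]
    refine MeasureTheory.setIntegral_congr_fun measurableSet_Ioi fun u hu => ?_
    have : (0:ℝ) ≤ u := by have : (1:ℝ) < u := hu; linarith
    simp only [Complex.ofReal_mul, Complex.ofReal_sum, sw_real h2]
    rw [Complex.ofReal_cpow this]
    simp
  rw [h3, ← Complex.ofReal_mul] at h
  rw [h, Complex.ofReal_re]

theorem sw_LamSummable {q : ℕ} (χ : DirichletCharacter ℂ q) {s : ℂ} (hs : 1 < s.re) :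
    LSeriesSummable (fun n => swc χ n * (ArithmeticFunction.vonMangoldt n : ℂ)) s := by
  obtain ⟨r, ψ, h⟩ := swc_char χ
  have := DirichletCharacter.LSeriesSummable_twist_vonMangoldt ψ hs
  rw [← h] at this
  exact this

theorem sw_341_alg {w v : ℂ} (hw : ‖w‖ ≤ 1) (hv : v = w ^ 2 ∨ (w = 0 ∧ ‖v‖ ≤ 1)) :
    0 ≤ (3 + 4 * w + v).re := by
  rcases hv with rfl | ⟨rfl, h⟩
  · have h1 : ‖w‖ ^ 2 ≤ 1 := by nlinarith [norm_nonneg w]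
    rw [← Complex.normSq_eq_norm_sq, Complex.normSq_apply] at h1
    simp [pow_two]
    nlinarith [sq_nonneg (1 + w.re)]
  · have := abs_le.1 ((Complex.abs_re_le_norm v).trans h)
    simp
    linarith [this.1]

theorem swc_sq {q : ℕ} (χ : DirichletCharacter ℂ q) (n : ℕ) :
    swc (χ ^ 2) n = swc χ n ^ 2 ∨ swc χ n = 0 := by
  unfold swc
  by_cases h : χ = 1
  · simp [h]
  · by_cases h2 : χ ^ 2 = 1
    · simp only [h, h2, if_true, if_false]
      by_cases hu : IsUnit (n : ZMod q)
      · left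
        rw [← MulChar.pow_apply' _ two_ne_zero, h2, MulChar.one_apply hu]
      · right; exact MulChar.map_nonunit _ hu
    · left
      simp only [h, h2, if_false]
      rw [MulChar.pow_apply' _ two_ne_zero]

theorem sw_341 {q : ℕ} (χ : DirichletCharacter ℂ q) {σ γ : ℝ} (hσ : 1 < σ) :
    0 ≤ 3 * (LSeries (fun n => swc (1 : DirichletCharacter ℂ q) n * (ArithmeticFunction.vonMangoldt n : ℂ)) (σ:ℂ)).re
     + 4 * (LSeries (fun n => swc χ n * (ArithmeticFunction.vonMangoldt n : ℂ)) (σ + γ * Complex.I)).re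
     + (LSeries (fun n => swc (χ ^ 2) n * (ArithmeticFunction.vonMangoldt n : ℂ)) (σ + 2 * γ * Complex.I)).re := by
  have s1 := (sw_LamSummable (1 : DirichletCharacter ℂ q) (s := (σ:ℂ)) (by simpa using hσ)).LSeriesHasSum
  have s2 := (sw_LamSummable χ (s := σ + γ * Complex.I) (by simpa using hσ)).LSeriesHasSum
  have s3 := (sw_LamSummable (χ^2) (s := σ + 2 * γ * Complex.I) (by simpa using hσ)).LSeriesHasSum
  have s4 := Complex.hasSum_re (((s1.mul_left 3).add (s2.mul_left 4)).add s3)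
  refine le_of_le_of_eq (HasSum.nonneg ?_ s4) (by simp)
  intro n
  show 0 ≤ Complex.re _
  rcases eq_or_ne n 0 with rfl | hn
  · simp
  rw [LSeries.term_of_ne_zero hn, LSeries.term_of_ne_zero hn, LSeries.term_of_ne_zero hn]
  have hn0 : (n:ℂ) ≠ 0 := by exact_mod_cast hn
  set u : ℂ := ((n:ℂ) ^ (γ * Complex.I))⁻¹ with hu
  have hunorm : ‖u‖ = 1 := by
    rw [hu, norm_inv, Complex.norm_natCast_cpow_of_pos (Nat.pos_of_ne_zero hn)]
    simp
  have e1 : (n:ℂ) ^ ((σ:ℂ) + γ * Complex.I) = n ^ (σ:ℂ) * u⁻¹ := by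
    rw [Complex.cpow_add _ _ hn0, hu, inv_inv]
  have e2 : (n:ℂ) ^ ((σ:ℂ) + 2 * γ * Complex.I) = n ^ (σ:ℂ) * (u⁻¹) ^ 2 := by
    rw [hu, inv_inv, pow_two, ← Complex.cpow_add _ _ hn0, ← Complex.cpow_add _ _ hn0]
    congr 1; ring
  have e3 : (n:ℂ) ^ (σ:ℂ) = ((n:ℝ) ^ σ : ℝ) := by
    rw [Complex.ofReal_cpow (by positivity)]; simp
  rw [e1, e2, e3]
  have hpos : (0:ℝ) < (n:ℝ) ^ σ := by positivity
  have hne : (((n:ℝ) ^ σ : ℝ) : ℂ) ≠ 0 := by exact_mod_cast hpos.ne'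
  have hu0 : u ≠ 0 := by intro h; rw [h] at hunorm; simp at hunorm
  have key : 3 * (swc (1 : DirichletCharacter ℂ q) n * (ArithmeticFunction.vonMangoldt n : ℂ) / (((n:ℝ) ^ σ : ℝ) : ℂ))
      + 4 * (swc χ n * (ArithmeticFunction.vonMangoldt n : ℂ) / ((((n:ℝ) ^ σ : ℝ) : ℂ) * u⁻¹))
      + swc (χ ^ 2) n * (ArithmeticFunction.vonMangoldt n : ℂ) / ((((n:ℝ) ^ σ : ℝ) : ℂ) * u⁻¹ ^ 2)
      = ((ArithmeticFunction.vonMangoldt n / (n:ℝ) ^ σ : ℝ) : ℂ) * (3 + 4 * (swc χ n * u) + swc (χ^2) n * u ^ 2) := by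
    have : swc (1 : DirichletCharacter ℂ q) n = 1 := by simp [swc]
    rw [this, Complex.ofReal_div]
    field_simp
  rw [key, Complex.re_ofReal_mul]
  refine mul_nonneg (div_nonneg ArithmeticFunction.vonMangoldt_nonneg hpos.le) (sw_341_alg ?_ ?_)
  · rw [norm_mul, hunorm, mul_one]; exact swc_norm χ n
  · rcases swc_sq χ n with h | h
    · left; rw [h]; ring
    · right; rw [h]
      refine ⟨by simp, ?_⟩
      rw [norm_mul, norm_pow, hunorm]; simpa using swc_norm _ n

theorem sw_ratio {q : ℕ} [NeZero q] (χ : DirichletCharacter ℂ q) {b L : ℝ} (hb : 0 ≤ b) (hL : 1 ≤ L)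
    (hq : (q:ℝ) ≤ exp L) {s : ℂ} (hs : s.re = 1 + exp (-b) / L) (hi : |s.im| ≤ 2 * exp L) :
    ∀ z ∈ Metric.closedBall s (1/4), ‖swE χ z‖ ≤ exp ((12 + 2 * b) * L) * ‖swE χ s‖ := by
  intro z hz
  have ha : 0 < exp (-b) := exp_pos _
  have ha1 : exp (-b) ≤ 1 := by simpa using hb
  have hL0 : 0 < L := by linarith
  have haL : exp (-b) / L ≤ 1 := by rw [div_le_one hL0]; linarith
  have haL0 : 0 < exp (-b) / L := by positivity
  have hz' : ‖z - s‖ ≤ 1/4 := by simpa [dist_eq_norm] using hz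
  have hre : s.re - 1/4 ≤ z.re := by
    have := abs_le.1 ((Complex.abs_re_le_norm (z - s)).trans hz')
    simp at this; linarith [this.1]
  have hE : 1 ≤ exp L := by simpa using hL0.le
  have hnz : ‖z‖ + 1 ≤ 6 * exp L := by
    have h1 : ‖z‖ ≤ ‖z - s‖ + ‖s‖ := by simpa using norm_add_le (z - s) s
    have h2 := Complex.norm_le_abs_re_add_abs_im s
    have h3 : |s.re| ≤ 2 := by rw [abs_le]; constructor <;> linarith
    linarith
  have hup := swE_upper χ (s := z) (by linarith)
  have hlo := swE_lower χ (s := s) (by linarith) (by linarith)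
  rw [hs, show 1 + exp (-b) / L - 1 = exp (-b) / L by ring] at hlo
  have hLe : L ≤ exp L := by linarith [add_one_le_exp L]
  have h7 : (432:ℝ) ≤ exp (7 * L) := by
    have h2 : (2.7:ℝ) ≤ exp 1 := by have := exp_one_gt_d9; linarith
    calc (432:ℝ) ≤ (2.7) ^ 7 := by norm_num
      _ ≤ (exp 1) ^ 7 := by gcongr
      _ = exp 7 := by rw [← exp_nat_mul]; norm_num
      _ ≤ _ := by gcongr; linarith
  calc ‖swE χ z‖ ≤ 4 * exp L * (6 * exp L) ^ 2 := hup.trans (by gcongr)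
    _ = 432 * exp L ^ 3 * L ^ 2 * exp b ^ 2 * ((exp (-b) / L) ^ 2 / 3) := by
        have : exp b * exp (-b) = 1 := by rw [← exp_add]; simp
        have h5 : exp b ^ 2 * exp (-b) ^ 2 = 1 := by rw [← mul_pow, this]; simp
        field_simp
        linear_combination (-3 * 4 * 36) * h5
    _ ≤ exp (7 * L) * exp L ^ 3 * exp L ^ 2 * exp b ^ 2 * ‖swE χ s‖ := by gcongr
    _ = exp (12 * L + 2 * b) * ‖swE χ s‖ := by
        congr 1
        rw [← exp_nat_mul, ← exp_nat_mul, ← exp_nat_mul, ← exp_add, ← exp_add, ← exp_add]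
        congr 1; push_cast; ring
    _ ≤ _ := by
        gcongr
        nlinarith

theorem sw_zerofree {δ : ℝ} (hδ : 0 < δ) (hδ1 : δ ≤ 1) : ∃ c : ℝ, 0 < c ∧ c ≤ 1 ∧
    ∀ (q : ℕ) [NeZero q] (χ : DirichletCharacter ℂ q) (L : ℝ), 1 ≤ L → (q:ℝ) ≤ exp L →
      (χ ^ 2 = 1 → ∀ s : ℂ, ‖s - 1‖ ≤ δ / L → swE χ s ≠ 0) →
      ∀ s : ℂ, 1 - c / L ≤ s.re → |s.im| ≤ exp L → swE χ s ≠ 0 := by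
  set b : ℝ := 40000 + 9 / δ with hb
  have hd9 : 0 < 9 / δ := by positivity
  have hb0 : 40000 ≤ b := by linarith
  have hbig : 1920 * (12 + 2 * b) + 16 + 9 / δ ≤ exp b / 2 := by
    have := quadratic_le_exp_of_nonneg (show 0 ≤ b by linarith)
    nlinarith
  set a := exp (-b) with ha
  have ha0 : 0 < a := exp_pos _
  have ha1 : a ≤ 1 := by rw [ha]; simp; linarith
  have hab : exp b = 1 / a := by rw [ha, exp_neg]; simp
  have had : a ≤ δ := by
    have : 9 / δ ≤ 1 / a := by rw [← hab]; linarith [add_one_le_exp b]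
    rw [div_le_div_iff₀ hδ ha0] at this; linarith
  refine ⟨a / 8, by positivity, by linarith, ?_⟩
  intro q _ χ L hL hq hex s hs hi hzero
  have hL0 : 0 < L := by linarith
  have hre1 : s.re ≤ 1 := by
    by_contra h; push Not at h; exact swE_ne χ h hzero
  set σ := 1 + a / L with hσ
  have haL : 0 < a / L := by positivity
  have haL1 : a / L ≤ 1/100 := by
    rw [div_le_iff₀ hL0]
    have : a ≤ 1/100 := by
      have h1 : 100 ≤ 1 / a := by rw [← hab]; linarith [add_one_le_exp b]
      rw [le_div_iff₀ ha0] at h1; linarith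
    linarith
  have hσ1 : 1 < σ := by linarith
  set γ := s.im with hγ
  set w := σ - s.re with hw
  have hw0 : 0 < w := by linarith
  set m := (12 + 2 * b) * L with hm
  have hm0 : 0 < m := by rw [hm]; positivity
  have hz : ∀ (ψ : DirichletCharacter ℂ q) (t : ℂ), t.re = σ → ∀ z ∈ Metric.ball t (1/4:ℝ), swE ψ z = 0 → z.re ≤ t.re := by
    intro ψ t ht z _ hz
    by_contra h; push Not at h
    exact swE_ne ψ (by linarith) hz
  have hE1 : 1 ≤ exp L := by simpa using hL0.le
  have hb00 : 0 ≤ b := by linarith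
  have A1 := sw_local1 (swE_diff (1 : DirichletCharacter ℂ q)) (s := (σ:ℂ)) (R := 1/4) (m := m) (by norm_num) hm0
    (sw_ratio 1 hb00 hL hq (by rw [← ha, ← hσ]; simp) (by simp; positivity)) (swE_ne _ (by simpa using hσ1)) (hz 1 _ (by simp))
  have A2 := sw_local2 (swE_diff χ) (s := σ + γ * Complex.I) (R := 1/4) (m := m) (by norm_num) hm0
    (sw_ratio χ hb00 hL hq (by rw [← ha, ← hσ]; simp) (by simp; linarith)) (swE_ne _ (by simpa using hσ1)) (hz χ _ (by simp))
    (w := w) hw0 (by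
      have : a / 8 / L = (a / L) / 8 := by ring
      rw [this] at hs
      linarith) (by
      rw [← hzero]; congr 1
      apply Complex.ext <;> simp [hw, hγ])
  have A3 := sw_local1 (swE_diff (χ^2)) (s := σ + 2 * γ * Complex.I) (R := 1/4) (m := m) (by norm_num) hm0
    (sw_ratio _ hb00 hL hq (by rw [← ha, ← hσ]; simp) (by simp [abs_mul]; linarith)) (swE_ne _ (by simpa using hσ1)) (hz _ _ (by simp))
  have K := sw_341 χ (σ := σ) (γ := γ) hσ1
  rw [swE_logderiv _ (by simpa using hσ1)] at A1 A2 A3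
  rw [Complex.sub_re] at A1 A2 A3
  have B1 : (swk (1 : DirichletCharacter ℂ q) / ((σ:ℂ) - 1)).re = L / a := by
    have : swk (1 : DirichletCharacter ℂ q) / ((σ:ℂ) - 1) = ((L / a : ℝ) : ℂ) := by
      have h1 : (σ:ℂ) - 1 = ((a / L : ℝ) : ℂ) := by rw [hσ]; push_cast; ring
      rw [h1]
      simp only [swk, if_true]
      push_cast
      have : (a:ℂ) ≠ 0 := by exact_mod_cast ha0.ne'
      have : (L:ℂ) ≠ 0 := by exact_mod_cast hL0.ne'
      field_simp
    rw [this, Complex.ofReal_re]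
  have B2 : 4 * (swk χ / ((σ + γ * Complex.I : ℂ) - 1)).re + (swk (χ^2) / ((σ + 2 * γ * Complex.I : ℂ) - 1)).re ≤ 9 / δ * L := by
    by_cases h2 : χ ^ 2 = 1
    · have hγ' : δ / (2 * L) ≤ |γ| := by
        by_contra h
        push Not at h
        refine hex h2 s ?_ hzero
        refine (Complex.norm_le_abs_re_add_abs_im _).trans ?_
        have e1 : |(s - 1).re| ≤ δ / (2 * L) := by
          rw [abs_le]
          have h8 : a / 8 / L ≤ δ / (2 * L) := by
            rw [div_div, div_le_div_iff₀ (by positivity) (by positivity)]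
            nlinarith
          have : 0 ≤ δ / (2 * L) := by positivity
          constructor
          · simp; linarith
          · simp; linarith
        have e2 : |(s - 1).im| ≤ δ / (2 * L) := by simpa [← hγ] using h.le
        have : δ / (2 * L) + δ / (2 * L) = δ / L := by field_simp; ring
        linarith
      have hγ0 : 0 < |γ| := lt_of_lt_of_le (by positivity) hγ'
      have hinv : 1 / |γ| ≤ 2 * L / δ := by
        rw [div_le_iff₀ hγ0]
        calc (1:ℝ) = 2 * L / δ * (δ / (2 * L)) := by field_simp
          _ ≤ _ := by gcongr
      have gen : ∀ (k z : ℂ) (x : ℝ), ‖k‖ ≤ 1 → 0 < x → x ≤ |z.im| → (k / z).re ≤ 1 / x := by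
        intro k z x hk hx hz
        refine (Complex.re_le_norm _).trans ?_
        rw [norm_div]
        have := hz.trans (Complex.abs_im_le_norm z)
        gcongr
      have hk : ∀ ψ : DirichletCharacter ℂ q, ‖swk ψ‖ ≤ 1 := by
        intro ψ; unfold swk; split_ifs <;> simp
      have g1 := gen (swk χ) ((σ + γ * Complex.I : ℂ) - 1) |γ| (hk _) hγ0 (by simp)
      have g2 := gen (swk (χ^2)) ((σ + 2 * γ * Complex.I : ℂ) - 1) (2 * |γ|) (hk _) (by linarith) (by simp [abs_mul])
      have : 1 / (2 * |γ|) = 1 / |γ| / 2 := by field_simp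
      rw [this] at g2
      have : 9 / δ * L = 4.5 * (2 * L / δ) := by ring
      linarith
    · have h1 : χ ≠ 1 := by rintro rfl; simp at h2
      simp only [swk, h1, h2, if_false]
      simp; positivity
  rw [B1] at A1
  have F : 4 * (1 / w) ≤ 3 * (L / a) + (1920 * m + 16 + 9 / δ * L) := by linarith
  have F2 : 1920 * m + 16 + 9 / δ * L ≤ (1 / a) / 2 * L := by
    rw [← hab, hm]
    nlinarith
  have F3 : 4 * (1 / w) ≤ 3.5 * (L / a) := by
    have : (1 / a) / 2 * L = 0.5 * (L / a) := by ring
    linarith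
  have hw9 : w ≤ 9/8 * (a / L) := by
    have : a / 8 / L = (a / L) / 8 := by ring
    rw [this] at hs; linarith
  have hprod : (L / a) * (a / L) = 1 := by field_simp
  have : 4 ≤ 3.5 * (L / a) * w := by
    rw [mul_one_div, div_le_iff₀ hw0] at F3; exact F3
  have hLa : 0 < L / a := by positivity
  nlinarith

open scoped ComplexOrder in
lemma sw_alt {P : ℂ → ℂ} {g : ℕ → ℝ} (hP : Differentiable ℂ P) (hg : ∀ n, 0 ≤ g n)
    (hs : ∀ s : ℂ, 1 < s.re → LSeriesSummable (fun n => (g n : ℂ)) s)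
    (hd : ∀ s : ℂ, 1 < s.re → P s ≠ 0 ∧ deriv P s / P s = 1/(s-1) - LSeries (fun n => (g n : ℂ)) s)
    (h2 : 0 ≤ P 2) (k : ℕ) : 0 ≤ (-1)^k * iteratedDeriv k (fun s => P s / (s-1)) 2 := by
  set G := LSeries (fun n => (g n : ℂ)) with hG
  have hopen : IsOpen {s : ℂ | 1 < s.re} := isOpen_lt continuous_const Complex.continuous_re
  have hmem : {s : ℂ | 1 < s.re} ∈ nhds (2:ℂ) := hopen.mem_nhds (by simp)
  have habs : LSeries.abscissaOfAbsConv (fun n => (g n : ℂ)) ≤ 1 := by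
    apply LSeries.abscissaOfAbsConv_le_of_forall_lt_LSeriesSummable
    intro y hy
    exact hs _ (by simpa using hy)
  have hGd : DifferentiableOn ℂ G {s : ℂ | 1 < s.re} := by
    refine (LSeries_differentiableOn _).mono ?_
    intro s h
    refine lt_of_le_of_lt habs ?_
    exact_mod_cast h
  have hne : ∀ s : ℂ, 1 < s.re → s - 1 ≠ 0 := by
    intro s h h0
    rw [sub_eq_zero] at h0; rw [h0] at h; simp at h
  have hFd : DifferentiableOn ℂ (fun s => P s / (s-1)) {s : ℂ | 1 < s.re} :=
    fun s h => ((hP s).div (by fun_prop) (hne s h)).differentiableWithinAt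
  have hderiv : deriv (fun s => P s / (s-1)) =ᶠ[nhds 2] -(G * fun s => P s / (s-1)) := by
    filter_upwards [hmem] with s h
    have h1 := (hd s h).1
    have h3 := (hd s h).2
    have h0 := hne s h
    have : HasDerivAt (fun s => P s / (s-1)) ((deriv P s * (s-1) - P s * 1)/(s-1)^2) s :=
      (hP s).hasDerivAt.div ((hasDerivAt_id s).sub_const 1) h0
    rw [this.deriv]
    simp only [Pi.neg_apply, Pi.mul_apply]
    have h4 : deriv P s = (1/(s-1) - G s) * P s := by rw [← h3]; field_simp
    rw [h4]; field_simp; ring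
  induction k using Nat.strong_induction_on with
  | _ k ih =>
    cases k with
    | zero => 
      simp only [pow_zero, iteratedDeriv_zero, one_mul]
      norm_num; exact h2
    | succ k =>
      rw [iteratedDeriv_succ', hderiv.iteratedDeriv_eq]
      have hc1 : ContDiffAt ℂ k G 2 := (hGd.analyticAt hmem).contDiffAt
      have hc2 : ContDiffAt ℂ k (fun s => P s / (s-1)) 2 := (hFd.analyticAt hmem).contDiffAt
      rw [iteratedDeriv_neg, iteratedDeriv_mul hc1 hc2]
      have : (-1)^(k+1) * -(∑ i ∈ Finset.range (k+1), (k.choose i : ℂ) * iteratedDeriv i G 2 * iteratedDeriv (k-i) (fun s => P s / (s-1)) 2)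
        = ∑ i ∈ Finset.range (k+1), (k.choose i : ℂ) * ((-1)^i * iteratedDeriv i G 2) * ((-1)^(k-i) * iteratedDeriv (k-i) (fun s => P s / (s-1)) 2) := by
        rw [pow_succ, mul_neg_one, neg_mul_neg, Finset.mul_sum]
        refine Finset.sum_congr rfl fun i hi => ?_
        have : (-1:ℂ)^k = (-1)^i * (-1)^(k-i) := by
          rw [← pow_add]; congr 1; have := Finset.mem_range.1 hi; omega
        rw [this]; ring
      rw [this]
      refine Finset.sum_nonneg fun i hi => mul_nonneg (mul_nonneg (by positivity) ?_) (ih _ (by omega))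
      have := LSeries.iteratedDeriv_alternating (a := fun n => (g n : ℂ)) (x := 2) (fun n => by simpa using hg n) (lt_of_le_of_lt habs (by exact_mod_cast (by norm_num : (1:ℝ) < 2))) i
      exact_mod_cast this

open scoped ComplexOrder in
lemma sw_est {P : ℂ → ℂ} {g : ℕ → ℝ} (hP : Differentiable ℂ P) (hg : ∀ n, 0 ≤ g n)
    (hs : ∀ s : ℂ, 1 < s.re → LSeriesSummable (fun n => (g n : ℂ)) s)
    (hd : ∀ s : ℂ, 1 < s.re → P s ≠ 0 ∧ deriv P s / P s = 1/(s-1) - LSeries (fun n => (g n : ℂ)) s)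
    (h2 : 0 ≤ P 2) (h2' : 1/81 ≤ (P 2).re) {M : ℝ} (hM : 1 ≤ M)
    (hb : ∀ s, ‖s-2‖ ≤ 4/3 → ‖P s‖ ≤ M) {β : ℝ} (hβ : 7/8 ≤ β) (hβ1 : β < 1)
    (hPβ : 0 ≤ (P β).re) :
    exp (-10)/162 * (1-β) * M^(-8*(1-β)) ≤ (P 1).re := by
  set E := dslope P 1 with hE
  have hEd : Differentiable ℂ E := by
    rw [← differentiableOn_univ] at hP ⊢
    exact (Complex.differentiableOn_dslope (by simp)).2 hP
  have hEval : ∀ s, s ≠ 1 → E s = P s/(s-1) - P 1 * (s-1)⁻¹ := by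
    intro s h
    have h0 : s - 1 ≠ 0 := sub_ne_zero.2 h
    rw [hE, dslope_of_ne _ h, slope_def_field]; field_simp
  set F := fun s => P s / (s-1) with hF
  have halt := sw_alt hP hg hs hd h2
  have hEk : ∀ k, iteratedDeriv k E 2 = iteratedDeriv k F 2 - P 1 * ((-1)^k * k.factorial) := by
    intro k
    have hev : E =ᶠ[nhds 2] (F - fun s => P 1 * (s-1)⁻¹) := by
      filter_upwards [isOpen_ne.mem_nhds (by norm_num : (2:ℂ) ≠ 1)] with s h
      rw [hEval s h]; rfl
    rw [hev.iteratedDeriv_eq]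
    have hi : ContDiffAt ℂ k (fun s : ℂ => (s-1)⁻¹) 2 := by
      refine ContDiffAt.inv (by fun_prop) (by norm_num)
    have h1 : ContDiffAt ℂ k F 2 := by
      refine ContDiffAt.div (hP.contDiff.contDiffAt) (by fun_prop) (by norm_num)
    have h3 : ContDiffAt ℂ k (fun s : ℂ => P 1 * (s-1)⁻¹) 2 := contDiffAt_const.mul hi
    rw [iteratedDeriv_sub h1 h3, iteratedDeriv_const_mul_field]
    congr 2
    have := iteratedDeriv_comp_sub_const (𝕜 := ℂ) k (fun s : ℂ => s⁻¹) 1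
    have := congrFun this 2
    rw [this, iteratedDeriv_eq_iterate, iter_deriv_inv]
    norm_num
  set l := (P 1).re with hl
  set x : ℝ := 2 - β with hx
  set e : ℕ → ℝ := fun k => (((k.factorial : ℂ))⁻¹ * ((-1)^k * iteratedDeriv k E 2)).re with he
  have hsum : HasSum (fun k => x^k * e k) (E β).re := by
    have := Complex.hasSum_taylorSeries_of_entire hEd 2 (β:ℂ)
    have := Complex.hasSum_re this
    convert this using 2 with k
    have h1 : ((β:ℂ) - 2)^k = ((x^k : ℝ) : ℂ) * (-1)^k := by
      rw [hx]; push_cast; rw [← mul_pow]; congr 1; ring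
    rw [he, h1]
    simp only [smul_eq_mul]
    rw [← Complex.re_ofReal_mul]
    congr 1; ring
  have hek : ∀ k, e k = (((k.factorial : ℂ))⁻¹ * ((-1)^k * iteratedDeriv k F 2)).re - l := by
    intro k
    have h1 : (k.factorial : ℂ) ≠ 0 := by exact_mod_cast k.factorial_ne_zero
    have h2 : (-1:ℂ)^k * (-1)^k = 1 := by rw [← mul_pow]; simp
    rw [he, hl, ← Complex.sub_re]
    simp only [hEk]
    congr 1
    have : (k.factorial : ℂ)⁻¹ * ((-1) ^ k * (iteratedDeriv k F 2 - P 1 * ((-1) ^ k * k.factorial))) = (k.factorial : ℂ)⁻¹ * ((-1) ^ k * iteratedDeriv k F 2) - P 1 * ((-1:ℂ)^k * (-1)^k) * ((k.factorial : ℂ)⁻¹ * k.factorial) := by ring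
    rw [this, h2, inv_mul_cancel₀ h1]; ring
  have hlow : ∀ k, -l ≤ e k := by
    intro k
    rw [hek]
    have h1 : (0:ℂ) ≤ (k.factorial : ℂ)⁻¹ := by
      rw [← Complex.ofReal_natCast, ← Complex.ofReal_inv]
      exact Complex.zero_le_real.2 (by positivity)
    have := (Complex.le_def.1 (mul_nonneg h1 (halt k))).1
    simp only [Complex.zero_re] at this
    linarith
  have hlow0 : 1/81 - l ≤ e 0 := by
    rw [hek]
    have : F 2 = P 2 := by rw [hF]; norm_num
    simp [this]
    linarith
  have hup : ∀ k, |e k| ≤ 6*M*(3/4)^k := by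
    intro k
    have hsph : ∀ z ∈ Metric.sphere (2:ℂ) (4/3), ‖E z‖ ≤ 6*M := by
      intro z hz
      rw [mem_sphere_iff_norm] at hz
      have h1 : (1/3:ℝ) ≤ ‖z-1‖ := by
        have := norm_sub_norm_le (z-2) (-1)
        rw [show z - 2 - -1 = z-1 by ring, hz, norm_neg, norm_one] at this
        linarith
      have h0 : z ≠ 1 := by rintro rfl; norm_num at h1
      have h3 : ‖P z‖ ≤ M := hb z hz.le
      have h4 : ‖P 1‖ ≤ M := hb 1 (by norm_num)
      rw [hEval z h0, ← div_eq_mul_inv, ← sub_div, norm_div, div_le_iff₀ (by linarith)]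
      have := norm_sub_le (P z) (P 1)
      nlinarith
    have := Complex.norm_iteratedDeriv_le_of_forall_mem_sphere_norm_le k (by norm_num : (0:ℝ) < 4/3) (hEd.diffContOnCl) hsph
    have hf : (0:ℝ) < k.factorial := by exact_mod_cast k.factorial_pos
    calc |e k| ≤ ‖((k.factorial : ℂ))⁻¹ * ((-1)^k * iteratedDeriv k E 2)‖ := Complex.abs_re_le_norm _
      _ = (k.factorial : ℝ)⁻¹ * ‖iteratedDeriv k E 2‖ := by simp
      _ ≤ (k.factorial : ℝ)⁻¹ * (k.factorial * (6*M) / (4/3)^k) := by gcongr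
      _ = 6*M*(3/4)^k := by
        rw [show (3/4:ℝ) = (4/3)⁻¹ by norm_num, inv_pow]; field_simp
  have hx1 : 1 < x := by rw [hx]; linarith
  have hx2 : x ≤ 9/8 := by rw [hx]; linarith
  set N := ⌈8*(log M + 9)⌉₊ with hN
  have hlM : 0 ≤ log M := log_nonneg hM
  have hN1 : 8*(log M + 9) ≤ N := Nat.le_ceil _
  have hN2 : (N:ℝ) < 8*(log M + 9) + 1 := Nat.ceil_lt_add_one (by positivity)
  have hN0 : 0 < N := by
    have : (0:ℝ) < N := by linarith
    exact_mod_cast this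
  have hhead : 1/81 - l * ∑ k ∈ Finset.range N, x^k ≤ ∑ k ∈ Finset.range N, x^k * e k := by
    obtain ⟨m, hm⟩ : ∃ m, N = m+1 := ⟨N-1, by omega⟩
    rw [hm, Finset.sum_range_succ', Finset.sum_range_succ', mul_add, Finset.mul_sum]
    have : ∑ i ∈ Finset.range m, -(l * x^(i+1)) ≤ ∑ k ∈ Finset.range m, x^(k+1) * e (k+1) := by
      refine Finset.sum_le_sum fun i _ => ?_
      have := mul_le_mul_of_nonneg_left (hlow (i+1)) (by positivity : 0 ≤ x^(i+1))
      linarith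
    rw [Finset.sum_neg_distrib] at this
    simp only [pow_zero]
    linarith
  have htail : -(6*M*(27/32)^N*(32/5)) ≤ ∑' k, x^(k+N) * e (k+N) := by
    have hs1 : HasSum (fun k : ℕ => 6*M*(27/32)^N*(27/32:ℝ)^k) (6*M*(27/32)^N*(32/5)) := by
      have := (hasSum_geometric_of_lt_one (by norm_num : (0:ℝ) ≤ 27/32) (by norm_num)).mul_left (6*M*(27/32)^N)
      norm_num at this ⊢
      exact this
    have hs2 : Summable (fun k => x^(k+N) * e (k+N)) := (summable_nat_add_iff N).2 hsum.summable
    refine hasSum_le (fun k => ?_) hs1.neg hs2.hasSum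
    have h1 := (abs_le.1 (hup (k+N))).1
    have h2 : x^(k+N) * (3/4)^(k+N) ≤ (27/32:ℝ)^(k+N) := by
      rw [← mul_pow]; gcongr; linarith
    have h3 := mul_le_mul_of_nonneg_left h1 (by positivity : 0 ≤ x^(k+N))
    have h4 := mul_le_mul_of_nonneg_left h2 (by positivity : 0 ≤ 6*M)
    rw [pow_add (27/32:ℝ) k N] at h4
    linarith
  have hEβ : (E β).re = (∑ k ∈ Finset.range N, x^k * e k) + ∑' k, x^(k+N) * e (k+N) := by
    rw [← hsum.tsum_eq, ← hsum.summable.sum_add_tsum_nat_add N]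
  have hEβ2 : (E β).re ≤ l/(1-β) := by
    have hβ' : (β:ℂ) ≠ 1 := by exact_mod_cast hβ1.ne
    rw [hEval _ hβ', Complex.sub_re]
    have h1 : (β:ℂ) - 1 = ((β-1 : ℝ):ℂ) := by push_cast; ring
    rw [h1, ← Complex.ofReal_inv, Complex.re_mul_ofReal, Complex.div_ofReal_re]
    have h3 : (P β).re / (β-1) ≤ 0 := div_nonpos_of_nonneg_of_nonpos hPβ (by linarith)
    have h4 : (P 1).re * (β-1)⁻¹ = -(l/(1-β)) := by
      rw [hl, ← div_eq_mul_inv, ← neg_sub 1 β, div_neg]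
    linarith
  have hgeom : ∑ k ∈ Finset.range N, x^k = (x^N - 1)/(1-β) := by
    rw [geom_sum_eq hx1.ne']; congr 1; rw [hx]; ring
  have hsmall : 6*M*(27/32)^N*(32/5) ≤ 1/162 := by
    have h1 : (27/32:ℝ) ≤ exp (-(1/8)) := by
      have := Real.add_one_le_exp (-(1/8):ℝ)
      linarith
    have h2 : (27/32:ℝ)^N ≤ exp (-(1/8)*N) := by
      rw [mul_comm, Real.exp_nat_mul]; gcongr
    have h3 : exp (-(1/8)*N) ≤ exp (-(log M) + (-9)) := exp_le_exp.2 (by linarith)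
    rw [exp_add, exp_neg, exp_log (by linarith)] at h3
    have h4 : exp (-9) ≤ 1/6480 := by
      have h5 : (2.7:ℝ)^9 ≤ exp 9 := by
        have := Real.exp_one_gt_d9
        rw [show (9:ℝ) = (9:ℕ) * 1 by norm_num, Real.exp_nat_mul]
        gcongr; linarith
      rw [exp_neg, inv_eq_one_div]
      apply one_div_le_one_div_of_le (by norm_num)
      refine le_trans ?_ h5; norm_num
    calc 6*M*(27/32)^N*(32/5) ≤ 6*M*(M⁻¹ * (1/6480))*(32/5) := by
          gcongr; exact h2.trans (h3.trans (by gcongr))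
      _ ≤ 1/162 := by field_simp; norm_num
  have hxN : x^N ≤ exp 10 * M^(8*(1-β)) := by
    have h1 : x ≤ exp (1-β) := by
      have := Real.add_one_le_exp (1-β); linarith
    calc x^N ≤ exp (1-β)^N := by gcongr
      _ = exp (N*(1-β)) := by rw [Real.exp_nat_mul]
      _ ≤ exp (10 + log M * (8*(1-β))) := exp_le_exp.2 (by nlinarith)
      _ = _ := by rw [exp_add, rpow_def_of_pos (by linarith)]
  have hb0 : 0 < 1-β := by linarith
  have hfin : 1/162 ≤ l * x^N/(1-β) := by
    rw [hgeom] at hhead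
    have : l * ((x^N-1)/(1-β)) = l*x^N/(1-β) - l/(1-β) := by ring
    linarith
  rw [le_div_iff₀ hb0] at hfin
  have hl0 : 0 < l := by
    by_contra h
    have : l * x^N ≤ 0 := mul_nonpos_of_nonpos_of_nonneg (not_lt.1 h) (by positivity)
    nlinarith
  have h9 : 1/162*(1-β) ≤ l * (exp 10 * M^(8*(1-β))) := hfin.trans (by gcongr)
  have hMp : 0 < M^(8*(1-β)) := rpow_pos_of_pos (by linarith) _
  rw [show -8*(1-β) = -(8*(1-β)) by ring, rpow_neg (by linarith), exp_neg]
  rw [← div_eq_mul_inv, div_le_iff₀ hMp]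
  rw [show (exp 10)⁻¹ / 162 * (1-β) = (1/162*(1-β)) / exp 10 by field_simp, div_le_iff₀ (exp_pos _)]
  linarith

lemma swc_real {q : ℕ} [NeZero q] {χ : DirichletCharacter ℂ q} (h2 : χ ^ 2 = 1) (n : ℕ) :
    ((swc χ n).re : ℂ) = swc χ n := by
  unfold swc; split_ifs
  · simp
  · exact sw_real h2 _

lemma swE_two {q : ℕ} [NeZero q] {χ : DirichletCharacter ℂ q} (h2 : χ ^ 2 = 1) :
    ∃ r : ℝ, 1/3 ≤ r ∧ swE χ 2 = r := by
  have h0 : swE χ 2 = LSeries (swc χ) 2 := by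
    rw [swE_eq χ (by norm_num)]; ring
  have hs : LSeriesSummable (swc χ) 2 :=
    LSeriesSummable_of_bounded_of_one_lt_re (m := 1) (fun n _ => swc_norm χ n) (by norm_num)
  have hL := hs.LSeriesHasSum
  unfold LSeriesHasSum at hL
  have ht : ∀ n, LSeries.term (swc χ) 2 n = (((swc χ n).re / n^2 : ℝ) : ℂ) := by
    intro n
    rcases eq_or_ne n 0 with rfl | h
    · simp
    · rw [LSeries.term_of_ne_zero h]
      push_cast
      rw [swc_real h2]
      congr 1
      exact_mod_cast Complex.cpow_natCast (n:ℂ) 2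
  have hf : LSeries.term (swc χ) 2 = fun n : ℕ => (((swc χ n).re / n^2 : ℝ) : ℂ) := funext ht
  rw [hf] at hL
  have hre := Complex.hasSum_re hL
  have him := Complex.hasSum_im hL
  simp only [Complex.ofReal_re, Complex.ofReal_im] at hre him
  have him0 : (LSeries (swc χ) 2).im = 0 := him.unique hasSum_zero
  refine ⟨(LSeries (swc χ) 2).re, ?_, ?_⟩
  · have h1 : HasSum (fun n : ℕ => if n = 1 then (2:ℝ) else 0) 2 := hasSum_ite_eq 1 2
    have h3 := h1.sub hasSum_zeta_two
    have := hasSum_le (fun n => ?_) h3 hre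
    · have := Real.pi_lt_d2
      have := Real.pi_pos
      nlinarith
    · split_ifs with h
      · subst h
        have : swc χ 1 = 1 := by unfold swc; split_ifs <;> simp
        rw [this]; norm_num
      · have h4 := (abs_le.1 ((Complex.abs_re_le_norm _).trans (swc_norm χ n))).1
        rw [zero_sub, ← neg_div]
        gcongr
  · rw [h0]; exact Complex.ext (by simp) (by simp [him0])

def swG (P : ℂ → ℂ) (k : ℂ) (h : ℕ → ℝ) (c : ℝ) : Prop :=
  Differentiable ℂ P ∧ (∀ s : ℂ, 1 < s.re → P s ≠ 0 ∧ LSeriesSummable (fun n => (h n : ℂ)) s ∧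
    deriv P s / P s = k/(s-1) - LSeries (fun n => (h n : ℂ)) s) ∧ ∃ r : ℝ, c ≤ r ∧ P 2 = r

lemma swG_mul {P Q : ℂ → ℂ} {k l : ℂ} {g h : ℕ → ℝ} {c d : ℝ} (hc : 0 ≤ c) (hd : 0 ≤ d)
    (hP : swG P k g c) (hQ : swG Q l h d) :
    swG (fun s => P s * Q s) (k+l) (fun n => g n + h n) (c*d) := by
  obtain ⟨p1, p2, r, p3, p4⟩ := hP
  obtain ⟨q1, q2, t, q3, q4⟩ := hQ
  refine ⟨p1.mul q1, fun s hs => ?_, r*t, by gcongr; linarith, by simp only [p4, q4]; push_cast; ring⟩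
  obtain ⟨a1, a2, a3⟩ := p2 s hs
  obtain ⟨b1, b2, b3⟩ := q2 s hs
  have hfun : (fun n => ((g n + h n : ℝ) : ℂ)) = (fun n => (g n : ℂ)) + (fun n => (h n : ℂ)) := by
    funext n; simp
  refine ⟨mul_ne_zero a1 b1, ?_, ?_⟩
  · rw [hfun]; exact a2.add b2
  · rw [hfun, LSeries_add a2 b2]
    have : deriv (fun s => P s * Q s) s = deriv P s * Q s + P s * deriv Q s :=
      deriv_fun_mul (p1 s) (q1 s)
    rw [this]
    have h1 : (deriv P s * Q s + P s * deriv Q s) / (P s * Q s) = deriv P s / P s + deriv Q s / Q s := by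
      field_simp
    rw [h1, a3, b3]; ring

lemma swG_swE {q : ℕ} [NeZero q] {χ : DirichletCharacter ℂ q} (h2 : χ ^ 2 = 1) :
    swG (swE χ) (swk χ) (fun n => (swc χ n).re * ArithmeticFunction.vonMangoldt n) (1/3) := by
  refine ⟨swE_diff χ, fun s hs => ⟨swE_ne χ hs, ?_, ?_⟩, swE_two h2⟩
  · have := sw_LamSummable χ hs
    convert this using 2 with n
    push_cast; rw [swc_real h2]
  · rw [swE_logderiv χ hs]
    congr 3
    funext n
    push_cast; rw [swc_real h2]

lemma swE_disc {q : ℕ} [NeZero q] (χ : DirichletCharacter ℂ q) {s : ℂ} (hs : ‖s - 2‖ ≤ 4/3) :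
    ‖swE χ s‖ ≤ 76 * q := by
  have h1 := (abs_le.1 ((Complex.abs_re_le_norm _).trans hs)).1
  simp at h1
  have h2 : ‖s‖ ≤ 10/3 := by
    have := norm_le_norm_add_norm_sub' s 2
    norm_num at this; linarith
  refine (swE_upper χ (by linarith)).trans ?_
  have : (‖s‖+1)^2 ≤ 19 := by nlinarith [norm_nonneg s]
  have hq : (0:ℝ) ≤ q := by positivity
  nlinarith

open scoped ComplexOrder in
lemma sw_est' {P : ℂ → ℂ} {g : ℕ → ℝ} {c : ℝ} (hG : swG P 1 g c) (hc : 1/81 ≤ c) (hg : ∀ n, 0 ≤ g n)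
    {M : ℝ} (hM : 1 ≤ M)
    (hb : ∀ s, ‖s-2‖ ≤ 4/3 → ‖P s‖ ≤ M) {β : ℝ} (hβ : 7/8 ≤ β) (hβ1 : β < 1)
    (hPβ : 0 ≤ (P β).re) :
    exp (-10)/162 * (1-β) * M^(-8*(1-β)) ≤ ‖P 1‖ := by
  obtain ⟨h1, h2, r, h3, h4⟩ := hG
  refine (sw_est h1 hg (fun s hs => (h2 s hs).2.1) (fun s hs => ⟨(h2 s hs).1, (h2 s hs).2.2⟩) ?_ ?_ hM hb hβ hβ1 hPβ).trans (Complex.re_le_norm _)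
  · rw [h4]; exact Complex.zero_le_real.2 (by linarith)
  · rw [h4]; simp; linarith

lemma swE_triv : swE (1 : DirichletCharacter ℂ 1) = riemannZeta₁ := by
  funext s; simp [swE]

lemma sw_two {q : ℕ} [NeZero q] {χ : DirichletCharacter ℂ q} (hχ : χ ≠ 1) (h2 : χ ^ 2 = 1)
    {β : ℝ} (hβ : 7/8 ≤ β) (hβ1 : β < 1) (hz : 0 ≤ (riemannZeta₁ β).re)
    (hL : 0 ≤ (DirichletCharacter.LFunction χ β).re) :
    exp (-10)/162 * (1-β) * (5776 * q)^(-8*(1-β)) ≤ ‖DirichletCharacter.LFunction χ 1‖ := by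
  have hq : (1:ℝ) ≤ q := by exact_mod_cast NeZero.pos q
  have hE : swE χ = DirichletCharacter.LFunction χ := by funext s; simp [swE, hχ]
  have h1 := swG_swE (χ := (1 : DirichletCharacter ℂ 1)) (by simp)
  have h3 := swG_mul (by norm_num) (by norm_num) h1 (swG_swE h2)
  have hk : swk (1 : DirichletCharacter ℂ 1) + swk χ = 1 := by simp [swk, hχ]
  rw [hk] at h3
  have := sw_est' h3 (by norm_num) (fun n => ?_) (M := 5776*q) (by linarith) (fun s hs => ?_) hβ hβ1 ?_
  · rw [swE_triv, hE, riemannZeta₁_one, one_mul] at this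
    exact this
  · have h4 := (abs_le.1 ((Complex.abs_re_le_norm _).trans (swc_norm χ n))).1
    have : (swc (1 : DirichletCharacter ℂ 1) n) = 1 := by simp [swc]
    rw [this, ← add_mul]
    exact mul_nonneg (by simp; linarith) ArithmeticFunction.vonMangoldt_nonneg
  · rw [norm_mul]
    calc _ ≤ (76 * ((1:ℕ):ℝ)) * (76*q) := by gcongr <;> exact swE_disc _ hs
      _ = _ := by push_cast; ring
  · rw [swE_triv, hE, ← sw_Lreal hχ h2 (by linarith : (0:ℝ) < β), Complex.re_mul_ofReal]
    exact mul_nonneg hz hL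

lemma sw_chi12 {q r : ℕ} [NeZero q] [NeZero r] (χ : DirichletCharacter ℂ q) (ψ : DirichletCharacter ℂ r)
    (n : ℕ) : (χ.changeLevel (q.dvd_mul_right r) * ψ.changeLevel (r.dvd_mul_left q)) (n : ZMod (q*r))
      = χ (n : ZMod q) * ψ (n : ZMod r) := by
  rw [MulChar.mul_apply]
  by_cases h : n.Coprime (q*r)
  · have h' : IsCoprime (n:ℤ) ((q*r : ℕ):ℤ) := Nat.isCoprime_iff_coprime.2 h
    have h1 := χ.changeLevel_eq_cast_of_dvd' (q.dvd_mul_right r) h'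
    have h2 := ψ.changeLevel_eq_cast_of_dvd' (r.dvd_mul_left q) h'
    simp only [Int.cast_natCast] at h1 h2
    rw [h1, h2]
  · have h0 : ¬ IsUnit (n : ZMod (q*r)) := by rwa [ZMod.isUnit_iff_coprime]
    rw [MulChar.map_nonunit _ h0, zero_mul]
    rw [Nat.coprime_mul_iff_right, not_and_or] at h
    rcases h with h | h
    · rw [MulChar.map_nonunit χ (by rwa [ZMod.isUnit_iff_coprime]), zero_mul]
    · rw [MulChar.map_nonunit ψ (by rwa [ZMod.isUnit_iff_coprime]), mul_zero]

lemma sw_four {q r : ℕ} [NeZero q] [NeZero r] {χ : DirichletCharacter ℂ q} {ψ : DirichletCharacter ℂ r}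
    (hχ : χ ≠ 1) (h2 : χ ^ 2 = 1) (hψ : ψ ≠ 1) (hψ2 : ψ ^ 2 = 1)
    {β : ℝ} (hβ : 7/8 ≤ β) (hβ1 : β < 1) (h0 : DirichletCharacter.LFunction χ β = 0)
    (hn0 : DirichletCharacter.LFunction ψ β ≠ 0) {η : ℝ} (hη : 0 < η) (hη1 : η ≤ 1) :
    exp (-10)/162 * (1-β) * (76^4 * (q*r)^2)^(-8*(1-β)) ≤ ‖DirichletCharacter.LFunction χ 1‖ *
      ‖DirichletCharacter.LFunction ψ 1‖ * ((q*r)^η/η) := by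
  have hq : (1:ℝ) ≤ q := by exact_mod_cast NeZero.pos q
  have hr : (1:ℝ) ≤ r := by exact_mod_cast NeZero.pos r
  have hEχ : swE χ = DirichletCharacter.LFunction χ := by funext s; simp [swE, hχ]
  have hEψ : swE ψ = DirichletCharacter.LFunction ψ := by funext s; simp [swE, hψ]
  set ω := χ.changeLevel (q.dvd_mul_right r) * ψ.changeLevel (r.dvd_mul_left q) with hω
  have hω2 : ω ^ 2 = 1 := by
    rw [hω, mul_pow, ← map_pow, ← map_pow, h2, hψ2, map_one, map_one, one_mul]
  have hω1 : ω ≠ 1 := by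
    intro h
    have h3 : χ.changeLevel (q.dvd_mul_right r) = ψ.changeLevel (r.dvd_mul_left q) := by
      have h4 : ψ.changeLevel (r.dvd_mul_left q) * ψ.changeLevel (r.dvd_mul_left q) = 1 := by
        rw [← pow_two, ← map_pow, hψ2, map_one]
      calc _ = χ.changeLevel (q.dvd_mul_right r) * (ψ.changeLevel (r.dvd_mul_left q) * ψ.changeLevel (r.dvd_mul_left q)) := by rw [h4, mul_one]
        _ = _ := by rw [← mul_assoc, ← hω, h, one_mul]
    have h5 := DirichletCharacter.LFunction_changeLevel (q.dvd_mul_right r) χ (s := β) (Or.inl hχ)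
    have h6 := DirichletCharacter.LFunction_changeLevel (r.dvd_mul_left q) ψ (s := β) (Or.inl hψ)
    rw [← h3, h5, h0, zero_mul] at h6
    refine mul_ne_zero hn0 ?_ h6.symm
    rw [Finset.prod_ne_zero_iff]
    intro p hp h7
    have hp2 : (1:ℝ) < p := by exact_mod_cast (Nat.prime_of_mem_primeFactors hp).one_lt
    have h8 : ‖ψ (p : ZMod r) * (p:ℂ)^(-(β:ℂ))‖ < 1 := by
      rw [norm_mul, Complex.norm_natCast_cpow_of_pos (by exact_mod_cast (by linarith : (0:ℝ) < p))]
      have h9 : (p:ℝ)^(-(β:ℂ)).re < 1 := by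
        simp only [Complex.neg_re, Complex.ofReal_re]
        exact rpow_lt_one_of_one_lt_of_neg hp2 (by linarith)
      have h10 := ψ.norm_le_one (p : ZMod r)
      nlinarith [rpow_nonneg (by linarith : (0:ℝ) ≤ p) (-(β:ℂ)).re]
    rw [← sub_eq_zero.1 h7] at h8
    simp at h8
  have hEω : swE ω = DirichletCharacter.LFunction ω := by funext s; simp [swE, hω1]
  have h1 := swG_swE (χ := (1 : DirichletCharacter ℂ 1)) (by simp)
  have h3 := swG_mul (by norm_num) (by norm_num) (swG_mul (by norm_num) (by norm_num) h1 (swG_swE h2)) (swG_mul (by norm_num) (by norm_num) (swG_swE hψ2) (swG_swE hω2))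
  have hk : swk (1 : DirichletCharacter ℂ 1) + swk χ + (swk ψ + swk ω) = 1 := by simp [swk, hχ, hψ, hω1]
  rw [hk] at h3
  have := sw_est' h3 (by norm_num) (fun n => ?_) (M := 76^4*(q*r)^2) ?_ (fun s hs => ?_) hβ hβ1 ?_
  · rw [swE_triv, hEχ, hEψ, hEω, riemannZeta₁_one, one_mul, norm_mul, norm_mul, ← mul_assoc] at this
    refine this.trans ?_
    gcongr
    have h4 := sw_L_bound hω1 hη.le hη1 (s := 1) (by norm_num) (by simpa using hη)
    simpa using h4
  · have h5 : swc ω n = swc χ n * swc ψ n := by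
      simp only [swc, hχ, hψ, hω1, if_false]; exact sw_chi12 χ ψ n
    have h6 : (swc ω n).re = (swc χ n).re * (swc ψ n).re := by
      rw [h5, ← swc_real h2, Complex.re_ofReal_mul]; simp
    have h4 := (abs_le.1 ((Complex.abs_re_le_norm _).trans (swc_norm χ n))).1
    have h7 := (abs_le.1 ((Complex.abs_re_le_norm _).trans (swc_norm ψ n))).1
    have : (swc (1 : DirichletCharacter ℂ 1) n) = 1 := by simp [swc]
    rw [this, h6, ← add_mul, ← add_mul, ← add_mul]
    refine mul_nonneg ?_ ArithmeticFunction.vonMangoldt_nonneg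
    simp only [Complex.one_re]
    nlinarith
  · have : (1:ℝ) ≤ q*r := by nlinarith
    nlinarith
  · rw [norm_mul, norm_mul, norm_mul]
    calc _ ≤ ((76 * ((1:ℕ):ℝ)) * (76*q)) * ((76*r) * (76*(q*r:ℕ))) := by gcongr <;> exact swE_disc _ hs
      _ = _ := by push_cast; ring
  · rw [hEχ, h0]; simp

lemma sw_siegel0 {ε : ℝ} (hε : 0 < ε) (hε1 : ε ≤ 1) : ∃ c : ℝ, 0 < c ∧ ∀ (q : ℕ) [NeZero q] (χ : DirichletCharacter ℂ q),
    χ ≠ 1 → χ ^ 2 = 1 → c * (q:ℝ)^(-ε) ≤ ‖DirichletCharacter.LFunction χ 1‖ := by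
  obtain ⟨η, hη, hηz⟩ : ∃ η > 0, ∀ x : ℝ, |x - 1| ≤ η → 0 ≤ (riemannZeta₁ x).re := by
    have hc : Continuous (fun x : ℝ => (riemannZeta₁ x).re) :=
      Complex.continuous_re.comp (differentiable_riemannZeta₁.continuous.comp Complex.continuous_ofReal)
    have : ∀ᶠ x : ℝ in nhds 1, 0 < (riemannZeta₁ x).re := by
      apply hc.continuousAt.eventually_const_lt
      simp [riemannZeta₁_one]
    obtain ⟨η, h1, h2⟩ := Metric.eventually_nhds_iff.1 this
    refine ⟨η/2, by linarith, fun x hx => (h2 ?_).le⟩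
    rw [Real.dist_eq]; linarith
  set d : ℝ := min (1/8) (min η (ε/32)) with hd
  have hd0 : 0 < d := by positivity
  have hd1 : d ≤ 1/8 := min_le_left _ _
  have hd2 : d ≤ η := (min_le_right _ _).trans (min_le_left _ _)
  have hd3 : d ≤ ε/32 := (min_le_right _ _).trans (min_le_right _ _)
  -- two factor consequence
  have two : ∀ β : ℝ, 1 - d ≤ β → β < 1 → ∀ (q : ℕ) [NeZero q] (χ : DirichletCharacter ℂ q),
      χ ≠ 1 → χ ^ 2 = 1 → 0 ≤ (DirichletCharacter.LFunction χ β).re →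
      exp (-10)/162 * (1-β) * 5776^(-8*(1-β)) * (q:ℝ)^(-ε) ≤ ‖DirichletCharacter.LFunction χ 1‖ := by
    intro β hβ hβ1 q _ χ hχ h2 hL
    have hq : (1:ℝ) ≤ q := by exact_mod_cast NeZero.pos q
    refine le_trans ?_ (sw_two hχ h2 (by linarith) hβ1 (hηz β (by rw [abs_le]; constructor <;> linarith)) hL)
    rw [mul_rpow (by norm_num) (by linarith), ← mul_assoc]
    have : 0 < 1-β := by linarith
    gcongr
    linarith
  by_cases hA : ∀ (q : ℕ) (_ : NeZero q) (χ : DirichletCharacter ℂ q), χ ≠ 1 → χ ^ 2 = 1 →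
      ∀ x : ℝ, 1 - d ≤ x → x < 1 → DirichletCharacter.LFunction χ x ≠ 0
  · refine ⟨exp (-10)/162 * (1-(1-d)) * 5776^(-8*(1-(1-d))), ?_, ?_⟩
    · have : 0 < 1 - (1-d) := by linarith
      positivity
    · intro q _ χ hχ h2
      refine two (1-d) le_rfl (by linarith) q χ hχ h2 ?_
      by_contra hneg
      push Not at hneg
      have hcont : Continuous (fun x : ℝ => (DirichletCharacter.LFunction χ x).re) :=
        Complex.continuous_re.comp ((DirichletCharacter.differentiable_LFunction hχ).continuous.comp Complex.continuous_ofReal)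
      obtain ⟨r, hr, hr2⟩ := swE_two h2
      have hE : swE χ = DirichletCharacter.LFunction χ := by funext s; simp [swE, hχ]
      rw [hE] at hr2
      have h3 : (0:ℝ) ∈ Set.Icc ((DirichletCharacter.LFunction χ (1-d:ℝ)).re) ((DirichletCharacter.LFunction χ (2:ℝ)).re) := by
        refine ⟨hneg.le, ?_⟩
        push_cast
        rw [hr2]; simp; linarith
      obtain ⟨x, hx, hx0⟩ := intermediate_value_Icc (by linarith : 1 - d ≤ 2) hcont.continuousOn h3
      have hx1 : DirichletCharacter.LFunction χ x = 0 := by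
        rw [← sw_Lreal hχ h2 (by linarith [hx.1] : (0:ℝ) < x)]
        exact_mod_cast hx0
      by_cases hlt : x < 1
      · exact hA q _ χ hχ h2 x hx.1 hlt hx1
      · exact DirichletCharacter.LFunction_ne_zero_of_one_le_re χ (Or.inl hχ) (by simpa using hlt) hx1
  · push Not at hA
    obtain ⟨r, hr, ψ, hψ, hψ2, β, hβ, hβ1, h0⟩ := hA
    have hb : 0 < 1 - β := by linarith
    have hr1 : (1:ℝ) ≤ r := by exact_mod_cast NeZero.pos r
    have hL1 : DirichletCharacter.LFunction ψ 1 ≠ 0 :=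
      DirichletCharacter.LFunction_ne_zero_of_one_le_re ψ (Or.inl hψ) (by simp)
    set B := ‖DirichletCharacter.LFunction ψ 1‖ * ((r:ℝ)^(ε/2)/(ε/2)) with hB
    have hBpos : 0 < B := mul_pos (norm_pos_iff.2 hL1) (by positivity)
    set A := exp (-10)/162 * (1-β) * (76^4 * (r:ℝ)^2)^(-8*(1-β)) with hA
    have hApos : 0 < A := by positivity
    refine ⟨min (exp (-10)/162 * (1-β) * 5776^(-8*(1-β))) (A/B), by positivity, ?_⟩
    intro q _ χ hχ h2
    have hq : (1:ℝ) ≤ q := by exact_mod_cast NeZero.pos q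
    have hq0 : (0:ℝ) < q := by linarith
    by_cases hL : 0 ≤ (DirichletCharacter.LFunction χ β).re
    · refine le_trans ?_ (two β hβ hβ1 q χ hχ h2 hL)
      gcongr; exact min_le_left _ _
    · have h4 := sw_four hψ hψ2 hχ h2 (by linarith) hβ1 h0 (by rintro h; rw [h] at hL; simp at hL) (by linarith : 0 < ε/2) (by linarith)
      have h5 : A * (q:ℝ)^(-(ε/2)) ≤ exp (-10)/162 * (1-β) * (76^4 * ((r:ℝ)*q)^2)^(-8*(1-β)) := by
        rw [mul_pow, ← mul_assoc, mul_rpow (by positivity) (by positivity), ← mul_assoc]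
        gcongr
        rw [← rpow_natCast, ← rpow_mul hq0.le]
        exact rpow_le_rpow_of_exponent_le hq (by push_cast; linarith)
      have h6 := h5.trans h4
      rw [mul_rpow (by linarith) (by linarith)] at h6
      have h7 : A * (q:ℝ)^(-(ε/2)) ≤ B * (q:ℝ)^(ε/2) * ‖DirichletCharacter.LFunction χ 1‖ := by
        rw [hB]; refine h6.trans (le_of_eq ?_); ring
      have h8 : (q:ℝ)^(-ε) = (q:ℝ)^(-(ε/2)) / (q:ℝ)^(ε/2) := by
        rw [← rpow_sub hq0]; congr 1; ring
      calc _ ≤ (A/B) * (q:ℝ)^(-ε) := by gcongr; exact min_le_right _ _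
        _ ≤ _ := by
          rw [h8, div_mul_div_comm, div_le_iff₀ (by positivity)]; linarith

lemma sw_siegel {ε : ℝ} (hε : 0 < ε) : ∃ c : ℝ, 0 < c ∧ ∀ (q : ℕ) [NeZero q] (χ : DirichletCharacter ℂ q),
    χ ≠ 1 → χ ^ 2 = 1 → c * (q:ℝ)^(-ε) ≤ ‖DirichletCharacter.LFunction χ 1‖ := by
  obtain ⟨c, hc, h⟩ := sw_siegel0 (ε := min ε 1) (by positivity) (min_le_right _ _)
  refine ⟨c, hc, fun q _ χ hχ h2 => le_trans ?_ (h q χ hχ h2)⟩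
  have hq : (1:ℝ) ≤ q := by exact_mod_cast NeZero.pos q
  gcongr
  exact min_le_left _ _

lemma sw_nonvan {ε : ℝ} (hε : 0 < ε) : ∃ c : ℝ, 0 < c ∧ ∀ (q : ℕ) [NeZero q] (χ : DirichletCharacter ℂ q),
    χ ^ 2 = 1 → ∀ s : ℂ, ‖s - 1‖ ≤ c * (q:ℝ)^(-ε) → swE χ s ≠ 0 := by
  obtain ⟨c0, hc0, h0⟩ := sw_siegel (half_pos hε)
  obtain ⟨r, hr, hz⟩ := Metric.eventually_nhds_iff.1 riemannZeta₁_ne_zero_of_near_one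
  set η := min (ε/2) 1 with hη
  have hη0 : 0 < η := by positivity
  have hη1 : η ≤ 1 := min_le_right _ _
  have hη2 : η ≤ ε/2 := min_le_left _ _
  refine ⟨min (r/2) (min (η/4) (c0*η^2/36)), by positivity, ?_⟩
  intro q _ χ h2 s hs
  have hq : (1:ℝ) ≤ q := by exact_mod_cast NeZero.pos q
  have hq0 : (0:ℝ) < q := by linarith
  have hqe : (q:ℝ)^(-ε) ≤ 1 := rpow_le_one_of_one_le_of_nonpos hq (by linarith)
  have hqe0 : (0:ℝ) < (q:ℝ)^(-ε) := by positivity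
  have hs1 : ‖s-1‖ ≤ r/2 := by
    refine hs.trans ((mul_le_mul_of_nonneg_right (min_le_left _ _) hqe0.le).trans ?_)
    nlinarith
  have hs2 : ‖s-1‖ ≤ η/4 := by
    refine hs.trans ((mul_le_mul_of_nonneg_right ((min_le_right _ _).trans (min_le_left _ _)) hqe0.le).trans ?_)
    nlinarith
  have hs3 : ‖s-1‖ ≤ c0*η^2/36 * (q:ℝ)^(-ε) := by
    refine hs.trans ((mul_le_mul_of_nonneg_right ((min_le_right _ _).trans (min_le_right _ _)) hqe0.le))
  by_cases hχ : χ = 1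
  · simp only [swE, hχ, if_true]
    apply hz; rw [dist_eq_norm]; linarith
  · simp only [swE, hχ, if_false]
    have hb : ∀ z ∈ Metric.ball (1:ℂ) (η/2), ‖DirichletCharacter.LFunction χ z‖ ≤ 4*(q:ℝ)^η/η := by
      intro z hz
      rw [mem_ball_iff_norm] at hz
      have h1 := (abs_le.1 ((Complex.abs_re_le_norm _).trans hz.le)).1
      simp at h1
      have h3 : ‖z‖ ≤ 2 := by
        have := norm_le_norm_add_norm_sub' z 1
        norm_num at this; linarith
      refine (sw_L_bound hχ hη0.le hη1 (by linarith) (by linarith)).trans ?_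
      have hp : 0 < z.re + η - 1 := by linarith
      calc _ ≤ 2 * ((q:ℝ)^η/(η/2)) := by gcongr; linarith
        _ = _ := by field_simp; norm_num
    have hmaps : Set.MapsTo (DirichletCharacter.LFunction χ) (Metric.ball 1 (η/2)) (Metric.ball (DirichletCharacter.LFunction χ 1) (9*(q:ℝ)^η/η)) := by
      intro z hz
      rw [mem_ball_iff_norm]
      refine lt_of_le_of_lt (norm_sub_le _ _) ?_
      have h1 := hb z hz
      have h3 := hb 1 (by simpa using hη0)
      have : 0 < (q:ℝ)^η/η := by positivity
      have e1 : 4*(q:ℝ)^η/η = 4*((q:ℝ)^η/η) := by ring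
      have e2 : 9*(q:ℝ)^η/η = 9*((q:ℝ)^η/η) := by ring
      rw [e1] at h1 h3; rw [e2]; linarith
    have := Complex.dist_le_div_mul_dist_of_mapsTo_ball (DirichletCharacter.differentiable_LFunction hχ).differentiableOn (hmaps.mono_right Metric.ball_subset_closedBall) (z := s) (by rw [mem_ball_iff_norm]; linarith)
    rw [dist_eq_norm, dist_eq_norm] at this
    intro hs0
    rw [hs0, zero_sub, norm_neg] at this
    have h5 := (h0 q χ hχ h2).trans this
    have h6 : (q:ℝ)^η ≤ (q:ℝ)^(ε/2) := rpow_le_rpow_of_exponent_le hq hη2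
    have h7 : 9*(q:ℝ)^η/η/(η/2) * ‖s-1‖ ≤ 18*(q:ℝ)^(ε/2)/η^2 * (c0*η^2/36 * (q:ℝ)^(-ε)) := by
      have : 9*(q:ℝ)^η/η/(η/2) = 18*(q:ℝ)^η/η^2 := by field_simp; norm_num
      rw [this]; gcongr
    have h8 : (q:ℝ)^(ε/2) * (q:ℝ)^(-ε) = (q:ℝ)^(-(ε/2)) := by
      rw [← rpow_add hq0]; congr 1; ring
    have h9 : 18*(q:ℝ)^(ε/2)/η^2 * (c0*η^2/36 * (q:ℝ)^(-ε)) = c0/2 * (q:ℝ)^(-(ε/2)) := by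
      rw [← h8]; field_simp; norm_num
    have h10 : 0 < (q:ℝ)^(-(ε/2)) := by positivity
    nlinarith

noncomputable def swf (u : ℝ) : ℂ :=
  (Set.Ioc (0:ℝ) 1).indicator (fun _ => (1:ℂ)) u - (Set.Ioc (0:ℝ) 1).indicator (fun t => (t:ℂ)^(1:ℂ)) u

lemma swf_eq {u : ℝ} (hu : 0 < u) : swf u = ((max (1-u) 0 : ℝ) : ℂ) := by
  unfold swf
  by_cases h : u ≤ 1
  · have hm : u ∈ Set.Ioc (0:ℝ) 1 := ⟨hu, h⟩
    rw [Set.indicator_of_mem hm, Set.indicator_of_mem hm, max_eq_left (by linarith)]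
    push_cast; simp
  · have hm : u ∉ Set.Ioc (0:ℝ) 1 := fun h' => h h'.2
    rw [Set.indicator_of_notMem hm, Set.indicator_of_notMem hm, max_eq_right (by linarith)]
    simp

lemma swf_mellin {s : ℂ} (hs : 0 < s.re) : HasMellin swf s (1/(s*(s+1))) := by
  have h1 := hasMellin_one_Ioc hs
  have h2 := hasMellin_cpow_Ioc 1 (s := s) (by simp; linarith)
  have h3 := hasMellin_sub h1.1 h2.1
  rw [h1.2, h2.2] at h3
  have hs0 : s ≠ 0 := by rintro rfl; simp at hs
  have hs1 : s + 1 ≠ 0 := by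
    intro h
    have := congrArg Complex.re h
    simp at this; linarith
  have : 1/s - 1/(s+1) = 1/(s*(s+1)) := by field_simp; ring
  rw [this] at h3
  exact h3

lemma sw_kernel_norm {s : ℂ} (hs : 1 ≤ s.re) : ‖1/(s*(s+1))‖ ≤ (1+s.im^2)⁻¹ := by
  rw [norm_div, norm_one, norm_mul, one_div]
  apply inv_anti₀ (by positivity)
  have h1 : ‖s‖^2 = s.re^2 + s.im^2 := by rw [Complex.sq_norm, Complex.normSq_apply]; ring
  have h2 : ‖s+1‖^2 = (s.re+1)^2 + s.im^2 := by rw [Complex.sq_norm, Complex.normSq_apply]; simp; ring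
  have h3 : ‖s‖ ≤ ‖s+1‖ := by
    apply le_of_sq_le_sq _ (norm_nonneg _)
    rw [h1, h2]; nlinarith
  nlinarith [norm_nonneg s]

lemma sw_kernel_int {σ : ℝ} (hσ : 1 ≤ σ) :
    MeasureTheory.Integrable (fun t : ℝ => 1/(((σ:ℂ)+t*Complex.I)*((σ:ℂ)+t*Complex.I+1))) := by
  refine MeasureTheory.Integrable.mono' integrable_inv_one_add_sq ?_ (Eventually.of_forall fun t => ?_)
  · apply Continuous.aestronglyMeasurable
    refine Continuous.div continuous_const (by fun_prop) ?_
    intro t h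
    rcases mul_eq_zero.1 h with h | h
    · have := congrArg Complex.re h
      simp at this; linarith
    · have := congrArg Complex.re h
      simp at this; linarith
  · have := sw_kernel_norm (s := (σ:ℂ)+t*Complex.I) (by simpa using hσ)
    simpa using this

lemma sw_kernel {σ : ℝ} (hσ : 1 ≤ σ) {u : ℝ} (hu : 0 < u) :
    ∫ t : ℝ, (u:ℂ)^(-((σ:ℂ)+t*Complex.I)) * (1/(((σ:ℂ)+t*Complex.I)*((σ:ℂ)+t*Complex.I+1)))
      = 2*π*((max (1-u) 0 : ℝ) : ℂ) := by
  have hm : ∀ t : ℝ, mellin swf ((σ:ℂ)+t*Complex.I) = 1/(((σ:ℂ)+t*Complex.I)*((σ:ℂ)+t*Complex.I+1)) := by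
    intro t
    exact (swf_mellin (by simp; linarith)).2
  have h := mellinInv_mellin_eq σ swf hu (swf_mellin (by simp; linarith)).1 ?_ ?_
  · rw [swf_eq hu] at h
    rw [← h]
    unfold mellinInv
    simp only [hm, smul_eq_mul, Complex.real_smul]
    push_cast
    rw [← mul_assoc]
    have : (2 * (π:ℂ)) * (1/(2*π)) = 1 := by
      have : (π:ℂ) ≠ 0 := by exact_mod_cast pi_ne_zero
      field_simp
    rw [this, one_mul]
  · unfold Complex.VerticalIntegrable
    simp only [hm]
    exact sw_kernel_int hσ
  · have : swf =ᶠ[nhds u] fun u => ((max (1-u) 0 : ℝ) : ℂ) := by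
      filter_upwards [lt_mem_nhds hu] with v hv using swf_eq hv
    refine ContinuousAt.congr ?_ this.symm
    fun_prop

lemma sw_perron {a : ℕ → ℂ} {σ : ℝ} (hσ : 1 ≤ σ) (ha : LSeriesSummable a σ) {x : ℝ} (hx : 0 < x) :
    2*π*∑ n ∈ Finset.Icc 1 ⌊x⌋₊, a n * ((x:ℂ) - n) =
    ∫ t : ℝ, LSeries a ((σ:ℂ)+t*Complex.I) * (x:ℂ)^((σ:ℂ)+t*Complex.I+1) *
       (1/(((σ:ℂ)+t*Complex.I)*((σ:ℂ)+t*Complex.I+1))) := by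
  set K : ℝ → ℂ := fun t => 1/(((σ:ℂ)+t*Complex.I)*((σ:ℂ)+t*Complex.I+1)) with hK
  have hKi : MeasureTheory.Integrable K := sw_kernel_int hσ
  set F : ℕ → ℝ → ℂ := fun n t => LSeries.term a ((σ:ℂ)+t*Complex.I) n * (x:ℂ)^((σ:ℂ)+t*Complex.I+1) * K t with hF
  have hxc : (x:ℂ) ≠ 0 := by exact_mod_cast hx.ne'
  have hform : ∀ n, n ≠ 0 → ∀ t, F n t = (a n * x) * ((((n/x : ℝ):ℂ)^(-((σ:ℂ)+t*Complex.I))) * K t) := by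
    intro n hn t
    have hn' : (0:ℝ) < n := by exact_mod_cast Nat.pos_of_ne_zero hn
    simp only [hF]
    rw [LSeries.term_of_ne_zero hn, Complex.cpow_add _ _ hxc, Complex.cpow_one, Complex.ofReal_div,
      Complex.div_cpow_ofReal_nonneg hn'.le hx.le, Complex.cpow_neg, Complex.cpow_neg]
    simp only [Complex.ofReal_natCast]
    have : (n:ℂ)^((σ:ℂ)+t*Complex.I) ≠ 0 := by
      rw [Ne, Complex.cpow_eq_zero_iff]; simp [hn]
    have h2 : (x:ℂ)^((σ:ℂ)+t*Complex.I) ≠ 0 := by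
      rw [Ne, Complex.cpow_eq_zero_iff]; simp [hx.ne']
    field_simp
  have hnorm : ∀ n t, ‖F n t‖ = ‖LSeries.term a σ n‖ * x^(σ+1) * ‖K t‖ := by
    intro n t
    simp only [hF, norm_mul]
    rw [LSeries.norm_term_eq, LSeries.norm_term_eq, Complex.norm_cpow_eq_rpow_re_of_pos hx]
    simp
  have hint : ∀ n, MeasureTheory.Integrable (F n) := by
    intro n
    refine (hKi.norm.const_mul (‖LSeries.term a σ n‖ * x^(σ+1))).mono' ?_ (Eventually.of_forall fun t => (hnorm n t).le)
    rcases eq_or_ne n 0 with rfl | hn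
    · have : F 0 = fun _ => 0 := by funext t; simp [hF]
      rw [this]; exact MeasureTheory.aestronglyMeasurable_const
    · have : F n = fun t : ℝ => (a n * x) * ((((n/x : ℝ):ℂ)^(-((σ:ℂ)+t*Complex.I))) * K t) := funext (hform n hn)
      rw [this]
      have hn' : (0:ℝ) < n := by exact_mod_cast Nat.pos_of_ne_zero hn
      have hne : ((n/x : ℝ):ℂ) ≠ 0 := by exact_mod_cast (div_pos hn' hx).ne'
      refine MeasureTheory.AEStronglyMeasurable.const_mul (MeasureTheory.AEStronglyMeasurable.mul ?_ hKi.aestronglyMeasurable) _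
      apply Continuous.aestronglyMeasurable
      exact Continuous.const_cpow (by fun_prop) (Or.inl hne)
  have hsum : Summable fun n => ∫ t, ‖F n t‖ := by
    simp only [hnorm, MeasureTheory.integral_const_mul]
    exact (ha.norm.mul_right _).mul_right _
  have hmain := MeasureTheory.hasSum_integral_of_summable_integral_norm hint hsum
  have hR : (fun t => ∑' n, F n t) = fun t : ℝ => LSeries a ((σ:ℂ)+t*Complex.I) * (x:ℂ)^((σ:ℂ)+t*Complex.I+1) * K t := by
    funext t
    simp only [hF, tsum_mul_right]
    rfl
  rw [hR] at hmain
  have hval : ∀ n, n ≠ 0 → ∫ t, F n t = 2*π*(a n * ((max (x-n) 0 : ℝ):ℂ)) := by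
    intro n hn
    have hn' : (0:ℝ) < n := by exact_mod_cast Nat.pos_of_ne_zero hn
    simp only [hform n hn]
    rw [MeasureTheory.integral_const_mul, sw_kernel hσ (div_pos hn' hx)]
    have : (max (x-n) 0 : ℝ) = x * max (1-n/x) 0 := by
      rw [mul_max_of_nonneg _ _ hx.le]; congr 1
      · field_simp
      · simp
    rw [this]; push_cast; ring
  have hfin : HasSum (fun n => ∫ t, F n t) (∑ n ∈ Finset.Icc 1 ⌊x⌋₊, ∫ t, F n t) := by
    apply hasSum_sum_of_ne_finset_zero
    intro n hn
    rcases eq_or_ne n 0 with rfl | h0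
    · simp [hF]
    · rw [hval n h0, max_eq_right]
      · simp
      · rw [Finset.mem_Icc, not_and_or] at hn
        have : ⌊x⌋₊ < n := by omega
        have := (Nat.floor_lt hx.le).1 this
        linarith
  rw [← hfin.unique hmain, Finset.mul_sum]
  refine Finset.sum_congr rfl fun n hn => ?_
  rw [Finset.mem_Icc] at hn
  rw [hval n (by omega), max_eq_left]
  · push_cast; ring
  · have := (Nat.le_floor_iff hx.le).1 hn.2
    linarith

lemma sw_zf {B : ℝ} (hB : 0 < B) : ∃ c : ℝ, 0 < c ∧ c ≤ 1 ∧ ∀ (q : ℕ) [NeZero q] (χ : DirichletCharacter ℂ q)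
    (L : ℝ), 1 ≤ L → (q:ℝ) ≤ exp L → (q:ℝ) ≤ L^(2*B) → ∀ s : ℂ, 1 - c/L ≤ s.re → |s.im| ≤ exp L → swE χ s ≠ 0 := by
  obtain ⟨c1, hc1, h1⟩ := sw_nonvan (ε := 1/(2*B)) (by positivity)
  obtain ⟨c, hc, hc', h⟩ := sw_zerofree (δ := min c1 1) (by positivity) (min_le_right _ _)
  refine ⟨c, hc, hc', fun q _ χ L hL hq1 hq2 => h q χ L hL hq1 fun h2 s hs => h1 q χ h2 s (hs.trans ?_)⟩
  have hq : (1:ℝ) ≤ q := by exact_mod_cast NeZero.pos q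
  have hL0 : 0 < L := by linarith
  have h3 : L⁻¹ ≤ (q:ℝ)^(-(1/(2*B))) := by
    rw [rpow_neg (by linarith)]
    apply inv_anti₀ (by positivity)
    calc (q:ℝ)^(1/(2*B)) ≤ (L^(2*B))^(1/(2*B)) := by gcongr
      _ = L := by rw [← rpow_mul hL0.le, mul_one_div_cancel (by positivity), rpow_one]
  rw [div_eq_mul_inv]
  gcongr
  exact min_le_left _ _

lemma sw_ld {B : ℝ} (hB : 0 < B) : ∃ c C : ℝ, 0 < c ∧ c ≤ 1/16 ∧ 0 < C ∧ ∀ (q : ℕ) [NeZero q] (χ : DirichletCharacter ℂ q)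
    (L : ℝ), 1 ≤ L → (q:ℝ) ≤ exp L → (q:ℝ) ≤ L^(2*B) → ∀ s : ℂ, 1 - c/L ≤ s.re → s.re ≤ 1 + c/L →
      |s.im| ≤ exp L - 1 → swE χ s ≠ 0 ∧ ‖deriv (swE χ) s / swE χ s‖ ≤ C * L^2 := by
  obtain ⟨c, hc, hc', h⟩ := sw_zf hB
  set b := log (16/c) with hb
  have hb0 : 0 ≤ b := log_nonneg (by rw [le_div_iff₀ hc]; linarith)
  have hbe : exp (-b) = c/16 := by rw [exp_neg, hb, exp_log (by positivity), inv_div]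
  refine ⟨c/16, 30*(12+2*b)*4/c, by positivity, by linarith, by positivity, ?_⟩
  intro q _ χ L hL hq1 hq2 s hs1 hs2 hs3
  have hL0 : 0 < L := by linarith
  set y := c/(16*L) with hy
  have hy0 : 0 < y := by positivity
  have hy1 : c/16/L = y := by rw [hy]; field_simp
  have hy2 : c/L = 16*y := by rw [hy]; field_simp
  have hy3 : y ≤ 1/16 := by rw [hy, div_le_div_iff₀ (by positivity) (by norm_num)]; nlinarith
  rw [hy1] at hs1 hs2
  set s0 : ℂ := ⟨1 + y, s.im⟩ with hs0
  have hrat := sw_ratio χ hb0 hL hq1 (s := s0) (by rw [hbe, hy1]) (by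
    have := exp_pos L
    simp only [hs0]; linarith)
  have hnz : ∀ z ∈ Metric.ball s0 (4*y), swE χ z ≠ 0 := by
    intro z hz
    rw [mem_ball_iff_norm] at hz
    have h1 := (abs_le.1 ((Complex.abs_re_le_norm _).trans hz.le)).1
    have h2 := (Complex.abs_im_le_norm _).trans hz.le
    simp only [hs0, Complex.sub_re, Complex.sub_im] at h1 h2
    refine h q χ L hL hq1 hq2 z (by rw [hy2]; linarith) ?_
    have := abs_sub_abs_le_abs_sub z.im s.im
    linarith
  have hbc := sw_bc (swE_diff χ) (c := s0) (r := 4*y) (m := (12+2*b)*L) (by positivity) (by positivity)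
    (fun z hz => hrat z (Metric.ball_subset_closedBall (Metric.ball_subset_ball (by linarith) hz))) hnz
  have hsmem : s ∈ Metric.closedBall s0 (4*y/2) := by
    rw [mem_closedBall_iff_norm]
    have : s - s0 = ((s.re - (1+y) : ℝ) : ℂ) := by
      apply Complex.ext <;> simp [hs0]
    rw [this, Complex.norm_real, Real.norm_eq_abs, abs_le]
    constructor <;> linarith
  refine ⟨?_, (hbc s hsmem).trans (le_of_eq ?_)⟩
  · apply hnz
    refine Metric.closedBall_subset_ball (by linarith) hsmem
  · rw [hy]; field_simp
    norm_num

lemma sw_arctan_le {x : ℝ} (hx : 0 ≤ x) : arctan x ≤ x := by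
  have h := Real.le_tan (arctan_nonneg.2 hx) (arctan_lt_pi_div_two x)
  rwa [tan_arctan] at h

lemma sw_kernel_norm2 {s : ℂ} (hs : 0 ≤ s.re) (h0 : s ≠ 0) :
    (1 + ‖s‖) * ‖1/(s*(s+1))‖ ≤ 2/‖s‖ := by
  have hp : 0 < ‖s‖ := norm_pos_iff.2 h0
  have h1 : 1 ≤ ‖s+1‖ := by
    have := Complex.re_le_norm (s+1)
    simp at this; linarith
  have h2 : ‖s‖ ≤ ‖s+1‖ := by
    apply le_of_sq_le_sq _ (norm_nonneg _)
    rw [Complex.sq_norm, Complex.normSq_apply, Complex.sq_norm, Complex.normSq_apply]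
    simp; nlinarith
  rw [norm_div, norm_one, norm_mul, mul_one_div, div_le_div_iff₀ (by positivity) hp]
  nlinarith

lemma sw_tail {g : ℝ → ℂ} {M T : ℝ} (hT : 0 < T) (hM : 0 ≤ M) (hg : MeasureTheory.Integrable g)
    (hb : ∀ t, ‖g t‖ ≤ M * (1+t^2)⁻¹) :
    ‖∫ t, g t‖ ≤ ‖∫ t in (-T)..T, g t‖ + M * (2/T) := by
  have hM' : MeasureTheory.Integrable (fun t : ℝ => M * (1+t^2)⁻¹) := integrable_inv_one_add_sq.const_mul M
  have hat : π/2 - arctan T ≤ 1/T := by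
    have := arctan_inv_of_pos hT
    have h2 := sw_arctan_le (inv_nonneg.2 hT.le)
    rw [one_div]; linarith
  have h1 : ‖∫ t in Set.Ioi T, g t‖ ≤ M * (1/T) := by
    refine (MeasureTheory.norm_integral_le_of_norm_le hM'.integrableOn (Eventually.of_forall fun t => hb t)).trans ?_
    rw [MeasureTheory.integral_const_mul, integral_Ioi_inv_one_add_sq]
    gcongr
  have h2 : ‖∫ t in Set.Iic (-T), g t‖ ≤ M * (1/T) := by
    refine (MeasureTheory.norm_integral_le_of_norm_le hM'.integrableOn (Eventually.of_forall fun t => hb t)).trans ?_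
    rw [MeasureTheory.integral_const_mul, integral_Iic_inv_one_add_sq, arctan_neg]
    gcongr
    linarith
  have e1 : ∫ t, g t = (∫ t in Set.Iic (-T), g t) + ∫ t in Set.Ioi (-T), g t :=
    (intervalIntegral.integral_Iic_add_Ioi hg.integrableOn hg.integrableOn).symm
  have e2 : ∫ t in Set.Ioi (-T), g t = (∫ t in (-T)..T, g t) + ∫ t in Set.Ioi T, g t :=
    (intervalIntegral.integral_interval_add_Ioi hg.integrableOn hg.integrableOn).symm
  rw [e1, e2]
  have := norm_add_le (∫ t in Set.Iic (-T), g t) ((∫ t in (-T)..T, g t) + ∫ t in Set.Ioi T, g t)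
  have := norm_add_le (∫ t in (-T)..T, g t) (∫ t in Set.Ioi T, g t)
  have : M * (2/T) = M*(1/T) + M*(1/T) := by ring
  linarith

lemma sw_contour {H : ℂ → ℂ} {σ0 σ1 T x D R0 R1 : ℝ} (h0 : 1/2 ≤ σ0) (h01 : σ0 ≤ σ1) (h011 : σ1 ≤ σ0 + 1) (h1 : 1 ≤ σ1)
    (hT : 1 ≤ T) (hx : 0 < x) (hD : 0 ≤ D)
    (hR0 : x^(σ0+1) ≤ R0) (hR1 : ∀ σ, σ0 ≤ σ → σ ≤ σ1 → x^(σ+1) ≤ R1)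
    (hd : ∀ s : ℂ, σ0 ≤ s.re → s.re ≤ σ1 → |s.im| ≤ T → DifferentiableAt ℂ H s ∧ ‖H s‖ ≤ D * (1+‖s‖))
    (hc : Continuous (fun t : ℝ => H ((σ1:ℂ)+t*Complex.I)))
    (hl : ∀ t : ℝ, ‖H ((σ1:ℂ)+t*Complex.I)‖ ≤ D) :
    ‖∫ t : ℝ, H ((σ1:ℂ)+t*Complex.I) * (x:ℂ)^((σ1:ℂ)+t*Complex.I+1) *
       (1/(((σ1:ℂ)+t*Complex.I)*((σ1:ℂ)+t*Complex.I+1)))‖ ≤ D*R1*(6/T) + 8*T*(D*R0) := by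
  set g : ℂ → ℂ := fun s => H s * (x:ℂ)^(s+1) * (1/(s*(s+1))) with hg
  have hxc : (x:ℂ) ≠ 0 := by exact_mod_cast hx.ne'
  have hxn : ∀ s : ℂ, ‖(x:ℂ)^(s+1)‖ = x^(s.re+1) := by
    intro s; rw [Complex.norm_cpow_eq_rpow_re_of_pos hx]; simp
  have hR0' : 0 ≤ R0 := le_trans (by positivity) hR0
  have hR1' : 0 ≤ R1 := le_trans (by positivity) (hR1 σ1 h01 le_rfl)
  have hne : ∀ s : ℂ, σ0 ≤ s.re → s ≠ 0 ∧ s + 1 ≠ 0 := by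
    intro s hs
    constructor
    · rintro rfl; simp at hs; linarith
    · intro h
      have := congrArg Complex.re h
      simp at this; linarith
  have hgb : ∀ s : ℂ, σ0 ≤ s.re → s.re ≤ σ1 → |s.im| ≤ T → ‖g s‖ ≤ D * x^(s.re+1) * (2/‖s‖) := by
    intro s a1 a2 a3
    have := sw_kernel_norm2 (by linarith) (hne s a1).1
    have h5 := (hd s a1 a2 a3).2
    simp only [hg]
    rw [norm_mul, norm_mul, hxn]
    calc _ ≤ D*(1+‖s‖) * x^(s.re+1) * ‖1/(s*(s+1))‖ := by gcongr
      _ = D * x^(s.re+1) * ((1+‖s‖) * ‖1/(s*(s+1))‖) := by ring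
      _ ≤ _ := by gcongr
  have hcont : Continuous (fun t : ℝ => g ((σ1:ℂ)+t*Complex.I)) := by
    simp only [hg]
    refine (hc.mul (Continuous.const_cpow (by fun_prop) (Or.inl hxc))).mul (Continuous.div continuous_const (by fun_prop) ?_)
    intro t
    have := hne ((σ1:ℂ)+t*Complex.I) (by simpa using h01)
    exact mul_ne_zero this.1 this.2
  have hlb : ∀ t : ℝ, ‖g ((σ1:ℂ)+t*Complex.I)‖ ≤ D * R1 * (1+t^2)⁻¹ := by
    intro t
    simp only [hg]
    rw [norm_mul, norm_mul, hxn]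
    have h5 := sw_kernel_norm (s := (σ1:ℂ)+t*Complex.I) (by simpa using h1)
    have h6 : ((σ1:ℂ)+t*Complex.I).im = t := by simp
    have h7 : ((σ1:ℂ)+t*Complex.I).re = σ1 := by simp
    rw [h6] at h5; rw [h7]
    gcongr
    · exact hl t
    · exact hR1 σ1 h01 le_rfl
  have hint : MeasureTheory.Integrable (fun t : ℝ => g ((σ1:ℂ)+t*Complex.I)) :=
    (integrable_inv_one_add_sq.const_mul (D*R1)).mono' hcont.aestronglyMeasurable (Eventually.of_forall hlb)
  have htail := sw_tail (T := T) (by linarith) (by positivity) hint hlb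
  have hrect := Complex.integral_boundary_rect_eq_zero_of_differentiableOn g ⟨σ0, -T⟩ ⟨σ1, T⟩ (by
    intro s hs
    rw [Complex.mem_reProdIm] at hs
    simp only [Set.uIcc_of_le h01, Set.uIcc_of_le (by linarith : -T ≤ T), Set.mem_Icc] at hs
    have h5 := (hd s hs.1.1 hs.1.2 (abs_le.2 hs.2)).1
    have h6 := hne s hs.1.1
    apply DifferentiableAt.differentiableWithinAt
    simp only [hg]
    refine (h5.mul ?_).mul ?_
    · exact DifferentiableAt.const_cpow (by fun_prop) (Or.inl hxc)
    · exact DifferentiableAt.div (by fun_prop) (by fun_prop) (mul_ne_zero h6.1 h6.2))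
  simp only [smul_eq_mul] at hrect
  have hhor : ∀ τ : ℝ, |τ| = T → ‖∫ y in σ0..σ1, g ((y:ℂ) + (τ:ℂ)*Complex.I)‖ ≤ D*R1*(2/T) := by
    intro τ hτ
    have := intervalIntegral.norm_integral_le_of_norm_le_const (f := fun y : ℝ => g ((y:ℂ) + (τ:ℂ)*Complex.I)) (a := σ0) (b := σ1) (C := D*R1*(2/T)) (fun y hy => by
      rw [Set.uIoc_of_le h01] at hy
      have e1 : ((y:ℂ) + (τ:ℂ)*Complex.I).re = y := by simp
      have e2 : ((y:ℂ) + (τ:ℂ)*Complex.I).im = τ := by simp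
      have h5 := hgb ((y:ℂ) + (τ:ℂ)*Complex.I) (by rw [e1]; exact hy.1.le) (by rw [e1]; exact hy.2) (by rw [e2, hτ])
      rw [e1] at h5
      refine h5.trans ?_
      have h6 : T ≤ ‖(y:ℂ) + (τ:ℂ)*Complex.I‖ := by
        rw [← hτ]; have := Complex.abs_im_le_norm ((y:ℂ) + (τ:ℂ)*Complex.I); rwa [e2] at this
      gcongr
      exact hR1 y hy.1.le hy.2)
    refine this.trans ?_
    rw [abs_of_nonneg (by linarith)]
    have : 0 ≤ D*R1*(2/T) := by positivity
    nlinarith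
  have hleft : ‖∫ y in (-T)..T, g ((σ0:ℂ) + (y:ℂ)*Complex.I)‖ ≤ 8*T*(D*R0) := by
    have := intervalIntegral.norm_integral_le_of_norm_le_const (f := fun y : ℝ => g ((σ0:ℂ) + (y:ℂ)*Complex.I)) (a := -T) (b := T) (C := D*R0*4) (fun y hy => by
      rw [Set.uIoc_of_le (by linarith)] at hy
      have e1 : ((σ0:ℂ) + (y:ℂ)*Complex.I).re = σ0 := by simp
      have e2 : ((σ0:ℂ) + (y:ℂ)*Complex.I).im = y := by simp
      have h5 := hgb ((σ0:ℂ) + (y:ℂ)*Complex.I) (by rw [e1]) (by rw [e1]; exact h01) (by rw [e2, abs_le]; exact ⟨hy.1.le, hy.2⟩)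
      rw [e1] at h5
      refine h5.trans ?_
      have h6 : 1/2 ≤ ‖(σ0:ℂ) + (y:ℂ)*Complex.I‖ := by
        have := Complex.re_le_norm ((σ0:ℂ) + (y:ℂ)*Complex.I); rw [e1] at this; linarith
      have h7 : 2/‖(σ0:ℂ) + (y:ℂ)*Complex.I‖ ≤ 4 := by
        rw [div_le_iff₀ (by linarith)]; linarith
      gcongr)
    refine this.trans (le_of_eq ?_)
    rw [abs_of_nonneg (by linarith)]; ring
  have hA := hhor (-T) (by rw [abs_neg, abs_of_nonneg (by linarith)])
  have hB := hhor T (abs_of_nonneg (by linarith))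
  set I1 := ∫ y in σ0..σ1, g ((y:ℂ) + ((-T:ℝ):ℂ)*Complex.I)
  set I2 := ∫ y in σ0..σ1, g ((y:ℂ) + (T:ℂ)*Complex.I)
  set I3 := ∫ y in (-T)..T, g ((σ1:ℂ) + (y:ℂ)*Complex.I)
  set I4 := ∫ y in (-T)..T, g ((σ0:ℂ) + (y:ℂ)*Complex.I)
  have hI3 : ‖I3‖ ≤ ‖I1‖ + ‖I2‖ + ‖I4‖ := by
    have e : Complex.I * I3 = I2 - I1 + Complex.I * I4 := by linear_combination hrect
    have e2 : ‖I3‖ = ‖Complex.I * I3‖ := by simp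
    rw [e2, e]
    refine (norm_add_le _ _).trans ?_
    have := norm_sub_le I2 I1
    have e3 : ‖Complex.I * I4‖ = ‖I4‖ := by simp
    linarith
  have : D*R1*(6/T) = D*R1*(2/T) + D*R1*(2/T) + D*R1*(2/T) := by ring
  refine htail.trans ?_
  linarith

noncomputable def swa {q : ℕ} (χ : DirichletCharacter ℂ q) (n : ℕ) : ℂ :=
  swc χ n * (ArithmeticFunction.vonMangoldt n : ℂ) - swk χ

noncomputable def swH {q : ℕ} [NeZero q] (χ : DirichletCharacter ℂ q) (s : ℂ) : ℂ :=
  -(deriv (swE χ) s / swE χ s) - swk χ * riemannZeta₀ s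

lemma swk_norm {q : ℕ} (χ : DirichletCharacter ℂ q) : ‖swk χ‖ ≤ 1 := by
  unfold swk; split_ifs <;> simp

lemma swa_norm {q : ℕ} (χ : DirichletCharacter ℂ q) {n : ℕ} (hn : n ≠ 0) : ‖swa χ n‖ ≤ log n + 1 := by
  unfold swa
  refine (norm_sub_le _ _).trans (add_le_add ?_ (swk_norm χ))
  rw [norm_mul, Complex.norm_real, Real.norm_of_nonneg ArithmeticFunction.vonMangoldt_nonneg]
  have h1 := swc_norm χ n
  have h2 : ArithmeticFunction.vonMangoldt n ≤ log n := ArithmeticFunction.vonMangoldt_le_log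
  have h3 : 0 ≤ ArithmeticFunction.vonMangoldt n := ArithmeticFunction.vonMangoldt_nonneg
  nlinarith [norm_nonneg (swc χ n)]

lemma swa_sum {q : ℕ} (χ : DirichletCharacter ℂ q) {s : ℂ} (hs : 1 < s.re) :
    LSeriesSummable (swa χ) s := by
  have h1 := sw_LamSummable χ hs
  have h2 : LSeriesSummable (fun _ => swk χ) s :=
    LSeriesSummable_of_bounded_of_one_lt_re (m := 1) (fun n _ => swk_norm χ) hs
  exact h1.sub h2

lemma swH_eq {q : ℕ} [NeZero q] (χ : DirichletCharacter ℂ q) {s : ℂ} (hs : 1 < s.re) :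
    LSeries (swa χ) s = swH χ s := by
  have h1 := sw_LamSummable χ hs
  have h2 : LSeriesSummable (fun _ => swk χ) s :=
    LSeriesSummable_of_bounded_of_one_lt_re (m := 1) (fun n _ => swk_norm χ) hs
  have h3 : LSeries (swa χ) s = _ := LSeries_sub h1 h2
  have h4 : LSeries (fun _ => swk χ) s = swk χ * riemannZeta s := by
    have : (fun _ => swk χ) = swk χ • (1 : ℕ → ℂ) := by funext n; simp
    rw [this, LSeries_smul, LSeries_one_eq_riemannZeta hs]
  have hne : s ≠ 1 := by rintro rfl; simp at hs
  rw [h3, h4]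
  unfold swH
  rw [swE_logderiv χ hs]
  have h5 : riemannZeta s = (s-1)⁻¹ + riemannZeta₀ s := by
    rw [riemannZeta_eq_inv_sub_mul hne, riemannZeta₁]
    have : s - 1 ≠ 0 := sub_ne_zero.2 hne
    field_simp
  rw [h5]; ring

lemma sw_right {q : ℕ} (χ : DirichletCharacter ℂ q) {δ : ℝ} (hδ : 0 < δ) (hδ1 : δ ≤ 1) {s : ℂ}
    (hs : s.re = 1 + 2*δ) : ‖LSeries (swa χ) s‖ ≤ 6/δ^2 := by
  set f : ℕ → ℂ := fun n => swa χ n * (n:ℂ)^(-(δ:ℂ)) * (δ/2) with hf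
  have hfz : ∀ n : ℕ, n ≠ 0 → ‖f n‖ ≤ 1 := by
    intro n hn
    have hn1 : (1:ℝ) ≤ n := by exact_mod_cast Nat.one_le_iff_ne_zero.2 hn
    have h1 := swa_norm χ hn
    have h2 := Real.log_le_rpow_div (by linarith : (0:ℝ) ≤ n) hδ
    have h3 : 1 ≤ (n:ℝ)^δ := one_le_rpow hn1 hδ.le
    have h4 : (n:ℝ)^δ ≤ (n:ℝ)^δ/δ := by
      rw [le_div_iff₀ hδ]; nlinarith
    rw [hf]
    simp only [norm_mul]
    rw [Complex.norm_natCast_cpow_of_pos (by omega)]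
    have h5 : ‖(δ:ℂ)/2‖ = δ/2 := by
      rw [norm_div, Complex.norm_real, Real.norm_of_nonneg hδ.le]; simp
    rw [h5]
    simp only [Complex.neg_re, Complex.ofReal_re]
    calc _ ≤ (2*((n:ℝ)^δ/δ)) * (n:ℝ)^(-δ) * (δ/2) := by gcongr; linarith
      _ = 1 := by
        rw [rpow_neg (by linarith)]; field_simp
  set f' : ℕ → ℂ := fun n => if n = 0 then 0 else f n with hf'
  have hfn : ∀ n, ‖f' n‖ ≤ 1 := by
    intro n
    rw [hf']; dsimp only
    split_ifs with h
    · simp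
    · exact hfz n h
  have h1 := sw_LS_bound hfn (s := s - δ) (by simp; linarith)
  have h2 : LSeries f' (s - δ) = LSeries (swa χ) s * (δ/2) := by
    unfold LSeries
    rw [← tsum_mul_right]
    congr 1; funext n
    rcases eq_or_ne n 0 with rfl | hn
    · simp
    · rw [LSeries.term_of_ne_zero hn, LSeries.term_of_ne_zero hn]
      simp only [hf', hn, if_false, hf]
      have hnc : (n:ℂ) ≠ 0 := by exact_mod_cast hn
      rw [Complex.cpow_sub _ _ hnc, Complex.cpow_neg]
      have : (n:ℂ)^(δ:ℂ) ≠ 0 := by rw [Ne, Complex.cpow_eq_zero_iff]; simp [hn]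
      field_simp
  rw [h2, norm_mul] at h1
  have h5 : ‖(δ:ℂ)/2‖ = δ/2 := by
    rw [norm_div, Complex.norm_real, Real.norm_of_nonneg hδ.le]; simp
  rw [h5] at h1
  have h6 : (s - (δ:ℂ)).re - 1 = δ := by simp; linarith
  rw [h6] at h1
  have h7 : 1/δ + 2 ≤ 3/δ := by
    rw [div_add' _ _ _ hδ.ne']; gcongr; linarith
  rw [le_div_iff₀ (by positivity)]
  have h8 := h1.trans h7
  rw [le_div_iff₀ hδ] at h8
  nlinarith

lemma swH_diff {q : ℕ} [NeZero q] (χ : DirichletCharacter ℂ q) {s : ℂ} (h : swE χ s ≠ 0) :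
    DifferentiableAt ℂ (swH χ) s := by
  have hd1 : DifferentiableAt ℂ (deriv (swE χ)) s := (((swE_diff χ).contDiff (n := 2)).differentiable_deriv_two) s
  have hd2 : DifferentiableAt ℂ riemannZeta₀ s := differentiable_riemannZeta₀ s
  exact ((hd1.fun_div (swE_diff χ s) h).fun_neg).fun_sub (hd2.const_mul _)

lemma swH_bd {q : ℕ} [NeZero q] (χ : DirichletCharacter ℂ q) {s : ℂ} {K : ℝ} (hK : 1 ≤ K) {C : ℝ} (hC : 0 < C)
    (hs : 1/2 ≤ s.re) (h : ‖deriv (swE χ) s / swE χ s‖ ≤ C*K) :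
    ‖swH χ s‖ ≤ (C+3)*K*(1+‖s‖) := by
  unfold swH
  have hz := sw_z0_bound (s := s) (by linarith)
  have hn := norm_nonneg s
  have hz2 : ‖s‖/s.re ≤ 2*‖s‖ := by
    rw [div_le_iff₀ (by linarith)]; nlinarith
  have hk := swk_norm χ
  have hz3 : ‖riemannZeta₀ s‖ ≤ 1 + 2*‖s‖ := hz.trans (by linarith)
  have h5 : ‖swk χ * riemannZeta₀ s‖ ≤ 1 * (1+2*‖s‖) := by
    rw [norm_mul]; exact mul_le_mul hk hz3 (norm_nonneg _) zero_le_one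
  have h6 := norm_sub_le (-(deriv (swE χ) s / swE χ s)) (swk χ * riemannZeta₀ s)
  rw [norm_neg] at h6
  have h7 : 0 ≤ C*K*‖s‖ := by positivity
  have h8 : 0 ≤ (K-1)*‖s‖ := mul_nonneg (by linarith) hn
  linarith

lemma swH_cont {q : ℕ} [NeZero q] (χ : DirichletCharacter ℂ q) {σ : ℝ} (h : 1 < σ) :
    Continuous (fun t : ℝ => swH χ ((σ:ℂ)+t*Complex.I)) := by
  rw [continuous_iff_continuousAt]
  intro t
  have c4 : Continuous (fun t : ℝ => (σ:ℂ)+t*Complex.I) := by fun_prop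
  exact (swH_diff χ (swE_ne χ (by simpa using h))).continuousAt.comp (f := fun t : ℝ => (σ:ℂ)+t*Complex.I) c4.continuousAt

lemma sw_A1 {B : ℝ} (hB : 0 < B) : ∃ c C : ℝ, 0 < c ∧ c ≤ 1 ∧ 0 < C ∧ ∀ (q : ℕ) [NeZero q] (χ : DirichletCharacter ℂ q)
    (L : ℝ), 1 ≤ L → (q:ℝ) ≤ exp L → (q:ℝ) ≤ L^(2*B) → ∀ x : ℝ, 0 < x → x ≤ 2*exp (L^2) →
    ‖∑ n ∈ Finset.Icc 1 ⌊x⌋₊, swa χ n * ((x:ℂ) - n)‖ ≤ C * exp (L^2)^2 * exp (-c*L) := by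
  obtain ⟨c, C, hc, hc', hC, h⟩ := sw_ld hB
  set D0 := C + 3 + 6*64/c^2 with hD0
  have hD0p : 0 < D0 := by positivity
  refine ⟨c/8, 112*D0*(128/c^2), by positivity, by linarith, by positivity, ?_⟩
  intro q _ χ L hL hq1 hq2 x hx hx2
  have hL0 : 0 < L := by linarith
  set D := D0*L^2 with hD
  have hDp : 0 < D := by positivity
  set σ0 := 1 - c/L with hσ0
  set σ1 := 1 + 2*(c/(8*L)) with hσ1
  set T := exp (c/2*L) with hT
  have hcL : c/L ≤ 1/16 := by rw [div_le_iff₀ hL0]; nlinarith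
  have hcL0 : 0 < c/L := by positivity
  have hcL8 : c/(8*L) = (c/L)/8 := by field_simp
  have hT1 : 1 ≤ T := by rw [hT]; exact one_le_exp (by positivity)
  have hTL : T ≤ exp L - 1 := by
    have h1 : T * 2 ≤ exp L := by
      have : (2:ℝ) ≤ exp (31/32*L) := by
        have h2 := Real.quadratic_le_exp_of_nonneg (x := 31/32*L) (by positivity)
        nlinarith
      calc T*2 ≤ exp (1/32*L) * exp (31/32*L) := by
            rw [hT]
            exact mul_le_mul (exp_le_exp.2 (by nlinarith)) this (by norm_num) (exp_pos _).le
        _ = exp L := by rw [← exp_add]; congr 1; ring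
    linarith
  have hX : 0 < exp (L^2) := exp_pos _
  have hX1 : 1 ≤ exp (L^2) := one_le_exp (by positivity)
  have hpow : ∀ σ, σ0 ≤ σ → σ ≤ σ1 → x^(σ+1) ≤ 8*exp (L^2)^2*exp (L^2*(σ-1)) := by
    intro σ a1 a2
    have b1 : x^(σ+1) ≤ (2*exp (L^2))^(σ+1) := rpow_le_rpow hx.le hx2 (by linarith)
    rw [mul_rpow (by norm_num) hX.le] at b1
    have b2 : (2:ℝ)^(σ+1) ≤ 8 := by
      calc (2:ℝ)^(σ+1) ≤ 2^(3:ℝ) := rpow_le_rpow_of_exponent_le (by norm_num) (by linarith)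
        _ = 8 := by norm_num
    have b3 : exp (L^2)^(σ+1) = exp (L^2)^2*exp (L^2*(σ-1)) := by
      rw [← exp_mul, ← exp_nat_mul, ← exp_add]; congr 1; push_cast; ring
    rw [b3] at b1
    calc _ ≤ _ := b1
      _ ≤ 8*(exp (L^2)^2*exp (L^2*(σ-1))) := by gcongr
      _ = _ := by ring
  have hR0 : x^(σ0+1) ≤ 8*exp (L^2)^2*exp (-(c*L)) := by
    refine (hpow σ0 le_rfl (by linarith)).trans (le_of_eq ?_)
    congr 2; rw [hσ0]; field_simp; ring
  have hR1 : ∀ σ, σ0 ≤ σ → σ ≤ σ1 → x^(σ+1) ≤ 8*exp (L^2)^2*exp (c/4*L) := by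
    intro σ a1 a2
    refine (hpow σ a1 a2).trans ?_
    have : L^2*(σ-1) ≤ c/4*L := by
      calc L^2*(σ-1) ≤ L^2*(2*(c/(8*L))) := by gcongr; linarith
        _ = _ := by field_simp; norm_num
    gcongr
  have hline : ∀ t : ℝ, 1 < ((σ1:ℂ)+t*Complex.I).re := by
    intro t; simp; linarith
  have hper := sw_perron (a := swa χ) (σ := σ1) (by linarith) (swa_sum χ (by simp; linarith)) hx
  simp only [fun t : ℝ => swH_eq χ (hline t)] at hper
  have hL2 : 1 ≤ L^2 := by nlinarith
  have hcon := sw_contour (H := swH χ) (σ0 := σ0) (σ1 := σ1) (T := T) (x := x) (D := D) (by linarith) (by linarith) (by linarith) (by linarith)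
    hT1 hx hDp.le hR0 hR1 ?_ ?_ ?_
  · rw [← hper, norm_mul] at hcon
    have hpi : (1:ℝ) ≤ ‖(2*π:ℂ)‖ := by
      rw [norm_mul, Complex.norm_real, Real.norm_of_nonneg pi_pos.le]
      have := pi_gt_three
      simp; linarith
    set S := ‖∑ n ∈ Finset.Icc 1 ⌊x⌋₊, swa χ n * ((x:ℂ) - n)‖ with hS
    have hS1 : S ≤ ‖(2*π:ℂ)‖ * S := by
      have : 0 ≤ S := norm_nonneg _
      nlinarith
    refine (hS1.trans hcon).trans ?_
    set E := exp (L^2)^2 with hE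
    have e1 : exp (c/4*L) * (1/T) = exp (-(c/4)*L) := by
      rw [hT, one_div, ← exp_neg, ← exp_add]; congr 1; ring
    have e2 : T * exp (-(c*L)) ≤ exp (-(c/4)*L) := by
      rw [hT, ← exp_add]; apply exp_le_exp.2; nlinarith
    have e3 : L^2 * exp (-(c/4)*L) ≤ 128/c^2 * exp (-(c/8)*L) := by
      have f1 : exp (-(c/4)*L) = exp (-(c/8)*L) * (exp (c/8*L))⁻¹ := by
        rw [← exp_neg, ← exp_add]; congr 1; ring
      have f2 := Real.quadratic_le_exp_of_nonneg (x := c/8*L) (by positivity)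
      have f3 : L^2 ≤ 128/c^2 * exp (c/8*L) := by
        have : L^2 = 128/c^2 * ((c/8*L)^2/2) := by field_simp; norm_num
        rw [this]; gcongr
        have : 0 ≤ c/8*L := by positivity
        linarith
      rw [f1]
      calc L^2 * (exp (-(c/8)*L) * (exp (c/8*L))⁻¹) ≤ (128/c^2 * exp (c/8*L)) * (exp (-(c/8)*L) * (exp (c/8*L))⁻¹) := by gcongr
        _ = _ := by
          have := (exp_pos (c/8*L)).ne'
          field_simp
    calc D*(8*E*exp (c/4*L))*(6/T) + 8*T*(D*(8*E*exp (-(c*L))))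
        = 48*D*E*(exp (c/4*L) * (1/T)) + 64*D*E*(T*exp (-(c*L))) := by ring
      _ ≤ 48*D*E*exp (-(c/4)*L) + 64*D*E*exp (-(c/4)*L) := by rw [e1]; gcongr
      _ = 112*D0*E*(L^2*exp (-(c/4)*L)) := by rw [hD]; ring
      _ ≤ 112*D0*E*(128/c^2 * exp (-(c/8)*L)) := by gcongr
      _ ≤ _ := le_of_eq (by ring)
  · intro s a1 a2 a3
    obtain ⟨g1, g2⟩ := h q χ L hL hq1 hq2 s a1 (by linarith) (a3.trans hTL)
    refine ⟨swH_diff χ g1, (swH_bd χ hL2 hC (by linarith) g2).trans ?_⟩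
    rw [hD, hD0]
    have : 0 ≤ 6*64/c^2 := by positivity
    have hn := norm_nonneg s
    refine mul_le_mul_of_nonneg_right (mul_le_mul_of_nonneg_right ?_ (by positivity)) (by positivity)
    linarith
  · exact swH_cont χ (by linarith)
  · intro t
    rw [← swH_eq χ (hline t)]
    refine (sw_right χ (δ := c/(8*L)) (by positivity) (by linarith) (by rw [Complex.add_re, Complex.ofReal_re, Complex.re_ofReal_mul, Complex.I_re, mul_zero, add_zero])).trans ?_
    rw [hD, hD0]
    have : 6/(c/(8*L))^2 = 6*64/c^2*L^2 := by field_simp; norm_num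
    rw [this]; gcongr; linarith

lemma sw_A {B : ℝ} (hB : 0 < B) : ∃ c C : ℝ, 0 < c ∧ c ≤ 1/4 ∧ 0 < C ∧ ∀ (q : ℕ) [NeZero q] (χ : DirichletCharacter ℂ q)
    (L : ℝ), 1 ≤ L → (q:ℝ) ≤ exp L → (q:ℝ) ≤ L^(2*B) → ∀ M : ℕ, (M:ℝ) ≤ exp (L^2) →
    ‖∑ n ∈ Finset.Icc 1 M, swa χ n‖ ≤ C * exp (L^2) * exp (-c*L) := by
  obtain ⟨c, C, hc, hc', hC, h⟩ := sw_A1 hB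
  refine ⟨c/4, 2*C+96/c^2, by positivity, by linarith, by positivity, ?_⟩
  intro q _ χ L hL hq1 hq2 M hM
  have hL0 : 0 < L := by linarith
  rcases Nat.eq_zero_or_pos M with rfl | hM0
  · simp; positivity
  have hM1 : (1:ℝ) ≤ M := by exact_mod_cast hM0
  set E := exp (L^2) with hE
  have hEp : 0 < E := exp_pos _
  set u := exp (-(c/2)*L) with hu
  have hup : 0 < u := exp_pos _
  have hu1 : u ≤ 1 := by rw [hu]; apply exp_le_one_iff.2; nlinarith
  set hh := E*u with hhh
  have hhp : 0 < hh := by positivity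
  have hhE : hh ≤ E := by rw [hhh]; nlinarith
  set x : ℝ := M + hh with hx
  have hxp : 0 < x := by positivity
  have hx2 : x ≤ 2*E := by linarith
  have hfl : M ≤ ⌊x⌋₊ := Nat.le_floor (by linarith)
  have hfl2 : (⌊x⌋₊:ℝ) ≤ x := Nat.floor_le hxp.le
  have k1 := h q χ L hL hq1 hq2 x hxp hx2
  have k2 := h q χ L hL hq1 hq2 M (by linarith) (by linarith)
  rw [Nat.floor_natCast] at k2
  have hsplit : (∑ n ∈ Finset.Icc 1 ⌊x⌋₊, swa χ n * ((x:ℂ) - n)) =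
      (∑ n ∈ Finset.Icc 1 M, swa χ n * (((M:ℝ):ℂ) - n)) + (∑ n ∈ Finset.Icc 1 M, swa χ n) * hh
       + ∑ n ∈ Finset.Ioc M ⌊x⌋₊, swa χ n * ((x:ℂ) - n) := by
    have e : Finset.Icc 1 ⌊x⌋₊ = Finset.Icc 1 M ∪ Finset.Ioc M ⌊x⌋₊ := by
      ext n; simp only [Finset.mem_union, Finset.mem_Icc, Finset.mem_Ioc]; omega
    rw [e, Finset.sum_union, Finset.sum_mul, ← Finset.sum_add_distrib]
    · congr 1
      apply Finset.sum_congr rfl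
      intro n _
      rw [hx]; push_cast; ring
    · rw [Finset.disjoint_left]; intro n; simp only [Finset.mem_Icc, Finset.mem_Ioc]; omega
  have k3 : ‖∑ n ∈ Finset.Ioc M ⌊x⌋₊, swa χ n * ((x:ℂ) - n)‖ ≤ hh * ((L^2+2)*hh) := by
    calc _ ≤ ∑ n ∈ Finset.Ioc M ⌊x⌋₊, (L^2+2)*hh := by
          apply norm_sum_le_of_le
          intro n hn
          rw [Finset.mem_Ioc] at hn
          have hn0 : n ≠ 0 := by omega
          have hn1 : (n:ℝ) ≤ x := le_trans (by exact_mod_cast hn.2) hfl2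
          have hn2 : (M:ℝ) < n := by exact_mod_cast hn.1
          rw [norm_mul]
          have e1 := swa_norm χ hn0
          have e2 : log n ≤ L^2 + 1 := by
            calc log n ≤ log (2*E) := log_le_log (by linarith) (by linarith)
              _ = log 2 + L^2 := by rw [log_mul (by norm_num) hEp.ne', hE, log_exp]
              _ ≤ _ := by have := log_two_lt_d9; linarith
          have e3 : ‖(x:ℂ) - n‖ ≤ hh := by
            have : (x:ℂ) - n = ((x - n : ℝ):ℂ) := by push_cast; rfl
            rw [this, Complex.norm_real, Real.norm_of_nonneg (by linarith)]
            linarith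
          exact mul_le_mul (by linarith) e3 (norm_nonneg _) (by positivity)
      _ = ((⌊x⌋₊ - M : ℕ):ℝ) * ((L^2+2)*hh) := by simp
      _ ≤ _ := by
        rw [Nat.cast_sub hfl]
        gcongr
        linarith
  set A := ∑ n ∈ Finset.Icc 1 M, swa χ n with hA
  have k4 : ‖A‖ * hh ≤ 2*(C*E^2*exp (-c*L)) + hh * ((L^2+2)*hh) := by
    have e1 : A * hh = (∑ n ∈ Finset.Icc 1 ⌊x⌋₊, swa χ n * ((x:ℂ) - n))
      - (∑ n ∈ Finset.Icc 1 M, swa χ n * (((M:ℝ):ℂ) - n)) - ∑ n ∈ Finset.Ioc M ⌊x⌋₊, swa χ n * ((x:ℂ) - n) := by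
      rw [hsplit]; ring
    have e2 : ‖A‖ * hh = ‖A*hh‖ := by rw [norm_mul, Complex.norm_real, Real.norm_of_nonneg hhp.le]
    rw [e2, e1]
    refine (norm_sub_le _ _).trans (add_le_add ((norm_sub_le _ _).trans ?_) k3)
    linarith
  have k5 : 2*(C*E^2*exp (-c*L)) = 2*C*E*u*hh := by
    have : exp (-c*L) = u*u := by rw [hu, ← exp_add]; congr 1; ring
    rw [this, hhh]; ring
  rw [k5] at k4
  have k6 : ‖A‖ ≤ 2*C*E*u + (L^2+2)*hh := by
    refine le_of_mul_le_mul_right (k4.trans (le_of_eq ?_)) hhp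
    ring
  refine k6.trans ?_
  set v := exp (-(c/4)*L) with hv
  have hvp : 0 < v := exp_pos _
  have huv : u = v*v := by rw [hu, hv, ← exp_add]; congr 1; ring
  have hv1 : v ≤ 1 := by rw [hv]; apply exp_le_one_iff.2; nlinarith
  have hLv : (L^2+2)*v ≤ 96/c^2 := by
    have f2 := Real.quadratic_le_exp_of_nonneg (x := c/4*L) (by positivity)
    have f3 : v * exp (c/4*L) = 1 := by rw [hv, ← exp_add]; ring_nf; exact exp_zero
    have f4 : L^2+2 ≤ 96/c^2 * exp (c/4*L) := by
      calc L^2+2 ≤ 3*L^2 := by nlinarith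
        _ = 96/c^2 * ((c/4*L)^2/2) := by field_simp; norm_num
        _ ≤ _ := by
          gcongr
          have : 0 ≤ c/4*L := by positivity
          linarith
    calc (L^2+2)*v ≤ (96/c^2 * exp (c/4*L))*v := by gcongr
      _ = 96/c^2 * (v * exp (c/4*L)) := by ring
      _ = _ := by rw [f3, mul_one]
  calc 2*C*E*u + (L^2+2)*hh = 2*C*E*(v*v) + ((L^2+2)*v)*(E*v) := by rw [hhh, huv]; ring
    _ ≤ 2*C*E*(v*1) + (96/c^2)*(E*v) := by gcongr
    _ = _ := by ring

lemma sw_poly {k c L : ℝ} (hk : 0 < k) (hc : 0 < c) (hL : 0 ≤ L) : L^k ≤ (k/c)^k * exp (c*L) := by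
  have h1 : c*L/k ≤ exp (c*L/k) := by have := add_one_le_exp (c*L/k); linarith
  have h2 : (c*L/k)^k ≤ exp (c*L/k)^k := rpow_le_rpow (by positivity) h1 hk.le
  rw [← exp_mul, div_mul_cancel₀ _ hk.ne'] at h2
  have h3 : L^k = (k/c)^k * (c*L/k)^k := by
    rw [← mul_rpow (by positivity) (by positivity)]; congr 1; field_simp
  rw [h3]; gcongr

lemma sw_abel (b : ℕ → ℂ) {z : ℂ} (hz : ‖z‖ = 1) {R : ℝ} {N : ℕ}
    (hS : ∀ M ≤ N, ‖∑ n ∈ Finset.Icc 1 M, b n‖ ≤ R) :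
    ‖∑ n ∈ Finset.Icc 1 N, b n * z^n‖ ≤ R + N * (R * ‖1 - z‖) := by
  have key : ∀ N : ℕ, ∑ n ∈ Finset.Icc 1 N, b n * z^n = (∑ n ∈ Finset.Icc 1 N, b n) * z^N
      + ∑ m ∈ Finset.range N, (∑ n ∈ Finset.Icc 1 m, b n) * z^m * (1 - z) := by
    intro N
    induction N with
    | zero => simp
    | succ k ih =>
      rw [Finset.sum_Icc_succ_top (by omega), ih, Finset.sum_range_succ, Finset.sum_Icc_succ_top (by omega)]
      ring
  rw [key]
  refine (norm_add_le _ _).trans (add_le_add ?_ ?_)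
  · rw [norm_mul, norm_pow, hz, one_pow, mul_one]; exact hS N le_rfl
  · calc _ ≤ ∑ m ∈ Finset.range N, R * ‖1 - z‖ := by
          apply norm_sum_le_of_le
          intro m hm
          rw [norm_mul, norm_mul, norm_pow, hz, one_pow, mul_one]
          have := hS m (Finset.mem_range.1 hm).le
          gcongr
      _ = _ := by simp

lemma sw_prim (n : ℕ) (hn : 0 < n) : ∑ z ∈ primitiveRoots n ℂ, z = (ArithmeticFunction.moebius n : ℂ) := by
  have h : ∀ n > 0, ∑ i ∈ n.divisors, (∑ z ∈ primitiveRoots i ℂ, z) = if n = 1 then (1:ℂ) else 0 := by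
    intro n hn
    haveI : NeZero n := ⟨hn.ne'⟩
    have hp := Complex.isPrimitiveRoot_exp n hn.ne'
    rw [← Finset.sum_biUnion, ← IsPrimitiveRoot.nthRoots_one_eq_biUnion_primitiveRoots]
    · rcases eq_or_ne n 1 with rfl | h1
      · have : Polynomial.nthRootsFinset 1 (1:ℂ) = {1} := by
          ext z; rw [Polynomial.mem_nthRootsFinset one_pos]; simp
        rw [this]; simp
      · rw [if_neg h1, ← hp.geom_sum_eq_zero (by omega)]
        symm
        apply Finset.sum_bij (fun i _ => Complex.exp (2*π*Complex.I/n)^i)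
        · intro i _
          rw [Polynomial.mem_nthRootsFinset hn, ← pow_mul, mul_comm i n, pow_mul, hp.pow_eq_one, one_pow]
        · intro i hi j hj hij
          exact hp.pow_inj (Finset.mem_range.1 hi) (Finset.mem_range.1 hj) hij
        · intro z hz
          rw [Polynomial.mem_nthRootsFinset hn] at hz
          obtain ⟨i, hi, e⟩ := hp.eq_pow_of_pow_eq_one hz
          exact ⟨i, Finset.mem_range.2 hi, e⟩
        · intro i _; rfl
    · intro i _ j _ hij
      exact IsPrimitiveRoot.disjoint hij
  have h2 := ArithmeticFunction.sum_eq_iff_sum_mul_moebius_eq.1 h n hn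
  rw [← h2]
  rw [Nat.sum_divisorsAntidiagonal (f := fun a b => (ArithmeticFunction.moebius a : ℂ) * if b = 1 then (1:ℂ) else 0)]
  rw [Finset.sum_eq_single n]
  · simp [Nat.div_self hn]
  · intro d hd hdn
    have : n / d ≠ 1 := by
      intro h3
      exact hdn (Nat.eq_of_dvd_of_div_eq_one (Nat.dvd_of_mem_divisors hd) h3)
    simp [this]
  · intro h3; exact absurd (Nat.mem_divisors_self n hn.ne') h3

lemma sw_primZ {q : ℕ} [NeZero q] {ζ : ℂ} (h : IsPrimitiveRoot ζ q) :
    ∑ b ∈ Finset.univ.filter (fun b : ZMod q => IsUnit b), ζ^b.val = (ArithmeticFunction.moebius q : ℂ) := by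
  rw [← sw_prim q (NeZero.pos q)]
  apply Finset.sum_bij (fun (b : ZMod q) _ => ζ^b.val)
  · intro b hb
    rw [mem_primitiveRoots (NeZero.pos q)]
    apply h.pow_of_coprime
    rw [Finset.mem_filter] at hb
    rw [← ZMod.isUnit_iff_coprime, ZMod.natCast_zmod_val]; exact hb.2
  · intro a _ b _ hab
    exact ZMod.val_injective q (h.pow_inj (ZMod.val_lt a) (ZMod.val_lt b) hab)
  · intro z hz
    rw [mem_primitiveRoots (NeZero.pos q), h.isPrimitiveRoot_iff] at hz
    obtain ⟨i, hi, hc, e⟩ := hz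
    refine ⟨(i : ZMod q), ?_, ?_⟩
    · rw [Finset.mem_filter]; exact ⟨Finset.mem_univ _, (ZMod.isUnit_iff_coprime i q).2 hc⟩
    · rw [ZMod.val_natCast, Nat.mod_eq_of_lt hi, e]
  · intro b _; rfl

lemma sw_noncop {q N : ℕ} (hq : 1 ≤ q) (hN : N ≠ 0) {S : Finset ℕ} (hS : ∀ n ∈ S, 1 ≤ n ∧ n ≤ N ∧ ¬ n.Coprime q) :
    ∑ n ∈ S, ArithmeticFunction.vonMangoldt n ≤ Nat.log 2 N * log q := by
  have h := ArithmeticFunction.vonMangoldt_sum (n := q ^ Nat.log 2 N)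
  push_cast at h
  rw [log_pow] at h
  rw [← h, ← Finset.sum_filter_ne_zero]
  apply Finset.sum_le_sum_of_subset_of_nonneg
  · intro n hn
    rw [Finset.mem_filter] at hn
    obtain ⟨h1, h2, h3⟩ := hS n hn.1
    rw [Nat.mem_divisors]
    refine ⟨?_, by positivity⟩
    have h4 := ArithmeticFunction.vonMangoldt_ne_zero_iff.1 hn.2
    rw [isPrimePow_nat_iff] at h4
    obtain ⟨p, k, hp, hk, rfl⟩ := h4
    have h5 : p ∣ q := by
      by_contra h6
      exact h3 (Nat.Coprime.pow_left k ((Nat.Prime.coprime_iff_not_dvd hp).2 h6))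
    have h7 : k ≤ Nat.log 2 N := by
      apply Nat.le_log_of_pow_le (by norm_num)
      exact (Nat.pow_le_pow_left hp.two_le k).trans h2
    exact (pow_dvd_pow_of_dvd h5 k).trans (pow_dvd_pow q h7)
  · intro i _ _; exact ArithmeticFunction.vonMangoldt_nonneg

noncomputable def swt {q : ℕ} [NeZero q] (ζ : ℂ) (χ : DirichletCharacter ℂ q) : ℂ :=
  ∑ b ∈ Finset.univ.filter (fun b : ZMod q => IsUnit b), ζ^b.val * χ b⁻¹

lemma swt_one {q : ℕ} [NeZero q] {ζ : ℂ} (h : IsPrimitiveRoot ζ q) :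
    swt ζ (1 : DirichletCharacter ℂ q) = (ArithmeticFunction.moebius q : ℂ) := by
  rw [← sw_primZ h]
  unfold swt
  apply Finset.sum_congr rfl
  intro b hb
  rw [Finset.mem_filter] at hb
  have : IsUnit b⁻¹ := isUnit_iff_exists_inv.2 ⟨b, ZMod.inv_mul_of_unit b hb.2⟩
  rw [MulChar.one_apply this, mul_one]

lemma swt_norm {q : ℕ} [NeZero q] {ζ : ℂ} (h : ‖ζ‖ = 1) (χ : DirichletCharacter ℂ q) : ‖swt ζ χ‖ ≤ q := by
  unfold swt
  calc _ ≤ ∑ b ∈ Finset.univ.filter (fun b : ZMod q => IsUnit b), (1:ℝ) := by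
        apply norm_sum_le_of_le
        intro b _
        rw [norm_mul, norm_pow, h, one_pow, one_mul]
        exact χ.norm_le_one _
    _ ≤ ∑ b : ZMod q, (1:ℝ) := Finset.sum_le_sum_of_subset_of_nonneg (Finset.filter_subset _ _) (by intros; norm_num)
    _ = q := by simp [ZMod.card]

lemma swt_exp {q : ℕ} [NeZero q] {ζ : ℂ} (h : IsPrimitiveRoot ζ q) {n : ℕ} (hn : n.Coprime q) :
    ∑ χ : DirichletCharacter ℂ q, swt ζ χ * swc χ n = q.totient * ζ^n := by
  have hu : IsUnit (n : ZMod q) := (ZMod.isUnit_iff_coprime n q).2 hn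
  have h1 : ∀ χ : DirichletCharacter ℂ q, swc χ n = χ (n : ZMod q) := by
    intro χ
    unfold swc
    split_ifs with hχ
    · rw [hχ, MulChar.one_apply hu]
    · rfl
  simp only [h1]
  unfold swt
  simp only [Finset.sum_mul]
  rw [Finset.sum_comm]
  have h2 : ∀ b ∈ Finset.univ.filter (fun b : ZMod q => IsUnit b), ∑ χ : DirichletCharacter ℂ q, ζ^b.val * χ b⁻¹ * χ (n : ZMod q)
      = if b = n then ζ^b.val * q.totient else 0 := by
    intro b hb
    rw [Finset.mem_filter] at hb
    simp only [mul_assoc]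
    rw [← Finset.mul_sum, DirichletCharacter.sum_char_inv_mul_char_eq ℂ hb.2]
    simp
  rw [Finset.sum_congr rfl h2, Finset.sum_ite_eq', if_pos (by simp [hu]), ZMod.val_natCast, mul_comm]
  congr 1
  exact (pow_eq_pow_mod n h.pow_eq_one).symm

lemma sw_card (q : ℕ) [NeZero q] : (Fintype.card (DirichletCharacter ℂ q) : ℝ) = q.totient := by
  rw [← DirichletCharacter.card_eq_totient_of_hasEnoughRootsOfUnity ℂ q, Nat.card_eq_fintype_card]

lemma sw_psi {q : ℕ} [NeZero q] {ζ : ℂ} (h : IsPrimitiveRoot ζ q) {M N : ℕ} (hN : N ≠ 0) (hMN : M ≤ N) {R : ℝ}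
    (hR : ∀ χ : DirichletCharacter ℂ q, ‖∑ n ∈ Finset.Icc 1 M, swa χ n‖ ≤ R) :
    ‖∑ n ∈ Finset.Icc 1 M, ((ArithmeticFunction.vonMangoldt n : ℂ) * ζ^n -
      (((ArithmeticFunction.moebius q : ℝ) / (q.totient : ℝ) : ℝ) : ℂ))‖ ≤ q*R + (1+q)*(Nat.log 2 N * log q) := by
  have hq : 1 ≤ q := NeZero.pos q
  have hφ : 0 < (q.totient : ℝ) := by exact_mod_cast Nat.totient_pos.2 hq
  have hφc : (q.totient : ℂ) ≠ 0 := by exact_mod_cast hφ.ne'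
  have hζ : ‖ζ‖ = 1 := h.norm'_eq_one (NeZero.ne q)
  have hsumt : ∀ f : DirichletCharacter ℂ q → ℂ, ∀ r : ℝ, (∀ χ, ‖f χ‖ ≤ r) →
      ‖(q.totient:ℂ)⁻¹ * ∑ χ : DirichletCharacter ℂ q, swt ζ χ * f χ‖ ≤ q*r := by
    intro f r hf
    rw [norm_mul, norm_inv, Complex.norm_natCast, inv_mul_le_iff₀ hφ]
    calc _ ≤ ∑ χ : DirichletCharacter ℂ q, (q:ℝ)*r := by
          apply norm_sum_le_of_le
          intro χ _
          rw [norm_mul]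
          exact mul_le_mul (swt_norm hζ χ) (hf χ) (norm_nonneg _) (by positivity)
      _ = _ := by rw [Finset.sum_const, Finset.card_univ, nsmul_eq_mul, sw_card]
  have hk : ∑ χ : DirichletCharacter ℂ q, swt ζ χ * swk χ = (ArithmeticFunction.moebius q : ℂ) := by
    classical
    rw [Finset.sum_eq_single 1]
    · rw [swt_one h]; simp [swk]
    · intro χ _ hχ; simp [swk, hχ]
    · simp
  set r : ℕ → ℂ := fun n => ζ^n - (q.totient:ℂ)⁻¹ * ∑ χ : DirichletCharacter ℂ q, swt ζ χ * swc χ n with hr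
  have hpt : ∀ n : ℕ, (ArithmeticFunction.vonMangoldt n : ℂ) * ζ^n -
      (((ArithmeticFunction.moebius q : ℝ) / (q.totient : ℝ) : ℝ) : ℂ) =
      (q.totient:ℂ)⁻¹ * (∑ χ : DirichletCharacter ℂ q, swt ζ χ * swa χ n) + (ArithmeticFunction.vonMangoldt n : ℂ) * r n := by
    intro n
    have e1 : ∑ χ : DirichletCharacter ℂ q, swt ζ χ * swa χ n = (∑ χ : DirichletCharacter ℂ q, swt ζ χ * swc χ n) * (ArithmeticFunction.vonMangoldt n : ℂ) - (ArithmeticFunction.moebius q : ℂ) := by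
      rw [← hk, Finset.sum_mul, ← Finset.sum_sub_distrib]
      apply Finset.sum_congr rfl
      intro χ _
      unfold swa; ring
    rw [e1, hr]
    push_cast
    ring
  simp only [hpt]
  rw [Finset.sum_add_distrib, ← Finset.mul_sum, Finset.sum_comm]
  simp only [← Finset.mul_sum]
  refine (norm_add_le _ _).trans (add_le_add (hsumt _ R hR) ?_)
  have hr0 : ∀ n : ℕ, n.Coprime q → r n = 0 := by
    intro n hn
    rw [hr]; dsimp only
    rw [swt_exp h hn, inv_mul_cancel_left₀ hφc, sub_self]
  have hr1 : ∀ n : ℕ, ‖r n‖ ≤ 1 + q := by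
    intro n
    refine (norm_sub_le _ _).trans (add_le_add ?_ ?_)
    · rw [norm_pow, hζ, one_pow]
    · have := hsumt (fun χ => swc χ n) 1 (fun χ => swc_norm χ n)
      rwa [mul_one] at this
  rw [← Finset.sum_filter_of_ne (p := fun n => ¬ n.Coprime q)]
  · calc _ ≤ ∑ n ∈ Finset.filter (fun n => ¬ n.Coprime q) (Finset.Icc 1 M), (1+q) * ArithmeticFunction.vonMangoldt n := by
          apply norm_sum_le_of_le
          intro n _
          rw [norm_mul, Complex.norm_real, Real.norm_of_nonneg ArithmeticFunction.vonMangoldt_nonneg, mul_comm]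
          exact mul_le_mul_of_nonneg_right (hr1 n) ArithmeticFunction.vonMangoldt_nonneg
      _ ≤ _ := by
        rw [← Finset.mul_sum]
        apply mul_le_mul_of_nonneg_left _ (by positivity)
        apply sw_noncop hq hN
        intro n hn
        rw [Finset.mem_filter, Finset.mem_Icc] at hn
        exact ⟨hn.1.1, hn.1.2.trans hMN, hn.2⟩
  · intro n _ hne hc
    exact hne (by rw [hr0 n hc, mul_zero])

lemma sw_LamHat (N : ℕ) (α : ℝ) : LamHat N α =
    ∑ n ∈ Finset.Icc 1 N, (ArithmeticFunction.vonMangoldt n : ℂ) * Complex.exp (-2 * Real.pi * Complex.I * n * α) := by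
  unfold LamHat
  rw [tsum_eq_sum (s := (Finset.Icc 1 N).map Nat.castEmbedding), Finset.sum_map]
  · apply Finset.sum_congr rfl
    intro n hn
    rw [Finset.mem_Icc] at hn
    have : LamN N (n:ℤ) = ArithmeticFunction.vonMangoldt n := by
      unfold LamN
      rw [if_pos ⟨by exact_mod_cast hn.1, by exact_mod_cast hn.2⟩, Int.toNat_natCast]
    simp [this]
  · intro n hn
    have : LamN N n = 0 := by
      unfold LamN
      rw [if_neg]
      intro h
      apply hn
      rw [Finset.mem_map]
      refine ⟨n.toNat, Finset.mem_Icc.2 ⟨by omega, by omega⟩, ?_⟩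
      simp only [Nat.castEmbedding_apply]
      omega
    rw [this]; simp

lemma sw_zn (β : ℝ) (n : ℕ) : Complex.exp (-2 * Real.pi * Complex.I * n * β) = Complex.exp (-2 * Real.pi * Complex.I * β)^n := by
  rw [← Complex.exp_nat_mul]; congr 1; ring

lemma sw_z1 (β : ℝ) : ‖Complex.exp (-2 * Real.pi * Complex.I * β)‖ = 1 := by
  have : (-2 * Real.pi * Complex.I * β : ℂ) = ((-2*π*β : ℝ):ℂ) * Complex.I := by push_cast; ring
  rw [this, Complex.norm_exp_ofReal_mul_I]

lemma sw_z2 (β : ℝ) : ‖1 - Complex.exp (-2 * Real.pi * Complex.I * β)‖ ≤ 2*π*|β| := by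
  have : (-2 * Real.pi * Complex.I * β : ℂ) = Complex.I * ((-2*π*β : ℝ):ℂ) := by push_cast; ring
  rw [this, norm_sub_rev]
  refine (Real.norm_exp_I_mul_ofReal_sub_one_le).trans (le_of_eq ?_)
  rw [Real.norm_eq_abs, abs_mul, abs_mul, abs_of_pos pi_pos]; norm_num

lemma sw_zeta {a : ℤ} {q : ℕ} (hq : q ≠ 0) (h : Int.gcd a q = 1) :
    IsPrimitiveRoot (Complex.exp (-2 * Real.pi * Complex.I * ((a/q : ℝ):ℂ))) q := by
  have h1 := Complex.isPrimitiveRoot_exp_of_isCoprime (-a) q hq (by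
    rw [IsCoprime.neg_left_iff]; exact Int.isCoprime_iff_gcd_eq_one.2 h)
  convert h1 using 2
  push_cast; ring

lemma sw_triv {N : ℕ} (hN : 2 ≤ N) (α β : ℝ) {q : ℕ} (hq : 1 ≤ q) :
    ‖LamHat N α - (((ArithmeticFunction.moebius q : ℝ) / (Nat.totient q : ℝ) : ℝ) : ℂ) * nuN N β‖ ≤ N * (log N + 1) := by
  have h1 : ‖LamHat N α‖ ≤ N * log N := by
    rw [sw_LamHat]
    calc _ ≤ ∑ n ∈ Finset.Icc 1 N, log N := by
          apply norm_sum_le_of_le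
          intro n hn
          rw [Finset.mem_Icc] at hn
          rw [norm_mul, sw_zn, norm_pow, sw_z1, one_pow, mul_one, Complex.norm_real, Real.norm_of_nonneg ArithmeticFunction.vonMangoldt_nonneg]
          exact ArithmeticFunction.vonMangoldt_le_log.trans (log_le_log (by exact_mod_cast hn.1) (by exact_mod_cast hn.2))
      _ = _ := by simp
  have h2 : ‖nuN N β‖ ≤ N := by
    unfold nuN
    calc _ ≤ ∑ n ∈ Finset.Icc 1 N, (1:ℝ) := by
          apply norm_sum_le_of_le
          intro n hn
          rw [sw_zn, norm_pow, sw_z1, one_pow]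
      _ = _ := by simp
  have h3 : ‖(((ArithmeticFunction.moebius q : ℝ) / (Nat.totient q : ℝ) : ℝ) : ℂ)‖ ≤ 1 := by
    have hφ : (1:ℝ) ≤ q.totient := by exact_mod_cast Nat.totient_pos.2 hq
    rw [Complex.norm_real, norm_div, Real.norm_eq_abs, Real.norm_of_nonneg (by linarith)]
    apply div_le_one_of_le₀ _ (by linarith)
    refine le_trans ?_ hφ
    exact_mod_cast ArithmeticFunction.abs_moebius_le_one
  refine (norm_sub_le _ _).trans ?_
  rw [norm_mul]
  have := mul_le_mul h3 h2 (norm_nonneg _) zero_le_one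
  linarith

theorem stmt9 (B : ℝ) (hB : 0 < B) :
    ∃ c : ℝ, 0 < c ∧ ∃ C : ℝ, ∀ N : ℕ, 2 ≤ N → ∀ a : ℤ, ∀ q : ℕ, ∀ β : ℝ,
      1 ≤ q → (q : ℝ) ≤ Real.log N ^ B → Int.gcd a q = 1 →
      |β| < Real.log N ^ B / N →
      ‖LamHat N ((a : ℝ) / q + β) -
          (((ArithmeticFunction.moebius q : ℝ) / (Nat.totient q : ℝ) : ℝ) : ℂ) * nuN N β‖
        ≤ C * N * Real.exp (-c * Real.sqrt (Real.log N)) := by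
  obtain ⟨c, C, hc, hc4, hC, hA⟩ := sw_A hB
  set K := (2*B/(1/2))^(2*B) with hK
  have hKp : 0 < K := by positivity
  set L1 := max 1 (2*log K) with hL1
  set K2 := ((4*B+3)/(c/2))^(4*B+3) with hK2
  have hK2p : 0 < K2 := by positivity
  refine ⟨c/2, by positivity, max (8*(C+4)*K2) ((L1^2+1)*exp (c/2*L1)), ?_⟩
  intro N hN a q β hq hqB hgcd hβ
  haveI : NeZero q := ⟨by omega⟩
  have hN2 : (2:ℝ) ≤ N := by exact_mod_cast hN
  have hlog : 0 < log N := log_pos (by linarith)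
  set L := √(log N) with hL
  have hL0 : 0 < L := sqrt_pos.2 hlog
  have hLsq : L^2 = log N := sq_sqrt hlog.le
  have hE : exp (L^2) = N := by rw [hLsq, exp_log (by linarith)]
  have hLB : log N ^ B = L^(2*B) := by
    rw [rpow_mul hL0.le, rpow_two, hLsq]
  rw [hLB] at hqB hβ
  have hN0 : (0:ℝ) < N := by linarith
  rcases lt_or_ge L L1 with hlt | hge
  · refine (sw_triv hN _ β hq).trans ?_
    rw [← hLsq]
    calc (N:ℝ)*(L^2+1) ≤ N * (L1^2+1) := by gcongr
      _ = (L1^2+1)*exp (c/2*L1) * N * exp (-(c/2)*L1) := by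
        have : exp (c/2*L1) * exp (-(c/2)*L1) = 1 := by rw [← exp_add]; ring_nf; exact exp_zero
        linear_combination (-(N*(L1^2+1))) * this
      _ ≤ (L1^2+1)*exp (c/2*L1) * N * exp (-(c/2)*L) := by
        gcongr ?_ * exp ?_
        nlinarith
      _ ≤ _ := by
        gcongr
        exact le_max_right _ _
  have hL1' : 1 ≤ L := (le_max_left _ _).trans hge
  have hLK : 2*log K ≤ L := (le_max_right _ _).trans hge
  have hqe : (q:ℝ) ≤ exp L := by
    refine hqB.trans ((sw_poly (k := 2*B) (c := 1/2) (by positivity) (by norm_num) hL0.le).trans ?_)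
    rw [← hK]
    have : K ≤ exp (1/2*L) := by
      rw [← exp_log hKp]; apply exp_le_exp.2; linarith
    calc K * exp (1/2*L) ≤ exp (1/2*L) * exp (1/2*L) := by gcongr
      _ = _ := by rw [← exp_add]; congr 1; ring
  set R := C * N * exp (-c*L) with hR
  have hζ := sw_zeta (by omega) hgcd
  set ζ := Complex.exp (-2 * Real.pi * Complex.I * ((a/q : ℝ):ℂ)) with hζd
  set P := L^(2*B) with hP
  have hP1 : 1 ≤ P := one_le_rpow hL1' (by positivity)
  have hq1 : (1:ℝ) ≤ q := by exact_mod_cast hq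
  set W := N * exp (-c*L) with hW
  have hWp : 0 < W := by positivity
  have hW1 : 1 ≤ W := by
    rw [hW, ← hE, ← exp_add]; apply one_le_exp; nlinarith
  set b : ℕ → ℂ := fun n => (ArithmeticFunction.vonMangoldt n : ℂ) * ζ^n -
      (((ArithmeticFunction.moebius q : ℝ) / (q.totient : ℝ) : ℝ) : ℂ) with hb
  have hlog2 : (Nat.log 2 N : ℝ) * log q ≤ 2*L^3 := by
    have e1 : (Nat.log 2 N : ℝ) ≤ 2*L^2 := by
      have h1 : (2:ℝ)^(Nat.log 2 N) ≤ N := by exact_mod_cast Nat.pow_log_le_self 2 (by omega)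
      have h2 := log_le_log (by positivity) h1
      rw [log_pow, ← hLsq] at h2
      have := log_two_gt_d9
      have h3 : (0:ℝ) ≤ Nat.log 2 N := by positivity
      nlinarith
    have e2 : log q ≤ L := by rw [log_le_iff_le_exp (by linarith)]; exact hqe
    have e3 : 0 ≤ log (q:ℝ) := log_nonneg hq1
    calc _ ≤ 2*L^2 * L := by gcongr
      _ = _ := by ring
  have hS : ∀ M ≤ N, ‖∑ n ∈ Finset.Icc 1 M, b n‖ ≤ (C+4)*P*L^3*W := by
    intro M hM
    have h1 := sw_psi hζ (M := M) (N := N) (by omega) hM (R := R) (fun χ => by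
      have := hA q χ L hL1' hqe hqB M (by rw [hE]; exact_mod_cast hM)
      rwa [hE] at this)
    refine h1.trans ?_
    have hL3 : 1 ≤ L^3 := one_le_pow₀ hL1'
    have hR' : R = C*W := by rw [hR, hW]; ring
    calc q*R + (1+q)*(Nat.log 2 N * log q) ≤ P*(C*W) + (P+P)*(2*L^3) := by
          rw [hR']; gcongr
      _ ≤ P*(C*W)*L^3 + (P+P)*(2*L^3)*W := by
        apply add_le_add
        · exact le_mul_of_one_le_right (by positivity) hL3
        · exact le_mul_of_one_le_right (by positivity) hW1
      _ = _ := by ring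
  set z := Complex.exp (-2 * Real.pi * Complex.I * β) with hz
  have hfin := sw_abel b (sw_z1 β) hS
  have hexp : LamHat N ((a : ℝ) / q + β) -
          (((ArithmeticFunction.moebius q : ℝ) / (Nat.totient q : ℝ) : ℝ) : ℂ) * nuN N β = ∑ n ∈ Finset.Icc 1 N, b n * z^n := by
    rw [sw_LamHat, nuN, Finset.mul_sum, ← Finset.sum_sub_distrib]
    apply Finset.sum_congr rfl
    intro n _
    have e1 : Complex.exp (-2 * Real.pi * Complex.I * n * (((a:ℝ)/q + β : ℝ):ℂ)) = ζ^n * z^n := by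
      rw [hζd, hz, ← sw_zn, ← sw_zn, ← Complex.exp_add]; congr 1; push_cast; ring
    rw [e1, sw_zn, hb]
    ring
  rw [hexp]
  refine hfin.trans ?_
  have hNz : N * ‖1 - z‖ ≤ 7*P := by
    have h1 := sw_z2 β
    have h2 : N * |β| ≤ P := by
      rw [lt_div_iff₀ hN0] at hβ; linarith
    have hpi := pi_lt_d2
    have h3 : 0 ≤ N*|β| := by positivity
    calc N * ‖1 - z‖ ≤ N * (2*π*|β|) := by gcongr
      _ = (2*π)*(N*|β|) := by ring
      _ ≤ 7 * P := by
        apply mul_le_mul _ h2 h3 (by norm_num)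
        linarith
  set Q := (C+4)*P*L^3*W with hQ
  have hQp : 0 < Q := by positivity
  have hpol : P*P*L^3 ≤ K2 * exp (c/2*L) := by
    have h1 := sw_poly (k := 4*B+3) (c := c/2) (L := L) (by positivity) (by positivity) hL0.le
    have h2 : L^(4*B+3) = P*P*L^3 := by
      rw [hP, ← rpow_add hL0, ← rpow_natCast L 3, ← rpow_add hL0]; congr 1; push_cast; ring
    rwa [h2] at h1
  calc Q + N*(Q*‖1 - z‖) = Q*1 + Q*(N*‖1 - z‖) := by ring
    _ ≤ Q*P + Q*(7*P) := by gcongr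
    _ = 8*(C+4)*W*(P*P*L^3) := by rw [hQ]; ring
    _ ≤ 8*(C+4)*W*(K2 * exp (c/2*L)) := by gcongr
    _ = 8*(C+4)*K2*N*exp (-(c/2)*L) := by
      have : exp (-c*L) * exp (c/2*L) = exp (-(c/2)*L) := by rw [← exp_add]; congr 1; ring
      rw [← this, hW]; ring
    _ ≤ _ := by
      gcongr
      exact le_max_left _ _
end

section
/- Let f(x) = c_k x^k + ⋯ + c_0 ∈ ℤ[x] with c_k > 0 and k ≥ 1, and let B > 0. Then ∫_{|β| < log^B N / N} |∫_0^N e^{−2πi yβ} dy|² (∫_0^M e^{2πi f(x) β} dx) dβ = (k/(k+1)) · M · N + O(M·N/log^B N), where M = (N/c_k)^{1/k} and the implied constant depends on f and B. -/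
open Real Filter Asymptotics MeasureTheory

/-- `M = (N/c_k)^{1/k}` as a real number. -/
noncomputable def Mreal (f : Polynomial ℤ) (k : ℕ) (N : ℕ) : ℝ :=
  ((N : ℝ) / (f.leadingCoeff : ℝ)) ^ ((1 : ℝ) / k)

noncomputable def SJ (N β : ℝ) : ℂ :=
  ∫ y in (0:ℝ)..N, Complex.exp (-2 * Real.pi * Complex.I * y * β)

lemma SJ_continuous (N : ℝ) : Continuous (SJ N) := by
  unfold SJ
  apply intervalIntegral.continuous_parametric_intervalIntegral_of_continuous
  · unfold Function.uncurry
    fun_prop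
  · exact continuous_const

lemma SJ_formula (N β : ℝ) (hβ : β ≠ 0) :
    SJ N β = (Complex.exp ((-2 * Real.pi * Complex.I * β) * N) - 1) /
      (-2 * Real.pi * Complex.I * β) := by
  have hb : (-2 * Real.pi * Complex.I * β : ℂ) ≠ 0 := by
    simp [hβ, Real.pi_ne_zero]
  have := integral_exp_mul_complex (a := 0) (b := N) hb
  rw [Complex.ofReal_zero, mul_zero, Complex.exp_zero] at this
  rw [← this]
  unfold SJ
  congr 1; ext y; congr 1; ring

lemma norm_e (t : ℝ) : ‖Complex.exp (t * Complex.I)‖ = 1 := Complex.norm_exp_ofReal_mul_I t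

lemma SJ_bound (N β : ℝ) : ‖SJ N β‖ ≤ |N| := by
  have := intervalIntegral.norm_integral_le_of_norm_le_const (a := 0) (b := N) (C := 1)
    (f := fun y : ℝ => Complex.exp (-2 * Real.pi * Complex.I * y * β)) (by
      intro x _
      rw [show (-2 * Real.pi * Complex.I * x * β : ℂ) = ((-2 * Real.pi * x * β : ℝ) : ℂ) * Complex.I by
        push_cast; ring, norm_e])
  simpa [SJ] using this

lemma SJ_bound2 (N β : ℝ) : ‖SJ N β‖ * |β| ≤ 1 := by
  by_cases hβ : β = 0
  · simp [hβ]
  rw [SJ_formula N β hβ, norm_div]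
  have h1 : ‖Complex.exp ((-2 * Real.pi * Complex.I * β) * N) - 1‖ ≤ 2 := by
    refine (norm_sub_le _ _).trans ?_
    rw [show (-2 * Real.pi * Complex.I * β * N : ℂ) = ((-2 * Real.pi * β * N : ℝ) : ℂ) * Complex.I by
        push_cast; ring, norm_e]
    norm_num
  have h2 : ‖(-2 * Real.pi * Complex.I * β : ℂ)‖ = 2 * π * |β| := by
    simp [abs_of_pos Real.pi_pos]
  rw [h2]
  have hp : 0 < |β| := abs_pos.mpr hβ
  have := Real.pi_gt_three
  rw [div_mul_eq_mul_div, div_le_one (by positivity)]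
  nlinarith

lemma SJ_sq_bound (N β : ℝ) : ‖SJ N β‖ ^ 2 ≤ (N ^ 2 + 1) * (1 + β ^ 2)⁻¹ := by
  have h1 := SJ_bound N β
  have h2 := SJ_bound2 N β
  rw [← div_eq_mul_inv, le_div_iff₀ (by positivity)]
  have h3 : ‖SJ N β‖ ^ 2 ≤ N ^ 2 := by
    rw [← sq_abs N]; gcongr
  have h4 : (‖SJ N β‖ * |β|) ^ 2 ≤ 1 := pow_le_one₀ (by positivity) h2
  rw [mul_pow, sq_abs] at h4
  linarith

lemma SJ_sq_integrable (N : ℝ) : Integrable (fun β => ‖SJ N β‖ ^ 2) := by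
  refine (integrable_inv_one_add_sq.const_mul (N ^ 2 + 1)).mono'
    ((SJ_continuous N).norm.pow 2).aestronglyMeasurable ?_
  filter_upwards with β
  rw [Real.norm_of_nonneg (by positivity)]
  exact SJ_sq_bound N β

noncomputable def tri (N : ℝ) (t : ℝ) : ℂ := ((max (N - |t|) 0 : ℝ) : ℂ)

lemma tri_continuous (N : ℝ) : Continuous (tri N) := by
  unfold tri; fun_prop

lemma tri_zero (N : ℝ) (hN : 0 < N) (t : ℝ) (ht : t ∉ Set.Ioc (-N) N) : tri N t = 0 := by
  unfold tri
  rw [max_eq_right]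
  · simp
  · by_contra! h
    apply ht
    have : |t| < N := by linarith
    rw [abs_lt] at this
    exact ⟨this.1, this.2.le⟩

lemma tri_integrable (N : ℝ) (hN : 0 < N) : Integrable (tri N) := by
  refine (tri_continuous N).integrable_of_hasCompactSupport ?_
  refine HasCompactSupport.intro (isCompact_Icc (a := -N) (b := N)) ?_
  intro x hx
  exact tri_zero N hN x (fun h => hx ⟨h.1.le, h.2⟩)

lemma tri_fourier (N β : ℝ) (hN : 0 < N) (hβ : β ≠ 0) :
    FourierTransform.fourier (tri N) β = ((‖SJ N β‖ ^ 2 : ℝ) : ℂ) := by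
  set b : ℂ := -2 * Real.pi * Complex.I * β with hbdef
  have hb : b ≠ 0 := by simp [hbdef, hβ, Real.pi_ne_zero]
  rw [Real.fourier_real_eq_integral_exp_smul]
  have e0 : (fun v : ℝ => Complex.exp (↑(-2 * π * v * β) * Complex.I) • tri N v) =
      fun v : ℝ => Complex.exp (b * v) * tri N v := by
    ext v; rw [smul_eq_mul]; congr 2; push_cast; rw [hbdef]; ring
  rw [e0, ← setIntegral_eq_integral_of_forall_compl_eq_zero (s := Set.Ioc (-N) N)
    (fun x hx => by rw [tri_zero N hN x hx, mul_zero]),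
    ← intervalIntegral.integral_of_le (by linarith)]
  have hc : Continuous (fun v : ℝ => Complex.exp (b * v) * tri N v) := by
    have := tri_continuous N
    fun_prop
  rw [← intervalIntegral.integral_add_adjacent_intervals (b := 0) (hc.intervalIntegrable _ _)
    (hc.intervalIntegrable _ _)]
  have hid : ∀ t : ℝ, HasDerivAt (fun t : ℝ => (t : ℂ)) 1 t := fun t => Complex.ofRealCLM.hasDerivAt
  have hexp : ∀ t : ℝ, HasDerivAt (fun t : ℝ => Complex.exp (b * t)) (Complex.exp (b * t) * (b * 1)) t :=
    fun t => ((hid t).const_mul b).cexp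
  have i1 : ∫ v in (-N)..0, Complex.exp (b * v) * tri N v =
      (N / b - 1 / b ^ 2) - (- Complex.exp (b * (-N)) / b ^ 2) := by
    have : ∫ v in (-N)..0, Complex.exp (b * v) * tri N v =
        ∫ v in (-N)..0, Complex.exp (b * v) * (N + v) := by
      apply intervalIntegral.integral_congr
      intro v hv
      rw [Set.uIcc_of_le (by linarith)] at hv
      simp only [tri]
      rw [abs_of_nonpos hv.2, max_eq_left (by linarith [hv.1])]
      push_cast; ring
    rw [this, intervalIntegral.integral_eq_sub_of_hasDerivAt
      (f := fun t : ℝ => Complex.exp (b * t) * (N + t) / b - Complex.exp (b * t) / b ^ 2)]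
    · simp
      ring
    · intro t _
      convert! (((hexp t).mul ((hid t).const_add (N:ℂ))).div_const b).sub ((hexp t).div_const (b^2)) using 1
      field_simp
      ring
    · apply Continuous.intervalIntegrable; fun_prop
  have i2 : ∫ v in (0:ℝ)..N, Complex.exp (b * v) * tri N v =
      Complex.exp (b * N) / b ^ 2 - (N / b + 1 / b ^ 2) := by
    have : ∫ v in (0:ℝ)..N, Complex.exp (b * v) * tri N v =
        ∫ v in (0:ℝ)..N, Complex.exp (b * v) * (N - v) := by
      apply intervalIntegral.integral_congr
      intro v hv
      rw [Set.uIcc_of_le (by linarith)] at hv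
      simp only [tri]
      rw [abs_of_nonneg hv.1, max_eq_left (by linarith [hv.2])]
      push_cast; ring
    rw [this, intervalIntegral.integral_eq_sub_of_hasDerivAt
      (f := fun t : ℝ => Complex.exp (b * t) * (N - t) / b + Complex.exp (b * t) / b ^ 2)]
    · simp
    · intro t _
      convert! (((hexp t).mul ((hid t).const_sub (N:ℂ))).div_const b).add ((hexp t).div_const (b^2)) using 1
      field_simp
      ring
    · apply Continuous.intervalIntegrable; fun_prop
  rw [i1, i2]
  have hconj : (starRingEnd ℂ) b = -b := by
    rw [hbdef]
    simp [Complex.conj_ofNat]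
  have hS : SJ N β = (Complex.exp (b * N) - 1) / b := SJ_formula N β hβ
  push_cast
  rw [← Complex.mul_conj', hS, map_div₀, map_sub, ← Complex.exp_conj, map_mul, hconj, Complex.conj_ofReal, map_one]
  have hm : Complex.exp (b * N) * Complex.exp (-b * N) = 1 := by
    rw [← Complex.exp_add]; simp
  rw [show b * -(N:ℂ) = -b * N by ring]
  generalize Complex.exp (b * N) = X at hm ⊢
  generalize Complex.exp (-b * N) = Y at hm ⊢
  field_simp
  linear_combination hm

lemma tri_inv (N c : ℝ) (hN : 0 < N) :
    ∫ β : ℝ, ((‖SJ N β‖ ^ 2 : ℝ) : ℂ) * Complex.exp (2 * Real.pi * Complex.I * c * β) = tri N c := by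
  have hae : FourierTransform.fourier (tri N) =ᵐ[volume] fun β => ((‖SJ N β‖ ^ 2 : ℝ) : ℂ) := by
    filter_upwards [compl_mem_ae_iff.mpr (measure_singleton (0:ℝ))] with β hβ
    exact tri_fourier N β hN hβ
  have hint : Integrable (FourierTransform.fourier (tri N)) :=
    ((SJ_sq_integrable N).ofReal).congr hae.symm
  have := congrFun ((tri_continuous N).fourierInv_fourier_eq (tri_integrable N hN) hint) c
  rw [← this, Real.fourierInv_eq']
  apply integral_congr_ae
  filter_upwards [hae] with β hβ
  rw [hβ, smul_eq_mul, mul_comm]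
  congr 2
  simp
  ring

lemma tail_bound (N δ : ℝ) (hδ : 0 < δ) :
    ∫ β in (Set.Ioo (-δ) δ)ᶜ, ‖SJ N β‖ ^ 2 ≤ 2 / δ := by
  have hI := SJ_sq_integrable N
  have hp : ∀ β : ℝ, 0 < β → ‖SJ N β‖ ^ 2 ≤ β ^ (-2:ℝ) ∧ ‖SJ N (-β)‖ ^ 2 ≤ β ^ (-2:ℝ) := by
    intro β hβ
    have key : ∀ γ : ℝ, |γ| = β → ‖SJ N γ‖ ^ 2 ≤ β ^ (-2:ℝ) := by
      intro γ hγ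
      rw [Real.rpow_neg hβ.le, ← one_div, le_div_iff₀ (by positivity)]
      have h2 := SJ_bound2 N γ
      rw [hγ] at h2
      have : (‖SJ N γ‖ * β) ^ 2 ≤ 1 := pow_le_one₀ (by positivity) h2
      rw [mul_pow] at this
      exact_mod_cast this
    exact ⟨key β (abs_of_pos hβ), key (-β) (by rw [abs_neg, abs_of_pos hβ])⟩
  have hv : ∫ t in Set.Ioi δ, t ^ (-2:ℝ) = 1 / δ := by
    rw [integral_Ioi_rpow_of_lt (by norm_num) hδ]
    norm_num [Real.rpow_neg_one]
  have hvi := integrableOn_Ioi_rpow_of_lt (a := -2) (by norm_num) hδ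
  have h1 : ∫ β in Set.Ioi δ, ‖SJ N β‖ ^ 2 ≤ 1 / δ := by
    rw [← hv]
    exact setIntegral_mono_on hI.integrableOn hvi measurableSet_Ioi
      (fun x hx => (hp x (hδ.trans hx)).1)
  have h2 : ∫ β in Set.Iic (-δ), ‖SJ N β‖ ^ 2 ≤ 1 / δ := by
    have := integral_comp_neg_Ioi δ (fun β => ‖SJ N β‖ ^ 2)
    rw [← this, ← hv]
    exact setIntegral_mono_on hI.comp_neg.integrableOn hvi measurableSet_Ioi
      (fun x hx => (hp x (hδ.trans hx)).2)
  have hset : (Set.Ioo (-δ) δ)ᶜ = Set.Iic (-δ) ∪ Set.Ici δ := by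
    ext x; simp only [Set.mem_compl_iff, Set.mem_Ioo, Set.mem_union, Set.mem_Iic, Set.mem_Ici]
    constructor
    · intro h; by_contra! h'; exact h ⟨h'.1, h'.2⟩
    · rintro (h | h) h' <;> linarith [h'.1, h'.2]
  rw [hset, setIntegral_union ?_ measurableSet_Ici hI.integrableOn hI.integrableOn,
    integral_Ici_eq_integral_Ioi]
  · calc _ ≤ 1 / δ + 1 / δ := add_le_add h2 h1
      _ = 2 / δ := by ring
  · rw [Set.disjoint_left]; intro x hx hx'
    simp only [Set.mem_Iic, Set.mem_Ici] at hx hx'; linarith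

lemma main_bound (F : ℝ → ℝ) (hF : Continuous F) (N δ M : ℝ) (hN : 0 < N) (hδ : 0 < δ) (hM : 0 ≤ M) :
    ‖(∫ β in Set.Ioo (-δ) δ, ((‖SJ N β‖ ^ 2 : ℝ) : ℂ) *
        ∫ x in (0:ℝ)..M, Complex.exp (2 * Real.pi * Complex.I * (F x : ℝ) * β)) -
      ((∫ x in (0:ℝ)..M, max (N - |F x|) 0 : ℝ) : ℂ)‖ ≤ M * (2 / δ) := by
  have hI := SJ_sq_integrable N
  have hnorm : ∀ x β : ℝ, ‖Complex.exp (2 * Real.pi * Complex.I * (F x : ℝ) * β)‖ = 1 := by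
    intro x β
    rw [show (2 * Real.pi * Complex.I * (F x : ℝ) * β : ℂ) =
      ((2 * Real.pi * F x * β : ℝ) : ℂ) * Complex.I by push_cast; ring, norm_e]
  set G : ℝ → ℂ := fun β => ((‖SJ N β‖ ^ 2 : ℝ) : ℂ) *
        ∫ x in (0:ℝ)..M, Complex.exp (2 * Real.pi * Complex.I * (F x : ℝ) * β) with hG
  have hGc : Continuous G := by
    have h1 := SJ_continuous N
    have h2 : Continuous fun β : ℝ =>
        ∫ x in (0:ℝ)..M, Complex.exp (2 * Real.pi * Complex.I * (F x : ℝ) * β) := by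
      apply intervalIntegral.continuous_parametric_intervalIntegral_of_continuous
      · unfold Function.uncurry
        fun_prop
      · exact continuous_const
    fun_prop
  have hGb : ∀ β, ‖G β‖ ≤ M * ‖SJ N β‖ ^ 2 := by
    intro β
    rw [hG]
    simp only
    rw [norm_mul, Complex.norm_real, Real.norm_of_nonneg (by positivity), mul_comm]
    gcongr
    have := intervalIntegral.norm_integral_le_of_norm_le_const (a := 0) (b := M) (C := 1)
      (fun x _ => (hnorm x β).le)
    simpa [abs_of_nonneg hM] using this
  have hGi : Integrable G :=
    (hI.const_mul M).mono' hGc.aestronglyMeasurable (Filter.Eventually.of_forall hGb)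
  have hswap : ∫ β, G β = ((∫ x in (0:ℝ)..M, max (N - |F x|) 0 : ℝ) : ℂ) := by
    rw [hG]
    simp_rw [intervalIntegral.integral_of_le hM, ← integral_const_mul]
    rw [integral_integral_swap]
    · simp_rw [tri_inv N _ hN]
      unfold tri
      exact integral_ofReal
    · have : IsFiniteMeasure (volume.restrict (Set.Ioc 0 M)) := by infer_instance
      refine (hI.comp_fst (volume.restrict (Set.Ioc 0 M))).mono' ?_ ?_
      · apply Continuous.aestronglyMeasurable
        have h1 := SJ_continuous N
        unfold Function.uncurry
        fun_prop
      · refine Filter.Eventually.of_forall ?_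
        rintro ⟨β, x⟩
        simp only [Function.uncurry]
        rw [norm_mul, hnorm, mul_one, Complex.norm_real, Real.norm_of_nonneg (by positivity)]
  rw [← hswap, ← integral_add_compl (measurableSet_Ioo (a := -δ) (b := δ)) hGi, sub_add_cancel_left, norm_neg]
  calc _ ≤ ∫ β in (Set.Ioo (-δ) δ)ᶜ, M * ‖SJ N β‖ ^ 2 :=
        norm_integral_le_of_norm_le (hI.const_mul M).integrableOn (Filter.Eventually.of_forall hGb)
    _ = M * ∫ β in (Set.Ioo (-δ) δ)ᶜ, ‖SJ N β‖ ^ 2 := integral_const_mul _ _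
    _ ≤ _ := by gcongr; exact tail_bound N δ hδ

lemma poly_bound (f : Polynomial ℤ) (k : ℕ) (hk : 1 ≤ k) (hdeg : f.natDegree = k) :
    ∃ C : ℝ, 0 ≤ C ∧ ∀ M x : ℝ, 1 ≤ M → 0 ≤ x → x ≤ M →
      |(Polynomial.aeval x f : ℝ) - f.leadingCoeff * x ^ k| ≤ C * M ^ (k - 1) := by
  refine ⟨∑ i ∈ Finset.range k, |(f.eraseLead.coeff i : ℝ)|, by positivity, ?_⟩
  intro M x hM hx hxM
  have h : (Polynomial.aeval x f : ℝ) = Polynomial.aeval x f.eraseLead + f.leadingCoeff * x ^ k := by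
    conv_lhs => rw [← Polynomial.eraseLead_add_C_mul_X_pow f]
    rw [hdeg]
    simp
  have hd : f.eraseLead.natDegree < k := by
    have := Polynomial.eraseLead_natDegree_le f
    omega
  rw [h, add_sub_cancel_right, Polynomial.aeval_eq_sum_range' hd, Finset.sum_mul]
  refine (Finset.abs_sum_le_sum_abs _ _).trans (Finset.sum_le_sum fun i hi => ?_)
  rw [zsmul_eq_mul, abs_mul, abs_of_nonneg (pow_nonneg hx i)]
  gcongr
  have : i ≤ k - 1 := by have := Finset.mem_range.mp hi; omega
  calc x ^ i ≤ M ^ i := by gcongr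
    _ ≤ _ := pow_le_pow_right₀ hM this

lemma int_bound (F : ℝ → ℝ) (hF : Continuous F) (k : ℕ) (c N M E : ℝ) (hc : 0 < c)
    (hM : 0 ≤ M) (hMN : c * M ^ k = N)
    (hE : ∀ x, 0 ≤ x → x ≤ M → |F x - c * x ^ k| ≤ E) :
    |(∫ x in (0:ℝ)..M, max (N - |F x|) 0) - (k : ℝ) / (k + 1) * M * N| ≤ E * M := by
  have h1 : ∫ x in (0:ℝ)..M, (N - c * x ^ k) = (k : ℝ) / (k + 1) * M * N := by
    rw [intervalIntegral.integral_sub (by simp) (by apply Continuous.intervalIntegrable; fun_prop),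
      intervalIntegral.integral_const_mul, integral_pow, intervalIntegral.integral_const]
    rw [← hMN]
    simp
    field_simp
    ring
  rw [← h1, ← intervalIntegral.integral_sub (by apply Continuous.intervalIntegrable; fun_prop)
    (by apply Continuous.intervalIntegrable; fun_prop)]
  have := intervalIntegral.norm_integral_le_of_norm_le_const (a := 0) (b := M) (C := E)
    (f := fun x => max (N - |F x|) 0 - (N - c * x ^ k)) (by
      intro x hx
      rw [Set.uIoc_of_le hM] at hx
      have hcx : 0 ≤ c * x ^ k := mul_nonneg hc.le (pow_nonneg hx.1.le _)
      have hcx2 : c * x ^ k ≤ N := by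
        rw [← hMN]; gcongr; exacts [hx.1.le, hx.2]
      have e : N - c * x ^ k = max (N - |c * x ^ k|) 0 := by
        rw [abs_of_nonneg hcx, max_eq_left (by linarith)]
      rw [e, Real.norm_eq_abs]
      refine (abs_max_sub_max_le_abs _ _ _).trans ?_
      rw [sub_sub_sub_cancel_left, abs_sub_comm]
      exact (abs_abs_sub_abs_le_abs_sub _ _).trans (hE x hx.1.le hx.2))
  simpa [abs_of_nonneg hM] using this

theorem stmt10 (f : Polynomial ℤ) (k : ℕ) (hk : 1 ≤ k)
    (hdeg : f.natDegree = k) (hlead : 0 < f.leadingCoeff) (B : ℝ) (hB : 0 < B) :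
    (fun N : ℕ =>
        (∫ β in Set.Ioo (-(Real.log N ^ B / N)) (Real.log N ^ B / N),
          (‖∫ y in (0:ℝ)..(N : ℝ), Complex.exp (-2 * Real.pi * Complex.I * y * β)‖ ^ 2 : ℂ) *
            ∫ x in (0:ℝ)..(Mreal f k N),
              Complex.exp (2 * Real.pi * Complex.I * (Polynomial.aeval x f : ℝ) * β))
          - (((k : ℝ) / (k + 1) * Mreal f k N * N : ℝ) : ℂ))
      =O[atTop]
    (fun N : ℕ => Mreal f k N * N / Real.log N ^ B) := by
  obtain ⟨C, hC, hCb⟩ := poly_bound f k hk hdeg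
  set c : ℝ := (f.leadingCoeff : ℝ) with hcdef
  have hc : 0 < c := by rw [hcdef]; exact_mod_cast hlead
  have hk0 : (0:ℝ) < k := by exact_mod_cast hk
  have hlog : ∀ᶠ N : ℕ in atTop, Real.log N ^ B ≤ (N:ℝ) ^ ((1:ℝ) / k) := by
    have h := (isLittleO_log_rpow_rpow_atTop (s := 1 / k) B (by positivity)).comp_tendsto
      (tendsto_natCast_atTop_atTop (R := ℝ))
    filter_upwards [h.bound one_pos] with N hN
    simp only [Function.comp, one_mul] at hN
    rw [Real.norm_of_nonneg (by positivity : (0:ℝ) ≤ (N:ℝ) ^ ((1:ℝ) / k))] at hN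
    exact (le_abs_self _).trans hN
  set D : ℝ := c ^ ((1:ℝ) / k) with hD
  have hDpos : 0 < D := Real.rpow_pos_of_pos hc _
  refine IsBigO.of_bound (2 + C / c * D) ?_
  have hbig : ∀ᶠ N : ℕ in atTop, c ≤ (N:ℝ) :=
    (tendsto_natCast_atTop_atTop (R := ℝ)).eventually_ge_atTop c
  filter_upwards [hlog, hbig, eventually_ge_atTop 3] with N hN1 hN2 hN3
  have hNpos : (0:ℝ) < N := by positivity
  have hL : 0 < Real.log N := Real.log_pos (by exact_mod_cast (by omega : 1 < N))
  have hLB : 0 < Real.log N ^ B := Real.rpow_pos_of_pos hL B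
  set L := Real.log N ^ B with hLdef
  set M := Mreal f k N with hMdef
  have hM1 : 1 ≤ M := by
    rw [hMdef, Mreal]
    exact Real.one_le_rpow ((one_le_div hc).mpr hN2) (by positivity)
  have hMk : c * M ^ k = N := by
    rw [hMdef, Mreal, one_div, Real.rpow_inv_natCast_pow (by positivity) (by omega), ← hcdef]
    field_simp
  have hMD : M * D = (N:ℝ) ^ ((1:ℝ) / k) := by
    rw [hMdef, Mreal, hD, ← Real.mul_rpow (by positivity) hc.le, div_mul_cancel₀ _ hc.ne']
  have hFc : Continuous fun x : ℝ => (Polynomial.aeval x f : ℝ) := by fun_prop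
  have b1 := main_bound (fun x => (Polynomial.aeval x f : ℝ)) hFc N (L / N) M hNpos
    (by positivity) (by linarith)
  have b2 := int_bound (fun x => (Polynomial.aeval x f : ℝ)) hFc k c N M (C * M ^ (k-1)) hc
    (by linarith) hMk (fun x hx hx' => hCb M x hM1 hx hx')
  have b2' : ‖((∫ x in (0:ℝ)..M, max ((N:ℝ) - |(Polynomial.aeval x f : ℝ)|) 0 : ℝ) : ℂ) -
      (((k : ℝ) / (k + 1) * M * N : ℝ) : ℂ)‖ ≤ C * M ^ (k-1) * M := by
    rw [← Complex.ofReal_sub, Complex.norm_real]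
    exact b2
  have b3 : C * M ^ (k-1) * M ≤ C / c * D * (M * N / L) := by
    have : C * M ^ (k-1) * M = C / c * N := by
      rw [mul_assoc, ← pow_succ, Nat.sub_add_cancel hk, ← hMk]; field_simp
    rw [this, mul_assoc]
    gcongr
    rw [← mul_div_assoc, le_div_iff₀ hLB]
    nlinarith [hMD]
  rw [Real.norm_of_nonneg (by positivity : 0 ≤ M * N / L), add_mul]
  have b4 := norm_add_le_of_le b1 (b2'.trans b3)
  rw [sub_add_sub_cancel] at b4
  have e : M * (2 / (L / N)) = 2 * (M * N / L) := by field_simp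
  rw [e] at b4
  simpa only [SJ, Complex.ofReal_pow] using b4
end
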